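/- The metric space (𝓛, d) is unbounded: for every R > 0 there exists φ ∈ Ham(B) such that d(L₀, φ(L₀)) > R. -/

import Mathlib

open Set

noncomputable section

/-- Phase space ℝ^{2n}, written as pairs (x, y) with x, y ∈ ℝⁿ. -/
abbrev Phase (n : ℕ) := EuclideanSpace ℝ (Fin n) × EuclideanSpace ℝ (Fin n)

/-- Squared Euclidean norm on phase space. -/
def quadNorm {n : ℕ} (p : Phase n) : ℝ := ‖p.1‖ ^ 2 + ‖p.2‖ ^ 2

/-- The open ball `B` of radius `1/√π` centered at the origin. -/
def BallB (n : ℕ) : Set (Phase n) := {p | quadNorm p < 1 / Real.pi}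

/-- The standard Lagrangian L₀ = {y = 0} ∩ B. -/
def L0 (n : ℕ) : Set (Phase n) := {p | p ∈ BallB n ∧ p.2 = 0}

/-- The Hamiltonian vector field X_{H_t} = (∂H/∂y, −∂H/∂x). -/
def hamVF {n : ℕ} (H : ℝ → Phase n → ℝ) (t : ℝ) (p : Phase n) : Phase n :=
  (gradient (fun y => H t (p.1, y)) p.2, - gradient (fun x => H t (x, p.2)) p.1)

/-- `H ∈ C_c^∞([0,1]×B)`: smooth, and spatially supported in a compact subset of `B`. -/
structure IsHamiltonian (n : ℕ) (H : ℝ → Phase n → ℝ) : Prop where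
  smooth : ContDiff ℝ (⊤ : ℕ∞) (fun q : ℝ × Phase n => H q.1 q.2)
  support : ∃ K : Set (Phase n), IsCompact K ∧ K ⊆ BallB n ∧ ∀ t p, p ∉ K → H t p = 0

/-- `φ` is the Hamiltonian flow of `H`. -/
structure IsHamFlow (n : ℕ) (H : ℝ → Phase n → ℝ) (φ : ℝ → Phase n → Phase n) : Prop where
  init : ∀ p, φ 0 p = p
  deriv : ∀ p t, HasDerivAt (fun s => φ s p) (hamVF H t (φ t p)) t
  smooth : ContDiff ℝ (⊤ : ℕ∞) (fun q : ℝ × Phase n => φ q.1 q.2)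

/-- The group `Ham(B)` of time-1 maps of Hamiltonian flows. -/
def Ham (n : ℕ) : Set (Phase n → Phase n) :=
  {f | ∃ H φ, IsHamiltonian n H ∧ IsHamFlow n H φ ∧ φ 1 = f}

/-- The Hofer length `‖H‖_{(1,∞)} = ∫₀¹ (max H_t − min H_t) dt`. -/
def oscNorm (n : ℕ) (H : ℝ → Phase n → ℝ) : ℝ :=
  ∫ t in (0:ℝ)..1, ((⨆ p, H t p) - (⨅ p, H t p))

/-- The Hofer norm on `Ham(B)`. -/
def hoferNorm (n : ℕ) (f : Phase n → Phase n) : ℝ :=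
  sInf {c | ∃ H φ, IsHamiltonian n H ∧ IsHamFlow n H φ ∧ φ 1 = f ∧ c = oscNorm n H}

/-- The space 𝓛 of Lagrangians Hamiltonian isotopic to L₀ in B. -/
def LagSet (n : ℕ) : Set (Set (Phase n)) := {L | ∃ f ∈ Ham n, f '' L0 n = L}

/-- The Lagrangian Hofer distance. -/
def lagd (n : ℕ) (L₁ L₂ : Set (Phase n)) : ℝ :=
  sInf {c | ∃ f ∈ Ham n, f '' L₁ = L₂ ∧ c = hoferNorm n f}

/-- A smooth real function compactly supported in the open interval (a, b). -/
def IsProfile (a b : ℝ) (f : ℝ → ℝ) : Prop :=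
  ContDiff ℝ (⊤ : ℕ∞) f ∧ HasCompactSupport f ∧ tsupport f ⊆ Ioo a b

/-- `f̃(z) = f(π |z|²)`. -/
def tilde (n : ℕ) (f : ℝ → ℝ) (p : Phase n) : ℝ := f (Real.pi * quadNorm p)

/-- The sup norm distance `‖f − g‖_∞`. -/
def supDist (f g : ℝ → ℝ) : ℝ := ⨆ t, |f t - g t|



open Set
noncomputable section PartM1

/-! ### Borsuk–Ulam via mod 2 chains of affine simplices (lists of points) -/

namespace BU

variable {E : Type*}

abbrev Ch (E : Type*) := List E →₀ ZMod 2

def sg (l : List E) : Ch E := Finsupp.single l 1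

def cone (v : E) : Ch E →ₗ[ZMod 2] Ch E := Finsupp.lmapDomain _ _ (List.cons v)

def bd : List E → Ch E
  | [] => 0
  | v :: l => sg l + cone v (bd l)

def ext (f : List E → Ch E) : Ch E →ₗ[ZMod 2] Ch E := Finsupp.linearCombination (ZMod 2) f

def ev (f : List E → ZMod 2) : Ch E →ₗ[ZMod 2] ZMod 2 := Finsupp.linearCombination (ZMod 2) f

@[simp] lemma ext_sg (f : List E → Ch E) (l : List E) : ext f (sg l) = f l := by
  simp [ext, sg]

@[simp] lemma ev_sg (f : List E → ZMod 2) (l : List E) : ev f (sg l) = f l := by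
  simp [ev, sg]

@[simp] lemma cone_sg (v : E) (l : List E) : cone v (sg l) = sg (v :: l) := by
  simp [cone, sg]

lemma add_self (c : Ch E) : c + c = 0 := by
  have h : (1 + 1 : ZMod 2) • c = 0 := by
    have : (1 + 1 : ZMod 2) = 0 := by decide
    rw [this, zero_smul]
  rwa [add_smul, one_smul] at h

def bdL : Ch E →ₗ[ZMod 2] Ch E := ext bd

@[simp] lemma bdL_sg (l : List E) : bdL (sg l) = bd l := by simp [bdL]

def Gen (P : List E → Prop) : Submodule (ZMod 2) (Ch E) :=
  Submodule.span (ZMod 2) {c | ∃ l, P l ∧ c = sg l}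

lemma sg_mem {P : List E → Prop} {l : List E} (h : P l) : sg l ∈ Gen P :=
  Submodule.subset_span ⟨l, h, rfl⟩

lemma Gen_mono {P Q : List E → Prop} (h : ∀ l, P l → Q l) : Gen P ≤ Gen Q := by
  apply Submodule.span_mono
  rintro c ⟨l, hl, rfl⟩
  exact ⟨l, h l hl, rfl⟩

/-- Linear maps send generated submodules to submodules. -/
lemma map_mem {P : List E → Prop} {M : Type*} [AddCommGroup M] [Module (ZMod 2) M]
    (f : Ch E →ₗ[ZMod 2] M) (S : Submodule (ZMod 2) M) (h : ∀ l, P l → f (sg l) ∈ S)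
    {c : Ch E} (hc : c ∈ Gen P) : f c ∈ S := by
  have : Gen P ≤ S.comap f := by
    apply Submodule.span_le.2
    rintro c ⟨l, hl, rfl⟩
    exact h l hl
  exact this hc

lemma eq_on {P : List E → Prop} {M : Type*} [AddCommGroup M] [Module (ZMod 2) M]
    (f g : Ch E →ₗ[ZMod 2] M) (h : ∀ l, P l → f (sg l) = g (sg l))
    {c : Ch E} (hc : c ∈ Gen P) : f c = g c := by
  have := map_mem (f - g) ⊥ (fun l hl => by simp [h l hl]) hc
  simpa [sub_eq_zero] using this

lemma mem_top (c : Ch E) : c ∈ Gen (fun _ : List E => True) := by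
  induction c using Finsupp.induction_linear with
  | zero => exact Submodule.zero_mem _
  | add f g hf hg => exact Submodule.add_mem _ hf hg
  | single l b =>
    have : Finsupp.single l b = b • sg l := by simp [sg]
    rw [this]
    exact Submodule.smul_mem _ _ (sg_mem trivial)

lemma eq_all {M : Type*} [AddCommGroup M] [Module (ZMod 2) M]
    (f g : Ch E →ₗ[ZMod 2] M) (h : ∀ l, f (sg l) = g (sg l)) (c : Ch E) : f c = g c :=
  eq_on f g (fun l _ => h l) (mem_top c)

lemma bdL_cone (v : E) (c : Ch E) : bdL (cone v c) = c + cone v (bdL c) := by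
  have := eq_all (bdL.comp (cone v)) (LinearMap.id + (cone v).comp bdL)
    (fun l => by simp [bd]) c
  simpa using this

lemma bd_bd (l : List E) : bdL (bd l) = 0 := by
  induction l with
  | nil => simp [bd]
  | cons v l ih => simp [bd, bdL_cone, ih, add_self]

lemma bd_mem (l : List E) (P : List E → Prop)
    (h : ∀ l', l'.length + 1 = l.length → (∀ v ∈ l', v ∈ l) → P l') : bd l ∈ Gen P := by
  induction l generalizing P with
  | nil => simp [bd]
  | cons v l ih =>
    refine Submodule.add_mem _ (sg_mem (h _ rfl (fun w hw => List.mem_cons_of_mem _ hw))) ?_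
    refine map_mem (P := fun l' => P (v :: l')) (cone v) (Gen P) ?_ ?_
    · intro l' hl'
      rw [cone_sg]
      exact sg_mem hl'
    · apply ih
      intro l' h1 h2
      apply h
      · simp [h1]
      · intro w hw
        rcases List.mem_cons.1 hw with rfl | hw
        · simp
        · exact List.mem_cons_of_mem _ (h2 w hw)

section cochain
variable (σ : ℕ → E → ZMod 2)

def w : ℕ → List E → ZMod 2
  | _, [] => 0
  | _, [_] => 1
  | j, v :: u :: l => (σ j v + σ j u) * w (j + 1) (u :: l)

def al (j : ℕ) : List E → ZMod 2
  | [] => 0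
  | v :: l => σ j v * w σ (j + 1) (v :: l)

lemma ev_al_cone (j : ℕ) (v : E) (c : Ch E) :
    ev (al σ j) (cone v c) = σ j v * ev (w σ (j + 1)) (cone v c) := by
  have := eq_all ((ev (al σ j)).comp (cone v)) ((σ j v) • ((ev (w σ (j+1))).comp (cone v)))
    (fun l => by simp [al]) c
  simpa using this

lemma coc (k : ℕ) : (∀ j (l : List E), l.length = k + 2 → ev (w σ j) (bd l) = 0) ∧
    (∀ j (l : List E), l.length = k + 2 → ev (al σ j) (bd l) = w σ j l) := by
  have key : ∀ k, (∀ j (l : List E), l.length = k + 2 → ev (w σ j) (bd l) = 0) →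
      (∀ j (l : List E), l.length = k + 2 → ev (al σ j) (bd l) = w σ j l) := by
    intro k hk j l hl
    match l, hl with
    | v :: u :: l, hl =>
      have h1 := hk (j + 1) (v :: u :: l) hl
      rw [bd, map_add, ev_sg] at h1
      have h2 : ev (w σ (j + 1)) (cone v (bd (u :: l))) = w σ (j + 1) (u :: l) := by
        rw [← sub_eq_zero, CharTwo.sub_eq_add, add_comm]; exact h1
      rw [bd, map_add, ev_sg, ev_al_cone, h2]
      simp only [al, w]
      ring
  induction k with
  | zero =>
    have : ∀ j (l : List E), l.length = 0 + 2 → ev (w σ j) (bd l) = 0 := by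
      intro j l hl
      match l, hl with
      | [v, u], _ =>
        simp [bd, w]
        decide
    exact ⟨this, key 0 this⟩
  | succ k ih =>
    have : ∀ j (l : List E), l.length = k + 1 + 2 → ev (w σ j) (bd l) = 0 := by
      intro j l hl
      have h1 : bd l ∈ Gen (fun l' : List E => l'.length = k + 2) :=
        bd_mem l _ (fun l' h _ => by omega)
      have h2 := eq_on (ev (w σ j)) ((ev (al σ j)).comp bdL)
        (fun l' hl' => by simp [ih.2 j l' hl']) h1
      rw [h2]
      simp [bd_bd]
    exact ⟨this, key _ this⟩

variable [AddCommGroup E]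

def nu : Ch E →ₗ[ZMod 2] Ch E := Finsupp.lmapDomain _ _ (List.map Neg.neg)

@[simp] lemma nu_sg (l : List E) : nu (sg l) = sg (l.map Neg.neg) := by simp [nu, sg]

lemma nu_cone (v : E) (c : Ch E) : nu (cone v c) = cone (-v) (nu c) := by
  have := eq_all (nu.comp (cone v)) ((cone (-v)).comp nu) (fun l => by simp) c
  simpa using this

lemma bd_nu (l : List E) : bd (l.map Neg.neg) = nu (bd l) := by
  induction l with
  | nil => simp [bd]
  | cons v l ih => simp [bd, ih, nu_cone]

variable (hσ : ∀ j v, v ≠ 0 → σ j (-v) = σ j v + 1)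
include hσ

lemma w_neg (j : ℕ) (l : List E) (hl : ∀ v ∈ l, v ≠ 0) : w σ j (l.map Neg.neg) = w σ j l := by
  induction l generalizing j with
  | nil => simp [w]
  | cons v l ih =>
    match l with
    | [] => simp [w]
    | u :: l =>
      have h := ih (j + 1) (fun x hx => hl x (List.mem_cons_of_mem _ hx))
      simp only [List.map_cons] at h ⊢
      simp only [w, h]
      rw [hσ j v (hl v (by simp)), hσ j u (hl u (by simp))]
      have h2 : (1 : ZMod 2) + 1 = 0 := by decide
      linear_combination (w σ (j + 1) (u :: l)) * h2

lemma al_neg (j : ℕ) (c : Ch E)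
    (hc : c ∈ Gen (fun l : List E => ∀ v ∈ l, v ≠ 0)) :
    ev (al σ j) (nu c) = ev (al σ j) c + ev (w σ (j + 1)) c := by
  have := eq_on ((ev (al σ j)).comp nu) (ev (al σ j) + ev (w σ (j+1)))
    (fun l hl => by
      match l with
      | [] => simp [al, w]
      | v :: l =>
        have h := w_neg σ hσ (j + 1) (v :: l) hl
        simp only [List.map_cons] at h
        simp only [LinearMap.comp_apply, nu_sg, List.map_cons, ev_sg, LinearMap.add_apply]
        simp only [al, h]
        rw [hσ j v (hl v (by simp))]
        ring) hc
  simpa using this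

end cochain

section sd
variable [NormedAddCommGroup E] [NormedSpace ℝ E]

def bary (l : List E) : E := ((l.length : ℝ)⁻¹) • l.sum

def Sd : ℕ → (Ch E →ₗ[ZMod 2] Ch E)
  | 0 => LinearMap.id
  | k + 1 => ext (fun l => cone (bary l) (Sd k (bd l)))

lemma Sd_zero (c : Ch E) : Sd 0 c = c := rfl

lemma Sd_succ_sg (k : ℕ) (l : List E) : Sd (k + 1) (sg l) = cone (bary l) (Sd k (bd l)) := by
  simp [Sd]

lemma bdL_Sd (k : ℕ) : ∀ c ∈ Gen (fun l : List E => l.length = k + 1),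
    bdL (Sd (k + 1) c) = Sd k (bdL c) := by
  induction k with
  | zero =>
    intro c hc
    have := eq_on (bdL.comp (Sd 1)) ((Sd 0).comp bdL) (fun l hl => by
      rw [LinearMap.comp_apply, LinearMap.comp_apply]
      match l, hl with
      | [v], _ => simp [Sd_succ_sg, bd, Sd_zero]) hc
    rwa [LinearMap.comp_apply, LinearMap.comp_apply] at this
  | succ k ih =>
    intro c hc
    have := eq_on (bdL.comp (Sd (k + 1 + 1))) ((Sd (k + 1)).comp bdL) (fun l hl => by
      have h1 : bd l ∈ Gen (fun l' : List E => l'.length = k + 1) :=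
        bd_mem l _ (fun l' h _ => by omega)
      rw [LinearMap.comp_apply, LinearMap.comp_apply, Sd_succ_sg, bdL_cone, ih _ h1, bd_bd,
        bdL_sg, map_zero, map_zero, add_zero]) hc
    rwa [LinearMap.comp_apply, LinearMap.comp_apply] at this

lemma bary_neg (l : List E) : bary (l.map Neg.neg) = - bary l := by
  have : (l.map Neg.neg).sum = - l.sum := by
    induction l with
    | nil => simp
    | cons v l ih => simp [ih]; abel
  simp [bary, this]

lemma Sd_nu (k : ℕ) (c : Ch E) : Sd k (nu c) = nu (Sd k c) := by
  induction k generalizing c with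
  | zero => simp [Sd]
  | succ k ih =>
    have := eq_all ((Sd (k+1)).comp nu) (nu.comp (Sd (k+1)))
      (fun l => by
        simp only [LinearMap.comp_apply, nu_sg, Sd_succ_sg, bd_nu, ih, nu_cone, bary_neg]) c
    simpa using this

lemma bary_mem (l : List E) (hl : l ≠ []) : bary l ∈ convexHull ℝ {v | v ∈ l} := by
  have hpos : (0 : ℝ) < l.length := by
    have := List.length_pos_of_ne_nil hl
    exact_mod_cast this
  have h : ∀ l' : List E, (∀ v ∈ l', v ∈ l) → l' ≠ [] →
      ((l'.length : ℝ)⁻¹) • l'.sum ∈ convexHull ℝ {v | v ∈ l} := by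
    intro l'
    induction l' with
    | nil => simp
    | cons v l' ih =>
      intro h1 _
      have hv : v ∈ convexHull ℝ {v | v ∈ l} := subset_convexHull _ _ (h1 v (by simp))
      by_cases h2 : l' = []
      · subst h2; simpa using hv
      · have h3 := ih (fun u hu => h1 u (List.mem_cons_of_mem _ hu)) h2
        have hp : (0 : ℝ) < l'.length := by
          have := List.length_pos_of_ne_nil h2
          exact_mod_cast this
        have h4 := (convex_convexHull ℝ {v | v ∈ l}) hv h3
          (a := ((l'.length : ℝ) + 1)⁻¹) (b := (l'.length : ℝ) / (l'.length + 1))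
          (by positivity) (by positivity) (by field_simp; ring)
        convert h4 using 1
        rw [List.length_cons, List.sum_cons, smul_add, smul_smul]
        push_cast
        congr 2
        field_simp
  exact h l (fun _ h => h) hl

lemma bary_dist (l : List E) (ρ : ℝ) (m : ℕ) (hm : l.length ≤ m) (hρ : 0 ≤ ρ)
    (h : ∀ v ∈ l, ∀ u ∈ l, ‖v - u‖ ≤ ρ) (v : E) (hv : v ∈ l) :
    ‖bary l - v‖ ≤ (1 - (m : ℝ)⁻¹) * ρ := by
  have hpos : (0 : ℝ) < l.length := by
    have := List.length_pos_of_mem hv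
    exact_mod_cast this
  have h1 : ∀ l' : List E, (∀ u ∈ l', u ∈ l) → ‖l'.sum - (l'.length : ℝ) • v‖ ≤ l'.length * ρ := by
    intro l'
    induction l' with
    | nil => simp
    | cons u l' ih =>
      intro h1
      have h3 := ih (fun u hu => h1 u (List.mem_cons_of_mem _ hu))
      have h4 := h u (h1 u (by simp)) v hv
      have : (u :: l').sum - ((u :: l').length : ℝ) • v
        = (u - v) + (l'.sum - (l'.length : ℝ) • v) := by
        simp [add_smul]; abel
      rw [this]
      refine (norm_add_le _ _).trans ?_
      push_cast [List.length_cons]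
      linarith
  obtain ⟨l1, l2, rfl⟩ := List.append_of_mem hv
  have h2 := h1 (l1 ++ l2) (by intro u hu; simp at hu ⊢; tauto)
  set k : ℝ := ((l1 ++ v :: l2).length : ℝ) with hk
  have hk' : ((l1 ++ l2).length : ℝ) = k - 1 := by rw [hk]; simp; ring
  have h3 : bary (l1 ++ v :: l2) - v = k⁻¹ • ((l1 ++ l2).sum - (k - 1) • v) := by
    rw [bary, ← hk, smul_sub, smul_smul]
    have : k⁻¹ * (k - 1) = 1 - k⁻¹ := by field_simp
    rw [this, sub_smul, one_smul]
    simp [smul_add]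
    abel
  rw [hk'] at h2
  rw [h3, norm_smul, norm_inv, Real.norm_of_nonneg hpos.le]
  have hkm : (m : ℝ)⁻¹ ≤ k⁻¹ := by
    apply inv_anti₀ hpos
    rw [hk]
    exact_mod_cast hm
  calc k⁻¹ * ‖(l1 ++ l2).sum - (k - 1) • v‖ ≤ k⁻¹ * ((k - 1) * ρ) := by gcongr
    _ = (1 - k⁻¹) * ρ := by field_simp
    _ ≤ _ := by gcongr

lemma Sd_small (m : ℕ) (ρ : ℝ) (hρ : 0 ≤ ρ) (k : ℕ) : ∀ l : List E, l.length = k + 1 → k + 1 ≤ m →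
    (∀ v ∈ l, ∀ u ∈ l, ‖v - u‖ ≤ ρ) →
    Sd (k + 1) (sg l) ∈ Gen (fun l' : List E => l'.length = k + 1 ∧
      (∀ v ∈ l', v ∈ convexHull ℝ {v | v ∈ l}) ∧
      (∀ v ∈ l', ∀ u ∈ l', ‖v - u‖ ≤ (1 - (m : ℝ)⁻¹) * ρ)) := by
  have hball : ∀ (l : List E) (m : ℕ), l.length ≤ m → (∀ v ∈ l, ∀ u ∈ l, ‖v - u‖ ≤ ρ) →
      ∀ x ∈ convexHull ℝ {v | v ∈ l}, ‖bary l - x‖ ≤ (1 - (m : ℝ)⁻¹) * ρ := by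
    intro l m hm h x hx
    have : convexHull ℝ {v | v ∈ l} ⊆ Metric.closedBall (bary l) ((1 - (m : ℝ)⁻¹) * ρ) := by
      apply convexHull_min
      · intro v hv
        rw [Metric.mem_closedBall, dist_comm, dist_eq_norm]
        exact bary_dist l ρ m hm hρ h v hv
      · exact convex_closedBall _ _
    have := this hx
    rwa [Metric.mem_closedBall, dist_comm, dist_eq_norm] at this
  induction k with
  | zero =>
    intro l hl hm h
    match l, hl with
    | [v], _ =>
      have : Sd 1 (sg [v]) = sg [v] := by simp [Sd_succ_sg, bd, Sd, bary]
      rw [this]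
      apply sg_mem
      have hm1 : (1 : ℝ) ≤ m := by exact_mod_cast hm
      have : (m : ℝ)⁻¹ ≤ 1 := inv_le_one_of_one_le₀ hm1
      simp
      apply mul_nonneg _ hρ
      linarith
  | succ k ih =>
    intro l hl hm h
    rw [Sd_succ_sg]
    set Q : List E → Prop := fun l' : List E => l'.length = k + 1 ∧
      (∀ v ∈ l', v ∈ convexHull ℝ {v | v ∈ l}) ∧
      (∀ v ∈ l', ∀ u ∈ l', ‖v - u‖ ≤ (1 - (m : ℝ)⁻¹) * ρ) with hQ
    have h1 : Sd (k + 1) (bd l) ∈ Gen Q := by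
      refine map_mem (P := fun l' : List E => l'.length = k + 1 ∧ ∀ v ∈ l', v ∈ l) _ _ ?_
        (bd_mem l _ (fun l' h1 h2 => ⟨by omega, h2⟩))
      rintro l' ⟨h1, h2⟩
      refine Gen_mono ?_ (ih l' h1 (by omega) (fun v hv u hu => h v (h2 v hv) u (h2 u hu)))
      rintro l'' ⟨g1, g2, g3⟩
      exact ⟨g1, fun v hv => convexHull_mono (fun u hu => h2 u hu) (g2 v hv), g3⟩
    refine map_mem (cone (bary l)) _ ?_ h1
    rintro l' ⟨g1, g2, g3⟩
    rw [cone_sg]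
    have hne : l ≠ [] := by rintro rfl; simp at hl
    have hb := hball l m (by omega) h
    refine sg_mem ⟨by simp [g1], ?_, ?_⟩
    · intro v hv
      rcases List.mem_cons.1 hv with rfl | hv
      · exact bary_mem l hne
      · exact g2 v hv
    · intro v hv u hu
      rcases List.mem_cons.1 hv with rfl | hv <;> rcases List.mem_cons.1 hu with rfl | hu
      · rw [sub_self, norm_zero]
        have := hb _ (bary_mem l hne)
        rwa [sub_self, norm_zero] at this
      · exact hb u (g2 u hu)
      · rw [norm_sub_rev]; exact hb v (g2 v hv)
      · exact g3 v hv u hu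

end sd

end BU
end PartM1

open Set
noncomputable section PartM1b

namespace BU

lemma w_const {E : Type*} (σ : ℕ → E → ZMod 2) (l : List E) (i j : ℕ)
    (hl : j + 2 ≤ l.length) (h : ∀ v ∈ l, ∀ u ∈ l, σ (i + j) v = σ (i + j) u) : w σ i l = 0 := by
  induction j generalizing i l with
  | zero =>
    match l, hl with
    | v :: u :: l, hl =>
      have := h v (by simp) u (by simp)
      simp only [add_zero] at this
      simp [w, this, CharTwo.add_self_eq_zero]
  | succ j ih =>
    match l, hl with
    | v :: u :: l, hl =>
      have := ih (u :: l) (i + 1) (by simp at hl ⊢; omega) (fun a ha b hb => by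
        have := h a (List.mem_cons_of_mem _ ha) b (List.mem_cons_of_mem _ hb)
        rwa [show i + 1 + j = i + (j + 1) by ring])
      simp [w, this]

section oct
variable {m : ℕ}

/-- standard basis vectors -/
def be (m : ℕ) (i : ℕ) : Fin m → ℝ := fun j => if (j : ℕ) = i then 1 else 0

def oc (m : ℕ) : ℕ → Ch (Fin m → ℝ)
  | 0 => sg []
  | i + 1 => cone (be m i) (oc m i) + cone (- be m i) (oc m i)

def oh (m : ℕ) (i : ℕ) : Ch (Fin m → ℝ) := cone (be m i) (oc m i)

lemma nu_oc (i : ℕ) : nu (oc m i) = oc m i := by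
  induction i with
  | zero => simp [oc]
  | succ i ih => simp [oc, nu_cone, ih, add_comm]

lemma oc_succ (i : ℕ) : oc m (i + 1) = oh m i + nu (oh m i) := by
  simp [oh, oc, nu_cone, nu_oc]

lemma bd_oc (i : ℕ) : bdL (oc m i) = 0 := by
  induction i with
  | zero => simp [oc, bd]
  | succ i ih => simp [oc, bdL_cone, ih, add_self]

lemma bd_oh (i : ℕ) : bdL (oh m i) = oc m i := by
  simp [oh, bdL_cone, bd_oc]

def Tl (m : ℕ) (i : ℕ) (l : List (Fin m → ℝ)) : Prop :=
  l.length = i ∧ ∃ ε : ℕ → ℝ, (∀ j, |ε j| = 1) ∧ ∀ v ∈ l, ∃ j < i, v = ε j • be m j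

lemma cone_Tl (i : ℕ) (s : ℝ) (hs : |s| = 1) (c : Ch (Fin m → ℝ)) (hc : c ∈ Gen (Tl m i)) :
    cone (s • be m i) c ∈ Gen (Tl m (i + 1)) := by
  refine map_mem _ _ ?_ hc
  rintro l ⟨hl, ε, he, h⟩
  rw [cone_sg]
  refine sg_mem ⟨by simp [hl], Function.update ε i s, ?_, ?_⟩
  · intro j
    by_cases hj : j = i
    · subst hj; simpa using hs
    · simp [hj, he]
  · intro v hv
    rcases List.mem_cons.1 hv with rfl | hv
    · exact ⟨i, by omega, by simp⟩
    · obtain ⟨j, hj, rfl⟩ := h v hv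
      exact ⟨j, by omega, by rw [Function.update_of_ne (by omega)]⟩

lemma oc_Tl (i : ℕ) : oc m i ∈ Gen (Tl m i) := by
  induction i with
  | zero => exact sg_mem ⟨rfl, fun _ => 1, by simp, by simp⟩
  | succ i ih =>
    refine Submodule.add_mem _ ?_ ?_
    · simpa using cone_Tl i 1 (by simp) _ ih
    · simpa using cone_Tl i (-1) (by simp) _ ih

lemma oh_Tl (i : ℕ) : oh m i ∈ Gen (Tl m (i + 1)) := by
  simpa [oh] using cone_Tl i 1 (by simp) _ (oc_Tl (m := m) i)

/-- a face (hyperplane piece) of the octahedron -/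
def Cf (m : ℕ) (ε : ℕ → ℝ) : Set (Fin m → ℝ) := {v | ∑ j, ε (j : Fin m) * v j = 1 ∧ ‖v‖ ≤ 1}

lemma Cf_convex (ε : ℕ → ℝ) : Convex ℝ (Cf m ε) := by
  intro x hx y hy a b ha hb hab
  refine ⟨?_, ?_⟩
  · have : ∑ j, ε (j : Fin m) * (a • x + b • y) j
        = a * ∑ j, ε (j : Fin m) * x j + b * ∑ j, ε (j : Fin m) * y j := by
      rw [Finset.mul_sum, Finset.mul_sum, ← Finset.sum_add_distrib]
      refine Finset.sum_congr rfl fun j _ => ?_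
      simp; ring
    rw [this, hx.1, hy.1]; linarith
  · have := (convex_closedBall (0 : Fin m → ℝ) 1) (by simpa using hx.2) (by simpa using hy.2) ha hb hab
    simpa using this

def Ql (m i : ℕ) (ρ : ℝ) (l : List (Fin m → ℝ)) : Prop :=
  l.length = i + 1 ∧ (∃ ε : ℕ → ℝ, (∀ j, |ε j| = 1) ∧ ∀ v ∈ l, v ∈ Cf m ε) ∧
    ∀ v ∈ l, ∀ u ∈ l, ‖v - u‖ ≤ ρ

lemma Tl_Ql (i : ℕ) (hi : i + 1 ≤ m) (l : List (Fin m → ℝ)) (h : Tl m (i + 1) l) : Ql m i 2 l := by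
  obtain ⟨hl, ε, he, h⟩ := h
  have hC : ∀ v ∈ l, v ∈ Cf m ε := by
    intro v hv
    obtain ⟨j, hj, rfl⟩ := h v hv
    constructor
    · rw [Finset.sum_eq_single ⟨j, by omega⟩]
      · simp [be]
        rw [← abs_mul_abs_self, he]; simp
      · intro b _ hb
        have : (b : ℕ) ≠ j := fun h => hb (Fin.ext h)
        simp [be, this]
      · simp
    · rw [pi_norm_le_iff_of_nonneg (by norm_num)]
      intro k
      simp only [be, Pi.smul_apply, smul_eq_mul]
      split_ifs <;> simp [he]
  refine ⟨hl, ⟨ε, he, hC⟩, fun v hv u hu => ?_⟩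
  have h1 := (hC v hv).2
  have h2 := (hC u hu).2
  linarith [norm_sub_le v u]

lemma iter_Ql (i : ℕ) (hi : i + 1 ≤ m) (r : ℕ) :
    (Sd (i + 1))^[r] (oh m i) ∈ Gen (Ql m i ((1 - (m : ℝ)⁻¹) ^ r * 2)) := by
  induction r with
  | zero =>
    simpa using Gen_mono (Tl_Ql i hi) (oh_Tl (m := m) i)
  | succ r ih =>
    rw [Function.iterate_succ_apply']
    refine map_mem _ _ ?_ ih
    rintro l ⟨h1, ⟨ε, he, h2⟩, h3⟩
    have hm1 : (1 : ℝ) ≤ m := by exact_mod_cast (by omega : 1 ≤ m)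
    have hm2 : (m : ℝ)⁻¹ ≤ 1 := inv_le_one_of_one_le₀ hm1
    refine Gen_mono ?_ (Sd_small m _ (by have : 0 ≤ 1 - (m : ℝ)⁻¹ := by linarith
                                         positivity) i l h1 hi h3)
    rintro l' ⟨g1, g2, g3⟩
    refine ⟨g1, ⟨ε, he, fun v hv => ?_⟩, ?_⟩
    · exact convexHull_min (fun u hu => h2 u hu) (Cf_convex ε) (g2 v hv)
    · intro v hv u hu
      refine (g3 v hv u hu).trans (le_of_eq ?_)
      ring

lemma Cf_ne (ε : ℕ → ℝ) (v : Fin m → ℝ) (hv : v ∈ Cf m ε) : v ≠ 0 := by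
  rintro rfl
  have := hv.1
  simp at this

lemma iter_Sd_comm (k : ℕ) (r : ℕ) (c : Ch (Fin m → ℝ)) (hc : c ∈ Gen (Tl m (k + 2)))
    (hk : k + 2 ≤ m) :
    bdL ((Sd (k + 2))^[r] c) = (Sd (k + 1))^[r] (bdL c) := by
  have hm1 : (1 : ℝ) ≤ m := by exact_mod_cast (by omega : 1 ≤ m)
  have hm2 : (m : ℝ)⁻¹ ≤ 1 := inv_le_one_of_one_le₀ hm1
  have key : ∀ r, (Sd (k + 2))^[r] c ∈ Gen (fun l : List (Fin m → ℝ) => l.length = k + 1 + 1 ∧ 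
      ∀ v ∈ l, ∀ u ∈ l, ‖v - u‖ ≤ 2) := by
    intro r
    induction r with
    | zero =>
      refine Gen_mono ?_ hc
      intro l hl
      have := Tl_Ql (k + 1) hk l hl
      exact ⟨this.1, this.2.2⟩
    | succ r ih =>
      rw [Function.iterate_succ_apply']
      refine map_mem _ _ ?_ ih
      rintro l ⟨h1, h3⟩
      refine Gen_mono ?_ (Sd_small m 2 (by norm_num) (k + 1) l h1 hk h3)
      rintro l' ⟨g1, g2, g3⟩
      refine ⟨g1, fun v hv u hu => (g3 v hv u hu).trans ?_⟩
      have : 0 ≤ (m : ℝ)⁻¹ := by positivity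
      linarith
  induction r with
  | zero => rfl
  | succ r ih =>
    rw [Function.iterate_succ_apply', Function.iterate_succ_apply', ← ih]
    exact bdL_Sd (k + 1) _ (Gen_mono (fun l hl => hl.1) (key r))

lemma iter_nu (k r : ℕ) (c : Ch (Fin m → ℝ)) :
    (Sd k)^[r] (nu c) = nu ((Sd k)^[r] c) := by
  induction r with
  | zero => rfl
  | succ r ih => rw [Function.iterate_succ_apply', Function.iterate_succ_apply', ih, Sd_nu]

lemma iter_add (k r : ℕ) (c d : Ch (Fin m → ℝ)) :
    (Sd k)^[r] (c + d) = (Sd k)^[r] c + (Sd k)^[r] d := by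
  induction r with
  | zero => rfl
  | succ r ih => rw [Function.iterate_succ_apply', Function.iterate_succ_apply',
      Function.iterate_succ_apply', ih, map_add]

lemma w_oh (σ : ℕ → (Fin m → ℝ) → ZMod 2) (hσ : ∀ j v, v ≠ 0 → σ j (-v) = σ j v + 1)
    (i : ℕ) (hi : i + 1 ≤ m) (r j : ℕ) : ev (w σ j) ((Sd (i + 1))^[r] (oh m i)) = 1 := by
  induction i generalizing j with
  | zero =>
    have h1 : oh m 0 = sg [be m 0] := by simp [oh, oc]
    have h2 : Sd 1 (sg [be m 0]) = sg [be m 0] := by simp [Sd_succ_sg, bd, Sd_zero, bary]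
    have h3 : (Sd (0 + 1))^[r] (oh m 0) = sg [be m 0] := by
      rw [h1]; exact Function.iterate_fixed h2 r
    rw [h3]; simp [w]
  | succ i ih =>
    have h1 := iter_Ql (m := m) (i + 1) hi r
    have h2 : ev (w σ j) ((Sd (i + 1 + 1))^[r] (oh m (i + 1))) =
        ev (al σ j) (bdL ((Sd (i + 1 + 1))^[r] (oh m (i + 1)))) := by
      have := eq_on (ev (w σ j)) ((ev (al σ j)).comp bdL) (fun l hl => by
        rw [LinearMap.comp_apply, bdL_sg, (coc σ i).2 j l hl.1, ev_sg]) h1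
      rwa [LinearMap.comp_apply] at this
    rw [h2, iter_Sd_comm i r _ (oh_Tl _) hi, bd_oh, oc_succ, iter_add, iter_nu, map_add,
      al_neg σ hσ, ih (by omega)]
    · rw [← add_assoc, CharTwo.add_self_eq_zero, zero_add]
    · refine Gen_mono ?_ (iter_Ql (m := m) i (by omega) r)
      rintro l ⟨-, ⟨ε, -, h⟩, -⟩ v hv
      exact Cf_ne ε v (h v hv)

end oct

/-- Borsuk–Ulam, coordinate version. -/
theorem borsuk_ulam_aux (m b : ℕ) (hb : b < m) (f : (Fin m → ℝ) → (Fin b → ℝ))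
    (hc : ContinuousOn f {0}ᶜ) (hodd : ∀ v, v ≠ 0 → f (-v) = - f v) (hne : ∀ v, v ≠ 0 → f v ≠ 0) :
    False := by
  classical
  obtain ⟨M, rfl⟩ : ∃ M, m = M + 1 := ⟨m - 1, by omega⟩
  -- the signs
  let s : (Fin (M + 1) → ℝ) → ZMod 2 := fun v => if WellOrderingRel v (-v) then 1 else 0
  have hs : ∀ v, v ≠ 0 → s (-v) = s v + 1 := by
    intro v hv
    have hne : v ≠ -v := fun h => hv (self_eq_neg.1 h)
    simp only [s, neg_neg]
    rcases trichotomous_of WellOrderingRel v (-v) with h | h | h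
    · have h' : ¬ WellOrderingRel (-v) v := fun h' => asymm_of WellOrderingRel h h'
      simp [h, h']
      decide
    · exact absurd h hne
    · have h' : ¬ WellOrderingRel v (-v) := fun h' => asymm_of WellOrderingRel h h'
      simp [h, h']
  let fj : ℕ → (Fin (M + 1) → ℝ) → ℝ := fun j v => if h : j < b then f v ⟨j, h⟩ else 0
  have hfj : ∀ j v, v ≠ 0 → fj j (-v) = - fj j v := by
    intro j v hv
    simp only [fj]
    split_ifs
    · rw [hodd v hv]; rfl
    · simp
  let σ : ℕ → (Fin (M + 1) → ℝ) → ZMod 2 := fun j v =>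
    if 0 < fj j v then 1 else if fj j v < 0 then 0 else s v
  have hσ : ∀ j v, v ≠ 0 → σ j (-v) = σ j v + 1 := by
    intro j v hv
    simp only [σ, hfj j v hv, hs v hv]
    rcases lt_trichotomy (fj j v) 0 with h | h | h
    · simp [h, h.le, not_lt.2 h.le]
    · simp [h]
    · simp [h, not_lt.2 h.le]; decide
  -- compactness
  let Kc : Set (Fin (M + 1) → ℝ) := {v | ‖v‖ ≤ 1 ∧ 1 ≤ ∑ j, |v j|}
  have hKc : IsCompact Kc := by
    have h1 : Kc = Metric.closedBall 0 1 ∩ {v | 1 ≤ ∑ j, |v j|} := by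
      ext v; simp [Kc]
    rw [h1]
    refine (isCompact_closedBall _ _).inter_right (isClosed_le continuous_const ?_)
    fun_prop
  have hK0 : Kc ⊆ {0}ᶜ := by
    rintro v ⟨-, h⟩ rfl
    simp at h
    linarith
  have hfK : ContinuousOn f Kc := hc.mono hK0
  have hbe : be (M + 1) 0 ∈ Kc := by
    have := (Tl_Ql (m := M + 1) 0 (by omega) [be (M + 1) 0] ⟨rfl, fun _ => 1, by simp, by
      simp⟩).2.1
    obtain ⟨ε, he, h⟩ := this
    obtain ⟨h1, h2⟩ := h (be (M + 1) 0) (by simp)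
    refine ⟨h2, ?_⟩
    rw [← h1]
    refine Finset.sum_le_sum fun j _ => ?_
    refine (le_abs_self _).trans ?_
    rw [abs_mul, he, one_mul]
  obtain ⟨v0, hv0, hmin⟩ := hKc.exists_isMinOn ⟨_, hbe⟩ hfK.norm
  set δ := ‖f v0‖ with hδ
  have hδ0 : 0 < δ := norm_pos_iff.2 (hne v0 (hK0 hv0))
  have huc := hKc.uniformContinuousOn_of_continuous hfK
  rw [Metric.uniformContinuousOn_iff] at huc
  obtain ⟨η, hη, huc⟩ := huc δ hδ0
  have hm1 : (1 : ℝ) ≤ (M + 1 : ℕ) := by exact_mod_cast (by omega : 1 ≤ M + 1)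
  obtain ⟨r, hr⟩ : ∃ r : ℕ, (1 - ((M + 1 : ℕ) : ℝ)⁻¹) ^ r * 2 < η := by
    have h1 : 0 ≤ 1 - ((M + 1 : ℕ) : ℝ)⁻¹ := by linarith [inv_le_one_of_one_le₀ hm1]
    have h2 : 1 - ((M + 1 : ℕ) : ℝ)⁻¹ < 1 := by
      have : 0 < ((M + 1 : ℕ) : ℝ)⁻¹ := by positivity
      linarith
    obtain ⟨r, hr⟩ := exists_pow_lt_of_lt_one (show 0 < η / 2 by positivity) h2
    exact ⟨r, by linarith⟩
  have h1 := w_oh σ hσ M le_rfl r 0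
  have h2 : ev (w σ 0) ((Sd (M + 1))^[r] (oh (M + 1) M)) = 0 := by
    have := eq_on (ev (w σ 0)) 0 (fun l hl => ?_) (iter_Ql (m := M + 1) M le_rfl r)
    · simpa using this
    obtain ⟨hl1, ⟨ε, he, hl2⟩, hl3⟩ := hl
    have hlK : ∀ v ∈ l, v ∈ Kc := by
      intro v hv
      obtain ⟨h1, h2⟩ := hl2 v hv
      refine ⟨h2, ?_⟩
      rw [← h1]
      refine Finset.sum_le_sum fun j _ => ?_
      refine (le_abs_self _).trans ?_
      rw [abs_mul, he, one_mul]
    obtain ⟨v, hv⟩ : ∃ v, v ∈ l := List.exists_mem_of_length_pos (by omega)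
    have hvd : δ ≤ ‖f v‖ := hmin (hlK v hv)
    obtain ⟨j, hj⟩ : ∃ j, δ ≤ |f v j| := by
      by_contra hcon
      push Not at hcon
      have := (pi_norm_lt_iff (x := f v) hδ0).2 (fun j => by simpa using hcon j)
      linarith
    rw [ev_sg, LinearMap.zero_apply]
    refine w_const σ l 0 j (by omega) ?_
    have hclose : ∀ u ∈ l, |f u j - f v j| < δ := by
      intro u hu
      have := huc u (hlK u hu) v (hlK v hv) (by rw [dist_eq_norm]; exact (hl3 u hu v hv).trans_lt hr)
      rw [dist_eq_norm] at this
      exact (norm_le_pi_norm (f u - f v) j).trans_lt this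
    have hfe : ∀ u, fj j u = f u j := fun u => by simp [fj]
    have hcst : ∀ u ∈ l, σ j u = if 0 < f v j then 1 else 0 := by
      intro u hu
      have := abs_lt.1 (hclose u hu)
      simp only [σ, hfe]
      rcases le_abs'.1 hj with h | h
      · have h4 : f u j < 0 := by linarith
        have h5 : f v j < 0 := by linarith
        simp [h4, not_lt.2 h4.le, not_lt.2 h5.le]
      · have h4 : 0 < f u j := by linarith
        have h5 : 0 < f v j := by linarith
        simp [h4, h5]
    intro u hu u' hu'
    rw [zero_add, hcst u hu, hcst u' hu']
  rw [h1] at h2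
  exact absurd h2 (by decide)

/-- Borsuk–Ulam. -/
theorem borsuk_ulam {A B : Type*} [NormedAddCommGroup A] [NormedSpace ℝ A] [FiniteDimensional ℝ A]
    [NormedAddCommGroup B] [NormedSpace ℝ B] [FiniteDimensional ℝ B]
    (hd : Module.finrank ℝ B < Module.finrank ℝ A) (g : A → B)
    (hc : ContinuousOn g {0}ᶜ) (hodd : ∀ v, v ≠ 0 → g (-v) = - g v) (hne : ∀ v, v ≠ 0 → g v ≠ 0) :
    False := by
  let eA : A ≃L[ℝ] (Fin (Module.finrank ℝ A) → ℝ) := ContinuousLinearEquiv.ofFinrankEq (by simp)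
  let eB : B ≃L[ℝ] (Fin (Module.finrank ℝ B) → ℝ) := ContinuousLinearEquiv.ofFinrankEq (by simp)
  refine borsuk_ulam_aux _ _ hd (fun v => eB (g (eA.symm v))) ?_ ?_ ?_
  · refine eB.continuous.comp_continuousOn (hc.comp eA.symm.continuous.continuousOn ?_)
    intro v hv
    simpa using hv
  · intro v hv
    rw [map_neg, hodd _ (by simpa using hv), map_neg]
  · intro v hv
    have := hne (eA.symm v) (by simpa using hv)
    simpa using this

end BU
end PartM1b

open Set
noncomputable section PartM2

namespace Dfm

variable {Z : Type*} [NormedAddCommGroup Z]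

/-- there is an odd continuous map between negative sets -/
def Rel (f g : Z → ℝ) : Prop :=
  ∃ Φ : Z → Z, ContinuousOn Φ {z | f z < 0} ∧ (∀ z, f z < 0 → Φ (-z) = - Φ z) ∧
    ∀ z, f z < 0 → g (Φ z) < 0

lemma Rel.refl (f : Z → ℝ) : Rel f f :=
  ⟨id, continuousOn_id, fun _ _ => rfl, fun _ h => h⟩

lemma Rel.trans {f g h : Z → ℝ} (h1 : Rel f g) (h2 : Rel g h) : Rel f h := by
  obtain ⟨Φ, a1, a2, a3⟩ := h1
  obtain ⟨Ψ, b1, b2, b3⟩ := h2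
  refine ⟨Ψ ∘ Φ, b1.comp a1 (fun z hz => a3 z hz), ?_, fun z hz => b3 _ (a3 z hz)⟩
  intro z hz
  simp only [Function.comp]
  rw [a2 z hz, b2 _ (a3 z hz)]

variable [InnerProductSpace ℝ Z] [FiniteDimensional ℝ Z]

theorem deform_inner (S : ℝ → Z → ℝ) (D : ℝ → Z → (Z →L[ℝ] ℝ)) (a b : ℝ) (hab : a ≤ b)
    (hD : ∀ s ∈ Icc a b, ∀ z, HasFDerivAt (S s) (D s z) z)
    (hSc : ContinuousOn (fun q : ℝ × Z => S q.1 q.2) (Icc a b ×ˢ univ))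
    (hDc : ContinuousOn (fun q : ℝ × Z => D q.1 q.2) (Icc a b ×ˢ univ))
    (hom : ∀ s ∈ Icc a b, ∀ (c : ℝ) z, S s (c • z) = c ^ 2 * S s z)
    (hnc : ∀ s ∈ Icc a b, ∀ z, z ≠ 0 → D s z ≠ 0) : Rel (S b) (S a) := by
  have hS0 : ∀ s ∈ Icc a b, S s 0 = 0 := fun s hs => by
    have := hom s hs 0 0
    simpa using this
  rcases subsingleton_or_nontrivial Z with hZ | hZ
  · refine ⟨id, continuousOn_id, fun _ _ => rfl, fun z hz => ?_⟩
    rw [Subsingleton.elim z 0, hS0 b (right_mem_Icc.2 hab)] at hz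
    exact absurd hz (lt_irrefl _)
  have hDodd : ∀ s ∈ Icc a b, ∀ z, D s (-z) = - D s z := by
    intro s hs z
    have h1 := hD s hs (-z)
    have h2 : HasFDerivAt (fun z : Z => -z) (-(ContinuousLinearMap.id ℝ Z)) z := (hasFDerivAt_id z).fun_neg
    have h3 := h1.comp z h2
    have h4 : (S s ∘ fun z => -z) = S s := by
      ext x
      have := hom s hs (-1) x
      simpa using this
    rw [h4] at h3
    have h5 := h3.unique (hD s hs z)
    rw [← h5]; ext; simp
  -- bounds
  have hK1 : IsCompact (Icc a b ×ˢ Metric.sphere (0 : Z) 1) := isCompact_Icc.prod (isCompact_sphere _ _)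
  have hne : (Icc a b ×ˢ Metric.sphere (0 : Z) 1).Nonempty :=
    (nonempty_Icc.2 hab).prod (NormedSpace.sphere_nonempty.2 zero_le_one)
  have hDn : ContinuousOn (fun q : ℝ × Z => ‖D q.1 q.2‖) (Icc a b ×ˢ Metric.sphere (0 : Z) 1) :=
    (hDc.mono (prod_mono le_rfl (subset_univ _))).norm
  obtain ⟨q0, hq0, hmin⟩ := hK1.exists_isMinOn hne hDn
  obtain ⟨q1, hq1, hmax⟩ := hK1.exists_isMaxOn hne hDn
  set c := ‖D q0.1 q0.2‖ with hc
  set C := ‖D q1.1 q1.2‖ with hC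
  have hc0 : 0 < c := by
    refine norm_pos_iff.2 (hnc _ hq0.1 _ ?_)
    intro h
    have := hq0.2
    rw [h] at this
    simp at this
  have hcmin : ∀ s ∈ Icc a b, ∀ u : Z, ‖u‖ = 1 → c ≤ ‖D s u‖ := fun s hs u hu =>
    hmin (show (s, u) ∈ _ from ⟨hs, by simpa using hu⟩)
  have hcmax : ∀ s ∈ Icc a b, ∀ u : Z, ‖u‖ = 1 → ‖D s u‖ ≤ C := fun s hs u hu =>
    hmax (show (s, u) ∈ _ from ⟨hs, by simpa using hu⟩)
  have hC0 : 0 < C := hc0.trans_le (hmin hq1)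
  have hK2 : IsCompact (Icc a b ×ˢ Metric.closedBall (0 : Z) (1 + C)) :=
    isCompact_Icc.prod (isCompact_closedBall _ _)
  have huD := hK2.uniformContinuousOn_of_continuous (hDc.mono (prod_mono le_rfl (subset_univ _)))
  have huS := hK2.uniformContinuousOn_of_continuous (hSc.mono (prod_mono le_rfl (subset_univ _)))
  rw [Metric.uniformContinuousOn_iff] at huD huS
  obtain ⟨η, hη, huD⟩ := huD (c / 2) (by positivity)
  obtain ⟨τ, hτ0, hτ1, hτη⟩ : ∃ τ : ℝ, 0 < τ ∧ τ ≤ 1 ∧ τ * C < η := by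
    refine ⟨min 1 (η / (2 * C)), by positivity, min_le_left _ _, ?_⟩
    calc min 1 (η / (2 * C)) * C ≤ (η / (2 * C)) * C := by gcongr; exact min_le_right _ _
      _ = η / 2 := by field_simp
      _ < η := by linarith
  obtain ⟨μ, hμ, huS⟩ := huS (τ * c ^ 2 / 2) (by positivity)
  let gr : ℝ → Z → Z := fun s z => (InnerProductSpace.toDual ℝ Z).symm (D s z)
  have hgn : ∀ s z, ‖gr s z‖ = ‖D s z‖ := fun s z => by simp [gr]
  have hgD : ∀ s z, D s z (gr s z) = ‖D s z‖ ^ 2 := by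
    intro s z
    rw [← hgn, ← real_inner_self_eq_norm_sq]
    exact (InnerProductSpace.toDual_symm_apply (x := gr s z) (y := D s z)).symm
  -- one step
  have step : ∀ s ∈ Icc a b, ∀ s' ∈ Icc a b, dist s s' < μ → Rel (S s) (S s') := by
    intro s hs s' hs' hss
    let Ψ : Z → Z := fun u => u - τ • gr s u
    refine ⟨fun z => Ψ (‖z‖⁻¹ • z), ?_, ?_, ?_⟩
    · have hz0 : ∀ z ∈ {z | S s z < 0}, ‖z‖ ≠ 0 := by
        rintro z hz h
        rw [norm_eq_zero] at h
        rw [mem_ofPred_eq, h, hS0 s hs] at hz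
        exact lt_irrefl _ hz
      have hDs : Continuous (D s) := by
        rw [← continuousOn_univ]
        exact hDc.comp (f := fun z : Z => (s, z)) (by fun_prop) (fun z _ => ⟨hs, mem_univ _⟩)
      have hΨ : Continuous Ψ := by
        refine continuous_id.sub (Continuous.const_smul ?_ _)
        exact (InnerProductSpace.toDual ℝ Z).symm.continuous.comp hDs
      exact hΨ.comp_continuousOn ((continuousOn_id.norm.inv₀ hz0).smul continuousOn_id)
    · intro z _
      simp only [Ψ, gr, norm_neg, smul_neg, hDodd s hs, map_neg]
      abel
    · intro z hz
      have hz0 : z ≠ 0 := by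
        rintro rfl
        rw [hS0 s hs] at hz; exact lt_irrefl _ hz
      set u := ‖z‖⁻¹ • z with hu
      have hu1 : ‖u‖ = 1 := by simp [hu, norm_smul, hz0]
      have hSu : S s u < 0 := by
        rw [hu, hom s hs]
        have : 0 < ‖z‖ := norm_pos_iff.2 hz0
        have h2 : 0 < (‖z‖⁻¹) ^ 2 := by positivity
        nlinarith
      have hdn : ‖Ψ u - u‖ = τ * ‖D s u‖ := by
        simp [Ψ, norm_smul, hgn, abs_of_pos hτ0]
      have hle := hcmax s hs u hu1
      have hge := hcmin s hs u hu1
      have hin : ∀ x ∈ Metric.closedBall u (τ * C), x ∈ Metric.closedBall (0 : Z) (1 + C) := by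
        intro x hx
        rw [mem_closedBall_iff_norm] at hx
        rw [mem_closedBall_zero_iff]
        have : ‖x‖ ≤ ‖u‖ + ‖x - u‖ := by
          have := norm_add_le u (x - u)
          simpa using this
        have : τ * C ≤ 1 * C := by gcongr
        linarith
      have hmv := Convex.norm_image_sub_le_of_norm_hasFDerivWithin_le' (f := S s) (f' := D s)
        (φ := D s u) (C := c / 2) (s := Metric.closedBall u (τ * C)) (x := u) (y := Ψ u)
        (fun x _ => (hD s hs x).hasFDerivWithinAt)
        (fun x hx => by
          have := huD (s, x) ⟨hs, hin x hx⟩ (s, u) ⟨hs, hin u (by simp; positivity)⟩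
            (by
              rw [Prod.dist_eq, max_lt_iff]
              refine ⟨by simpa using hη, ?_⟩
              exact (Metric.mem_closedBall.1 hx).trans_lt hτη)
          rw [dist_eq_norm] at this
          exact this.le)
        (convex_closedBall _ _) (by simp; positivity)
        (by rw [mem_closedBall_iff_norm, hdn]; gcongr)
      have h1 : D s u (Ψ u - u) = - (τ * ‖D s u‖ ^ 2) := by
        simp [Ψ, hgD]
      rw [h1, hdn, Real.norm_eq_abs] at hmv
      have h2 := (abs_le.1 hmv).2
      have h3 := huS (s, Ψ u) ⟨hs, hin _ (by rw [mem_closedBall_iff_norm, hdn]; gcongr)⟩ (s', Ψ u)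
        ⟨hs', hin _ (by rw [mem_closedBall_iff_norm, hdn]; gcongr)⟩ (by
          rw [Prod.dist_eq, max_lt_iff]
          exact ⟨hss, by simpa using hμ⟩)
      rw [Real.dist_eq] at h3
      have h4 := (abs_lt.1 h3).1
      simp only at h4
      have h5 : τ * c ^ 2 / 2 ≤ τ * ‖D s u‖ ^ 2 - c / 2 * (τ * ‖D s u‖) := by
        have : c ^ 2 / 2 ≤ ‖D s u‖ ^ 2 - c / 2 * ‖D s u‖ := by nlinarith
        nlinarith
      linarith
  -- chain
  have chain : ∀ k : ℕ, ∀ s ∈ Icc a b, s - a ≤ k * (μ / 2) → Rel (S s) (S a) := by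
    intro k
    induction k with
    | zero =>
      intro s hs h
      have : s = a := le_antisymm (by simpa using h) hs.1
      rw [this]; exact Rel.refl _
    | succ k ih =>
      intro s hs h
      push_cast at h
      have hs' : max a (s - μ / 2) ∈ Icc a b :=
        ⟨le_max_left _ _, max_le hab (by linarith [hs.2])⟩
      refine (step s hs _ hs' ?_).trans (ih _ hs' ?_)
      · rw [Real.dist_eq, abs_lt]
        constructor
        · have : max a (s - μ / 2) ≤ s := max_le hs.1 (by linarith)
          linarith
        · have := le_max_right a (s - μ / 2)
          linarith
      · rw [sub_le_iff_le_add]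
        refine max_le ?_ (by linarith)
        have : (0 : ℝ) ≤ k * (μ / 2) := by positivity
        linarith
  obtain ⟨k, hk⟩ := exists_nat_gt ((b - a) / (μ / 2))
  refine chain k b (right_mem_Icc.2 hab) ?_
  rw [div_lt_iff₀ (by positivity)] at hk
  exact hk.le

/-- transfer to arbitrary finite-dimensional normed spaces -/
theorem deform {Z : Type*} [NormedAddCommGroup Z] [NormedSpace ℝ Z] [FiniteDimensional ℝ Z]
    (S : ℝ → Z → ℝ) (D : ℝ → Z → (Z →L[ℝ] ℝ)) (a b : ℝ) (hab : a ≤ b)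
    (hD : ∀ s ∈ Icc a b, ∀ z, HasFDerivAt (S s) (D s z) z)
    (hSc : ContinuousOn (fun q : ℝ × Z => S q.1 q.2) (Icc a b ×ˢ univ))
    (hDc : ContinuousOn (fun q : ℝ × Z => D q.1 q.2) (Icc a b ×ˢ univ))
    (hom : ∀ s ∈ Icc a b, ∀ (c : ℝ) z, S s (c • z) = c ^ 2 * S s z)
    (hnc : ∀ s ∈ Icc a b, ∀ z, z ≠ 0 → D s z ≠ 0) : Rel (S b) (S a) := by
  let e : EuclideanSpace ℝ (Fin (Module.finrank ℝ Z)) ≃L[ℝ] Z :=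
    ContinuousLinearEquiv.ofFinrankEq (by simp)
  have hmaps : MapsTo (fun q : ℝ × EuclideanSpace ℝ (Fin (Module.finrank ℝ Z)) => (q.1, e q.2))
      (Icc a b ×ˢ univ) (Icc a b ×ˢ univ) := fun q hq => ⟨hq.1, mem_univ _⟩
  have := deform_inner (fun s z => S s (e z)) (fun s z => (D s (e z)).comp (e : _ →L[ℝ] Z)) a b hab
    (fun s hs z => (hD s hs (e z)).comp z e.hasFDerivAt)
    (hSc.comp (f := fun q : ℝ × EuclideanSpace ℝ (Fin (Module.finrank ℝ Z)) => (q.1, e q.2))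
      (by fun_prop) hmaps)
    (ContinuousOn.clm_comp (hDc.comp
      (f := fun q : ℝ × EuclideanSpace ℝ (Fin (Module.finrank ℝ Z)) => (q.1, e q.2))
      (by fun_prop) hmaps) continuousOn_const)
    (fun s hs c z => by rw [map_smul, hom s hs])
    (fun s hs z hz h => by
      refine hnc s hs (e z) (by simpa using hz) ?_
      ext v
      have := congrArg (fun f => f (e.symm v)) h
      simpa using this)
  obtain ⟨Φ, h1, h2, h3⟩ := this
  refine ⟨fun z => e (Φ (e.symm z)), ?_, ?_, ?_⟩
  · refine e.continuous.comp_continuousOn (h1.comp e.symm.continuous.continuousOn ?_)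
    intro z hz
    simpa using hz
  · intro z hz
    show e (Φ (e.symm (-z))) = - e (Φ (e.symm z))
    rw [map_neg, h2 _ (by simpa using hz), map_neg]
  · intro z hz
    exact h3 _ (by simpa using hz)

end Dfm
end PartM2

open Set
set_option linter.unusedSectionVars false
noncomputable section PartM3

namespace Disc

variable {X : Type*} [NormedAddCommGroup X] [InnerProductSpace ℝ X] [FiniteDimensional ℝ X]

/-- the symplectic gradient of a covector on `X × X` -/
def sgrad (f : X × X →L[ℝ] ℝ) : X × X :=
  ((InnerProductSpace.toDual ℝ X).symm (f.comp (ContinuousLinearMap.inr ℝ X X)),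
   - (InnerProductSpace.toDual ℝ X).symm (f.comp (ContinuousLinearMap.inl ℝ X X)))

lemma sgrad_spec (f : X × X →L[ℝ] ℝ) (u : X × X) :
    f u = inner ℝ (sgrad f).1 u.2 - inner ℝ (sgrad f).2 u.1 := by
  simp only [sgrad, inner_neg_left, InnerProductSpace.toDual_symm_apply,
    ContinuousLinearMap.comp_apply, ContinuousLinearMap.inr_apply, ContinuousLinearMap.inl_apply]
  rw [sub_neg_eq_add, ← map_add]
  simp

lemma sgrad_unique (f : X × X →L[ℝ] ℝ) (v : X × X)
    (h : ∀ u : X × X, f u = inner ℝ v.1 u.2 - inner ℝ v.2 u.1) : sgrad f = v := by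
  ext1
  · refine ext_inner_right ℝ fun u => ?_
    have h1 := h (0, u)
    have h2 := sgrad_spec f (0, u)
    simp at h1 h2
    rw [← h1, ← h2]
  · refine ext_inner_right ℝ fun u => ?_
    have h1 := h (u, 0)
    have h2 := sgrad_spec f (u, 0)
    simp at h1 h2
    linarith

lemma sgrad_sub (f g : X × X →L[ℝ] ℝ) : sgrad (f - g) = sgrad f - sgrad g := by
  apply sgrad_unique
  intro u
  simp only [sub_apply, sgrad_spec f u, sgrad_spec g u, Prod.fst_sub,
    Prod.snd_sub, inner_sub_left]
  ring

lemma sgrad_smul (c : ℝ) (f : X × X →L[ℝ] ℝ) : sgrad (c • f) = c • sgrad f := by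
  apply sgrad_unique
  intro u
  simp only [smul_apply, sgrad_spec f u, Prod.smul_fst,
    Prod.smul_snd, real_inner_smul_left, smul_eq_mul]
  ring

lemma sgrad_norm (f : X × X →L[ℝ] ℝ) : ‖sgrad f‖ ≤ ‖f‖ := by
  rw [Prod.norm_def]
  refine max_le ?_ ?_
  · simp only [sgrad, LinearIsometryEquiv.norm_map]
    refine (ContinuousLinearMap.opNorm_comp_le _ _).trans ?_
    have := ContinuousLinearMap.norm_inr_le_one ℝ X X
    exact mul_le_of_le_one_right (norm_nonneg _) this
  · simp only [sgrad, LinearIsometryEquiv.norm_map, norm_neg]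
    refine (ContinuousLinearMap.opNorm_comp_le _ _).trans ?_
    have := ContinuousLinearMap.norm_inl_le_one ℝ X X
    exact mul_le_of_le_one_right (norm_nonneg _) this

/-- Family of degree-2 homogeneous Hamiltonians. -/
structure HomHam (a : ℝ) (h : ℝ → ℝ → X × X → ℝ) (D : ℝ → ℝ → X × X → (X × X →L[ℝ] ℝ)) : Prop where
  hasD : ∀ s ∈ Icc a 1, ∀ t ∈ Icc (0 : ℝ) 1, ∀ w, HasFDerivAt (h s t) (D s t w) w
  contH : ContinuousOn (fun q : ℝ × ℝ × (X × X) => h q.1 q.2.1 q.2.2)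
    (Icc a 1 ×ˢ Icc (0 : ℝ) 1 ×ˢ univ)
  contD : ContinuousOn (fun q : ℝ × ℝ × (X × X) => D q.1 q.2.1 q.2.2)
    (Icc a 1 ×ˢ Icc (0 : ℝ) 1 ×ˢ univ)
  hom : ∀ s ∈ Icc a 1, ∀ t ∈ Icc (0 : ℝ) 1, ∀ (c : ℝ) w, h s t (c • w) = c ^ 2 * h s t w
  homD : ∀ s ∈ Icc a 1, ∀ t ∈ Icc (0 : ℝ) 1, ∀ (c : ℝ) w, D s t (c • w) = c • D s t w
  bd : ∃ C, 0 ≤ C ∧ ∀ s ∈ Icc a 1, ∀ t ∈ Icc (0 : ℝ) 1, ∀ w, ‖D s t w‖ ≤ C * ‖w‖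
  lip : ∀ c1 c2 : ℝ, 0 < c1 → ∃ L, 0 ≤ L ∧ ∀ s ∈ Icc a 1, ∀ t ∈ Icc (0 : ℝ) 1, ∀ w W,
    c1 ≤ ‖W‖ → ‖W‖ ≤ c2 → ‖D s t w - D s t W‖ ≤ L * ‖w - W‖

/-- exact orbits starting on the zero section leave it uniformly -/
def Orbits (a : ℝ) (D : ℝ → ℝ → X × X → (X × X →L[ℝ] ℝ)) : Prop :=
  ∃ r0 c1 c2 c : ℝ, 0 < r0 ∧ 0 < c1 ∧ 0 < c ∧ ∀ s ∈ Icc a 1, ∀ x0 : X, ‖x0‖ = r0 →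
    ∃ W : ℝ → X × X, W 0 = (x0, 0) ∧ (∀ t ∈ Icc (0 : ℝ) 1, HasDerivAt W (sgrad (D s t (W t))) t) ∧
      (∀ t ∈ Icc (0 : ℝ) 1, c1 ≤ ‖W t‖ ∧ ‖W t‖ ≤ c2) ∧ c ≤ ‖(W 1).2‖

/-- discrete orbit -/
def DOrb (N : ℕ) (v : ℝ → X × X → X × X) (w : ℕ → X × X) : Prop :=
  ∀ i < N, w (i + 1) = w i + (N : ℝ)⁻¹ • v (i / N) ((w i).1, (w (i + 1)).2)

lemma pair_norm_le (a b : X × X) : ‖(a.1, b.2)‖ ≤ ‖a‖ + ‖b‖ := by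
  rw [Prod.norm_def]
  refine max_le ?_ ?_
  · exact (norm_fst_le a).trans (by linarith [norm_nonneg b])
  · exact (norm_snd_le b).trans (by linarith [norm_nonneg a])

lemma gronwall (N : ℕ) (hN : 0 < N) (L δ : ℝ) (hL : 0 ≤ L) (hδ : 0 ≤ δ)
    (hLN : (N : ℝ)⁻¹ * L ≤ 1 / 2) (e : ℕ → ℝ) (he : ∀ i, 0 ≤ e i) (he0 : e 0 = 0)
    (hs : ∀ i < N, e (i + 1) ≤ e i + (N : ℝ)⁻¹ * (L * (e i + e (i + 1)) + δ)) :
    e N ≤ 2 * δ * Real.exp (4 * L) := by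
  set η := (N : ℝ)⁻¹ with hη
  have hN' : (0 : ℝ) < N := by exact_mod_cast hN
  have hη0 : 0 < η := by positivity
  have key : ∀ i ≤ N, e i ≤ 2 * δ * (i * η) * Real.exp (4 * L * (i * η)) := by
    intro i
    induction i with
    | zero => intro _; simp [he0]
    | succ i ih =>
      intro hi
      have h1 := ih (by omega)
      have h2 := hs i (by omega)
      have h3 : e (i + 1) ≤ (1 + 4 * L * η) * e i + 2 * η * δ := by
        have := he i
        have h5 : 0 ≤ η * L := by positivity
        have h6 : 0 ≤ η * L * e i := by positivity
        have h7 : 0 ≤ η * δ := by positivity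
        have h4 : (1 - η * L) * e (i + 1) ≤ (1 + η * L) * e i + η * δ := by linarith
        have h8 : (1 + η * L) * e i + η * δ ≤ (1 - η * L) * ((1 + 4 * L * η) * e i + 2 * η * δ) := by
          have h9 : 0 ≤ (1 / 2 - η * L) * (η * L * e i) := by
            apply mul_nonneg (by linarith) h6
          have h10 : 0 ≤ (1 / 2 - η * L) * (η * δ) := by
            apply mul_nonneg (by linarith) h7
          nlinarith
        exact le_of_mul_le_mul_left (h4.trans h8) (by linarith)
      have h4 : 1 + 4 * L * η ≤ Real.exp (4 * L * η) := by
        linarith [Real.add_one_le_exp (4 * L * η)]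
      have h5 : Real.exp (4 * L * ((i + 1 : ℕ) * η))
          = Real.exp (4 * L * η) * Real.exp (4 * L * (i * η)) := by
        rw [← Real.exp_add]; push_cast; ring_nf
      have h6 : 1 ≤ Real.exp (4 * L * ((i + 1 : ℕ) * η)) := Real.one_le_exp (by positivity)
      calc e (i + 1) ≤ (1 + 4 * L * η) * e i + 2 * η * δ := h3
        _ ≤ Real.exp (4 * L * η) * (2 * δ * (i * η) * Real.exp (4 * L * (i * η))) + 2 * η * δ := by
          gcongr
          exact he i
        _ = 2 * δ * (i * η) * Real.exp (4 * L * ((i + 1 : ℕ) * η)) + 2 * η * δ * 1 := by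
          rw [h5]; ring
        _ ≤ 2 * δ * (i * η) * Real.exp (4 * L * ((i + 1 : ℕ) * η)) +
            2 * η * δ * Real.exp (4 * L * ((i + 1 : ℕ) * η)) := by gcongr
        _ = _ := by push_cast; ring
  have := key N le_rfl
  rw [hη, mul_inv_cancel₀ hN'.ne'] at this
  simpa using this

lemma dorb_zero (N : ℕ) (hN : 0 < N) (v : ℝ → X × X → X × X) (w : ℕ → X × X) (C : ℝ)
    (hC : 0 ≤ C) (hv : ∀ t ∈ Icc (0 : ℝ) 1, ∀ w, ‖v t w‖ ≤ C * ‖w‖) (hCN : (N : ℝ)⁻¹ * C < 1)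
    (h : DOrb N v w) (h0 : w 0 = 0) : ∀ i ≤ N, w i = 0 := by
  have hN' : (0 : ℝ) < N := by exact_mod_cast hN
  intro i
  induction i with
  | zero => intro _; exact h0
  | succ i ih =>
    intro hi
    have h1 := ih (by omega)
    have h2 := h i (by omega)
    rw [h1, zero_add] at h2
    have hiN : (i : ℝ) ≤ N := by exact_mod_cast (by omega : i ≤ N)
    have h3 := hv (i / N) ⟨by positivity, (div_le_one hN').2 hiN⟩ ((0 : X × X).1, (w (i + 1)).2)
    have h4 := pair_norm_le (0 : X × X) (w (i + 1))
    have h5 : ‖w (i + 1)‖ ≤ (N : ℝ)⁻¹ * (C * ‖w (i + 1)‖) := by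
      conv_lhs => rw [h2]
      rw [norm_smul, Real.norm_of_nonneg (by positivity)]
      gcongr
      refine h3.trans ?_
      gcongr
      simpa using h4
    by_contra hne
    have h6 : 0 < ‖w (i + 1)‖ := norm_pos_iff.2 hne
    nlinarith

theorem no_dorb {a : ℝ} {h : ℝ → ℝ → X × X → ℝ} {D : ℝ → ℝ → X × X → (X × X →L[ℝ] ℝ)}
    (hh : HomHam a h D) (ho : Orbits a D) :
    ∃ N0 : ℕ, ∀ N ≥ N0, 0 < N → ∀ s ∈ Icc a 1, ∀ w : ℕ → X × X,
      DOrb N (fun t w => sgrad (D s t w)) w → (w 0).2 = 0 → (w N).2 = 0 → ∀ i ≤ N, w i = 0 := by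
  obtain ⟨r0, c1, c2, c, hr0, hc1, hc, ho⟩ := ho
  obtain ⟨C, hC, hbd⟩ := hh.bd
  obtain ⟨L, hL, hlip⟩ := hh.lip c1 c2 hc1
  -- uniform continuity
  have hK : IsCompact (Icc a 1 ×ˢ Icc (0 : ℝ) 1 ×ˢ Metric.closedBall (0 : X × X) c2) :=
    isCompact_Icc.prod (isCompact_Icc.prod (isCompact_closedBall _ _))
  have huc := hK.uniformContinuousOn_of_continuous
    (hh.contD.mono (prod_mono le_rfl (prod_mono le_rfl (subset_univ _))))
  replace huc := (Metric.uniformContinuousOn_iff (α := ℝ × ℝ × X × X)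
    (β := X × X →L[ℝ] ℝ)).1 huc
  set δ := c / (8 * Real.exp (4 * L)) with hδ
  have hδ0 : 0 < δ := by positivity
  obtain ⟨μ, hμ, huc⟩ := huc δ hδ0
  have hc2 : 0 ≤ |c2| := abs_nonneg _
  set B := C * |c2| with hB
  have hB0 : 0 ≤ B := by positivity
  -- choose N0
  obtain ⟨N0, hN0⟩ := exists_nat_gt (max (2 * L) (max (2 * C) (max ((1 + B) / μ) (L * B / δ))))
  refine ⟨N0, fun N hNN0 hN s hs w hw hw0 hwN => ?_⟩
  have hN' : (0 : ℝ) < N := by exact_mod_cast hN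
  have hNbig : max (2 * L) (max (2 * C) (max ((1 + B) / μ) (L * B / δ))) < N :=
    hN0.trans_le (by exact_mod_cast hNN0)
  simp only [max_lt_iff] at hNbig
  obtain ⟨b1, b2, b3, b4⟩ := hNbig
  set η := (N : ℝ)⁻¹ with hη
  have hη0 : 0 < η := by positivity
  have hηN : η * N = 1 := inv_mul_cancel₀ hN'.ne'
  have hηL : η * L ≤ 1 / 2 := by
    have : η * (2 * L) ≤ η * N := by gcongr
    linarith
  have hηC : η * C < 1 := by
    have : η * (2 * C) ≤ η * N := by gcongr
    linarith
  have hημ : η * (1 + B) < μ := by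
    rw [div_lt_iff₀ hμ] at b3
    have : η * (1 + B) < η * (N * μ) := by gcongr
    have h2 : η * (N * μ) = μ := by rw [← mul_assoc, hηN, one_mul]
    linarith
  have hηδ : L * (B * η) ≤ δ := by
    rw [div_lt_iff₀ hδ0] at b4
    have : η * (L * B) < η * (N * δ) := by gcongr
    have h2 : η * (N * δ) = δ := by rw [← mul_assoc, hηN, one_mul]
    linarith
  have hti : ∀ i ≤ N, (i : ℝ) / N ∈ Icc (0 : ℝ) 1 := by
    intro i hi
    have hiN : (i : ℝ) ≤ N := by exact_mod_cast hi
    exact ⟨by positivity, (div_le_one hN').2 hiN⟩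
  have hv : ∀ t ∈ Icc (0 : ℝ) 1, ∀ w, ‖sgrad (D s t w)‖ ≤ C * ‖w‖ := fun t ht w =>
    (sgrad_norm _).trans (hbd s hs t ht w)
  by_cases hx0 : (w 0).1 = 0
  · exact dorb_zero N hN _ w C hC hv hηC hw (Prod.ext hx0 hw0)
  exfalso
  -- rescale
  set κ := r0 / ‖(w 0).1‖ with hκ
  have hnx : 0 < ‖(w 0).1‖ := norm_pos_iff.2 hx0
  set w' : ℕ → X × X := fun i => κ • w i with hw'
  have hdw' : DOrb N (fun t w => sgrad (D s t w)) w' := by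
    intro i hi
    have h1 := hw i hi
    have h2 : ((w' i).1, (w' (i + 1)).2) = κ • ((w i).1, (w (i + 1)).2) := rfl
    simp only [h2]
    rw [hh.homD s hs _ (hti i hi.le), sgrad_smul, smul_comm, ← smul_add]
    simp only [hw']
    rw [← h1]
  have hn0 : ‖(w' 0).1‖ = r0 := by
    simp only [hw', Prod.smul_fst, norm_smul, hκ, norm_div, Real.norm_of_nonneg hr0.le, norm_norm]
    field_simp
  obtain ⟨W, hW0, hWd, hWb, hW1⟩ := ho s hs _ hn0
  have hw'0 : w' 0 = W 0 := by
    rw [hW0]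
    refine Prod.ext rfl ?_
    simp [hw', hw0]
  have hWB : ∀ t ∈ Icc (0 : ℝ) 1, ‖sgrad (D s t (W t))‖ ≤ B := by
    intro t ht
    refine (hv t ht _).trans ?_
    rw [hB]
    gcongr
    exact (hWb t ht).2.trans (le_abs_self _)
  have hWlip : ∀ t ∈ Icc (0 : ℝ) 1, ∀ t' ∈ Icc (0 : ℝ) 1, ‖W t' - W t‖ ≤ B * ‖t' - t‖ := by
    intro t ht t' ht'
    exact Convex.norm_image_sub_le_of_norm_hasDerivWithin_le
      (fun x hx => (hWd x hx).hasDerivWithinAt) hWB (convex_Icc 0 1) ht ht'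
  set e : ℕ → ℝ := fun i => ‖w' i - W (i / N)‖ with he
  have hestep : ∀ i < N, e (i + 1) ≤ e i + η * (L * (e i + e (i + 1)) + 2 * δ) := by
    intro i hi
    have ht := hti i hi.le
    have ht' := hti (i + 1) hi
    set t : ℝ := (i : ℝ) / N with htdef
    have htt : ((i + 1 : ℕ) : ℝ) / N = t + η := by
      rw [htdef, hη]; push_cast; field_simp
    rw [htt] at ht'
    set q : X × X := ((w' i).1, (w' (i + 1)).2) with hq
    have h1 : w' (i + 1) = w' i + η • sgrad (D s t q) := hdw' i hi
    -- W increment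
    have h2 : ‖(W (t + η) - (t + η) • sgrad (D s t (W t))) - (W t - t • sgrad (D s t (W t)))‖ ≤
        δ * ‖(t + η) - t‖ := by
      refine Convex.norm_image_sub_le_of_norm_hasDerivWithin_le (s := Icc t (t + η))
        (f := fun r => W r - r • sgrad (D s t (W t)))
        (f' := fun r => sgrad (D s r (W r)) - sgrad (D s t (W t))) ?_ ?_ (convex_Icc _ _)
        (left_mem_Icc.2 (by linarith)) (right_mem_Icc.2 (by linarith))
      · intro r hr
        have hr' : r ∈ Icc (0 : ℝ) 1 := ⟨ht.1.trans hr.1, hr.2.trans ht'.2⟩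
        have := (hWd r hr').fun_sub ((hasDerivAt_id r).smul_const (sgrad (D s t (W t))))
        simpa using this.hasDerivWithinAt
      · intro r hr
        have hr' : r ∈ Icc (0 : ℝ) 1 := ⟨ht.1.trans hr.1, hr.2.trans ht'.2⟩
        rw [← sgrad_sub]
        refine (sgrad_norm _).trans ?_
        have hrt : ‖r - t‖ ≤ η := by
          rw [Real.norm_of_nonneg (by linarith [hr.1])]; linarith [hr.2]
        have := huc (s, r, W r) ⟨hs, hr', by simpa using (hWb r hr').2⟩ (s, t, W t)
          ⟨hs, ht, by simpa using (hWb t ht).2⟩ (by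
            rw [Prod.dist_eq, Prod.dist_eq]
            simp only [dist_self, dist_eq_norm]
            refine max_lt hμ (max_lt ?_ ?_)
            · have : 0 ≤ η * B := by positivity
              linarith
            · refine (hWlip t ht r hr').trans_lt ?_
              have : B * ‖r - t‖ ≤ B * η := by gcongr
              linarith)
        have h' : dist (D s r (W r)) (D s t (W t)) < δ := this
        exact (le_of_eq (dist_eq_norm (D s r (W r)) (D s t (W t))).symm).trans h'.le
    have h3 : ‖W (t + η) - W t - η • sgrad (D s t (W t))‖ ≤ δ * η := by
      have : (t + η) - t = η := by ring
      rw [this, Real.norm_of_nonneg hη0.le] at h2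
      convert h2 using 2
      rw [add_smul]; abel
    -- Lipschitz term
    have h4 : ‖q - W t‖ ≤ e i + e (i + 1) + B * η := by
      have hlp := hWlip t ht _ ht'
      have : (t + η) - t = η := by ring
      rw [this, Real.norm_of_nonneg hη0.le] at hlp
      have ee : e (i + 1) = ‖w' (i + 1) - W (t + η)‖ := by simp only [he, htt]
      have e2 : q - W t = ((w' i - W t).1, ((w' (i + 1) - W (t + η)) + (W (t + η) - W t)).2) := by
        simp [hq]; rfl
      rw [e2]
      refine (pair_norm_le _ _).trans ?_
      rw [ee]
      have := norm_add_le (w' (i + 1) - W (t + η)) (W (t + η) - W t)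
      simp only [he]
      linarith
    have h5 : ‖sgrad (D s t q) - sgrad (D s t (W t))‖ ≤ L * (e i + e (i + 1) + B * η) := by
      rw [← sgrad_sub]
      refine (sgrad_norm _).trans ((hlip s hs t ht q (W t) (hWb t ht).1 (hWb t ht).2).trans ?_)
      gcongr
    have h6 : w' (i + 1) - W (t + η) = (w' i - W t) + η • (sgrad (D s t q) - sgrad (D s t (W t)))
        - (W (t + η) - W t - η • sgrad (D s t (W t))) := by
      rw [h1, smul_sub]; abel
    have h7 : e (i + 1) ≤ e i + η * (L * (e i + e (i + 1) + B * η)) + δ * η := by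
      have ee : e (i + 1) = ‖w' (i + 1) - W (t + η)‖ := by simp only [he, htt]
      refine (le_of_eq (ee.trans (congrArg norm h6))).trans ?_
      refine (norm_sub_le _ _).trans (add_le_add ((norm_add_le _ _).trans ?_) h3)
      rw [norm_smul, Real.norm_of_nonneg hη0.le]
      gcongr
    have h8 : η * (L * (B * η)) ≤ η * δ := by gcongr
    nlinarith
  have hfin := gronwall N hN L (2 * δ) hL (by positivity) hηL e (fun i => norm_nonneg _)
    (by simp [he, hw'0]) hestep
  have h9 : 2 * (2 * δ) * Real.exp (4 * L) = c / 2 := by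
    rw [hδ]; field_simp; norm_num
  rw [h9] at hfin
  have h10 : ‖(W 1).2‖ ≤ e N := by
    have : (W 1).2 = - (w' N - W (N / N)).2 := by
      rw [div_self hN'.ne']
      simp [hw', hwN]
    rw [this, norm_neg]
    exact norm_snd_le _
  linarith

end Disc
end PartM3

open Set
set_option linter.unusedSectionVars false
noncomputable section PartM3b

namespace Disc

variable {X : Type*} [NormedAddCommGroup X] [InnerProductSpace ℝ X] [FiniteDimensional ℝ X]

abbrev ZZ (X : Type*) (M : ℕ) := (Fin (M + 1) → X) × (Fin M → X)

/-- position coordinate -/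
def cx (M : ℕ) (i : ℕ) : ZZ X M →L[ℝ] X :=
  if h : i < M + 1 then
    (ContinuousLinearMap.proj (R := ℝ) (φ := fun _ : Fin (M + 1) => X) ⟨i, h⟩).comp
      (ContinuousLinearMap.fst ℝ _ _)
  else 0

/-- momentum coordinate -/
def cy (M : ℕ) (i : ℕ) : ZZ X M →L[ℝ] X :=
  if h : 1 ≤ i ∧ i < M + 1 then
    (ContinuousLinearMap.proj (R := ℝ) (φ := fun _ : Fin M => X) ⟨i - 1, by omega⟩).comp
      (ContinuousLinearMap.snd ℝ _ _)
  else 0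

lemma cx_of_lt {M i : ℕ} (h : i < M + 1) (z : ZZ X M) : cx M i z = z.1 ⟨i, h⟩ := by
  simp [cx, h]

lemma cy_zero {M : ℕ} (z : ZZ X M) : cy M 0 z = 0 := by simp [cy]

lemma cy_last {M : ℕ} (z : ZZ X M) : cy M (M + 1) z = 0 := by simp [cy]

lemma cy_of {M i : ℕ} (h : i < M) (z : ZZ X M) : cy M (i + 1) z = z.2 ⟨i, h⟩ := by
  simp [cy, h]

/-- discrete action -/
def act (M : ℕ) (h : ℝ → X × X → ℝ) (z : ZZ X M) : ℝ :=
  ∑ i ∈ Finset.range (M + 1), (inner ℝ (cy M i z - cy M (i + 1) z) (cx M i z)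
    - ((M + 1 : ℕ) : ℝ)⁻¹ * h ((i : ℝ) / (M + 1 : ℕ)) (cx M i z, cy M (i + 1) z))

def actD (M : ℕ) (D : ℝ → X × X → (X × X →L[ℝ] ℝ)) (z : ZZ X M) : ZZ X M →L[ℝ] ℝ :=
  ∑ i ∈ Finset.range (M + 1),
    ((innerSL ℝ (cy M i z - cy M (i + 1) z)).comp (cx M i)
      + (innerSL ℝ (cx M i z)).comp (cy M i - cy M (i + 1))
    - ((M + 1 : ℕ) : ℝ)⁻¹ • (D ((i : ℝ) / (M + 1 : ℕ)) (cx M i z, cy M (i + 1) z)).comp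
        ((cx M i).prod (cy M (i + 1))))

lemma tmem {M i : ℕ} (h : i ≤ M + 1) : (i : ℝ) / (M + 1 : ℕ) ∈ Icc (0 : ℝ) 1 := by
  have hN' : (0 : ℝ) < (M + 1 : ℕ) := by positivity
  have hiN : (i : ℝ) ≤ (M + 1 : ℕ) := by exact_mod_cast h
  exact ⟨by positivity, (div_le_one hN').2 hiN⟩

lemma act_hasFDeriv {M : ℕ} {h : ℝ → X × X → ℝ} {D : ℝ → X × X → (X × X →L[ℝ] ℝ)}
    (hD : ∀ t ∈ Icc (0 : ℝ) 1, ∀ w, HasFDerivAt (h t) (D t w) w) (z : ZZ X M) :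
    HasFDerivAt (act M h) (actD M D z) z := by
  unfold act actD
  refine HasFDerivAt.fun_sum fun i hi => ?_
  have hi' : i ≤ M + 1 := by have := Finset.mem_range.1 hi; omega
  have h1 : HasFDerivAt (fun z : ZZ X M => cy M i z - cy M (i + 1) z) (cy M i - cy M (i + 1)) z :=
    (cy (X := X) M i - cy M (i + 1)).hasFDerivAt
  have h2 : HasFDerivAt (fun z : ZZ X M => cx M i z) (cx M i) z := (cx (X := X) M i).hasFDerivAt
  have h3 : HasFDerivAt (fun z : ZZ X M => (cx M i z, cy M (i + 1) z))
      ((cx M i).prod (cy M (i + 1))) z := ((cx (X := X) M i).prod (cy M (i + 1))).hasFDerivAt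
  have h4 := (h1.inner ℝ h2).fun_sub (((hD _ (tmem hi') _).comp z h3).const_mul
    (((M + 1 : ℕ) : ℝ)⁻¹))
  refine h4.congr_fderiv ?_
  ext u
  all_goals simp [fderivInnerCLM_apply, real_inner_comm, inner_sub_left, inner_sub_right]
  all_goals ring

lemma act_cont {M : ℕ} {a : ℝ} {h : ℝ → ℝ → X × X → ℝ} {D : ℝ → ℝ → X × X → (X × X →L[ℝ] ℝ)}
    (hh : HomHam a h D) :
    ContinuousOn (fun q : ℝ × ZZ X M => act M (h q.1) q.2) (Icc a 1 ×ˢ univ) := by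
  unfold act
  refine continuousOn_finsetSum _ fun i hi => ?_
  have hi' : i ≤ M + 1 := by have := Finset.mem_range.1 hi; omega
  refine ContinuousOn.sub (by fun_prop) (continuousOn_const.mul ?_)
  exact hh.contH.comp (f := fun q : ℝ × ZZ X M =>
    (q.1, (i : ℝ) / (M + 1 : ℕ), (cx M i q.2, cy M (i + 1) q.2))) (by fun_prop)
    (fun q hq => ⟨hq.1, tmem hi', mem_univ _⟩)

lemma actD_cont {M : ℕ} {a : ℝ} {h : ℝ → ℝ → X × X → ℝ} {D : ℝ → ℝ → X × X → (X × X →L[ℝ] ℝ)}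
    (hh : HomHam a h D) :
    ContinuousOn (fun q : ℝ × ZZ X M => actD M (D q.1) q.2) (Icc a 1 ×ˢ univ) := by
  unfold actD
  refine continuousOn_finsetSum _ fun i hi => ?_
  have hi' : i ≤ M + 1 := by have := Finset.mem_range.1 hi; omega
  refine ContinuousOn.sub (Continuous.continuousOn ?_) (ContinuousOn.fun_const_smul ?_ _)
  · refine Continuous.add ?_ ?_
    · refine Continuous.clm_comp ((innerSL ℝ).continuous.comp (by fun_prop)) continuous_const
    · refine Continuous.clm_comp ((innerSL ℝ).continuous.comp (by fun_prop)) continuous_const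
  · refine ContinuousOn.clm_comp ?_ continuousOn_const
    exact hh.contD.comp (f := fun q : ℝ × ZZ X M =>
      (q.1, (i : ℝ) / (M + 1 : ℕ), (cx M i q.2, cy M (i + 1) q.2))) (by fun_prop)
      (fun q hq => ⟨hq.1, tmem hi', mem_univ _⟩)

lemma act_hom {M : ℕ} {h : ℝ → X × X → ℝ}
    (hom : ∀ t ∈ Icc (0 : ℝ) 1, ∀ (c : ℝ) w, h t (c • w) = c ^ 2 * h t w) (c : ℝ) (z : ZZ X M) :
    act M h (c • z) = c ^ 2 * act M h z := by
  unfold act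
  rw [Finset.mul_sum]
  refine Finset.sum_congr rfl fun i hi => ?_
  have hi' : i ≤ M + 1 := by have := Finset.mem_range.1 hi; omega
  have h1 : (cx M i (c • z), cy M (i + 1) (c • z)) = c • (cx M i z, cy M (i + 1) z) := by
    simp
  rw [h1, hom _ (tmem hi')]
  simp only [map_smul, ← smul_sub, real_inner_smul_left, real_inner_smul_right]
  ring

lemma crit_dorb {M : ℕ} (D : ℝ → X × X → (X × X →L[ℝ] ℝ)) (z : ZZ X M) (hz : actD M D z = 0) :
    ∃ w : ℕ → X × X, DOrb (M + 1) (fun t w => sgrad (D t w)) w ∧ (w 0).2 = 0 ∧ (w (M + 1)).2 = 0 ∧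
      ((∀ i ≤ M + 1, w i = 0) → z = 0) := by
  set v : ℕ → X × X := fun i => sgrad (D ((i : ℝ) / (M + 1 : ℕ)) (cx M i z, cy M (i + 1) z)) with hv
  set η := ((M + 1 : ℕ) : ℝ)⁻¹ with hη
  have hform : ∀ u : ZZ X M, ∑ i ∈ Finset.range (M + 1),
      (inner ℝ (cy M i z - cy M (i + 1) z + η • (v i).2) (cx M i u)
        + inner ℝ (cx M i z) (cy M i u) - inner ℝ (cx M i z + η • (v i).1) (cy M (i + 1) u)) = 0 := by
    intro u
    have h1 : actD M D z u = 0 := by rw [hz]; rfl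
    rw [← h1]
    simp only [actD, sum_apply, add_apply, sub_apply,
      smul_apply, ContinuousLinearMap.comp_apply, ContinuousLinearMap.prod_apply, innerSL_apply_apply]
    refine Finset.sum_congr rfl fun i _ => ?_
    rw [sgrad_spec (D _ _)]
    simp only [hv, ← hη, inner_add_left, real_inner_smul_left, inner_sub_right, smul_eq_mul]
    ring
  -- X-variation
  have hX : ∀ j < M + 1, cy M (j + 1) z = cy M j z + η • (v j).2 := by
    intro j hj
    have h1 : ∀ a : X, inner ℝ (cy M j z - cy M (j + 1) z + η • (v j).2) a = 0 := by
      intro a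
      have h2 := hform (Pi.single ⟨j, hj⟩ a, 0)
      have hy : ∀ i, cy M i ((Pi.single ⟨j, hj⟩ a, 0) : ZZ X M) = 0 := by
        intro i; unfold cy; split_ifs <;> simp
      rw [Finset.sum_eq_single j] at h2
      · rw [hy, hy, cx_of_lt hj] at h2
        simpa using h2
      · intro i hi hij
        rw [hy, hy, cx_of_lt (Finset.mem_range.1 hi)]
        have : (⟨i, Finset.mem_range.1 hi⟩ : Fin (M + 1)) ≠ ⟨j, hj⟩ := by
          intro h; exact hij (Fin.mk.inj_iff.1 h)
        simp [Pi.single_eq_of_ne this]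
      · intro h; exact absurd (Finset.mem_range.2 hj) h
    have h3 := ext_inner_right ℝ (x := cy M j z - cy M (j + 1) z + η • (v j).2) (y := 0)
      (fun a => by rw [h1 a, inner_zero_left])
    rw [← sub_eq_zero, ← neg_eq_zero, ← h3]; abel
  have hY : ∀ j < M, cx M (j + 1) z = cx M j z + η • (v j).1 := by
    intro j hj
    have h1 : ∀ a : X, inner ℝ (cx M (j + 1) z - (cx M j z + η • (v j).1)) a = 0 := by
      intro a
      have h2 := hform (0, Pi.single ⟨j, hj⟩ a)
      have hx : ∀ i, cx M i ((0, Pi.single ⟨j, hj⟩ a) : ZZ X M) = 0 := by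
        intro i; unfold cx; split_ifs <;> simp
      have hy : ∀ i, cy M i ((0, Pi.single ⟨j, hj⟩ a) : ZZ X M) = if i = j + 1 then a else 0 := by
        intro i
        unfold cy
        split_ifs with h3 h4 h4
        · subst h4; simp
        · have : (⟨i - 1, by omega⟩ : Fin M) ≠ ⟨j, hj⟩ := by
            intro h; have := Fin.mk.inj_iff.1 h; omega
          simp [Pi.single_eq_of_ne this]
        · omega
        · simp
      simp only [hx, hy, inner_zero_right, zero_add, Finset.sum_sub_distrib] at h2
      have e1 : ∑ i ∈ Finset.range (M + 1), inner ℝ (cx M i z) (if i = j + 1 then a else 0)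
          = inner ℝ (cx M (j + 1) z) a := by
        rw [Finset.sum_eq_single (j + 1)]
        · simp
        · intro i _ hi; simp [hi]
        · intro h; exact absurd (Finset.mem_range.2 (by omega)) h
      have e2 : ∑ i ∈ Finset.range (M + 1), inner ℝ (cx M i z + η • (v i).1)
          (if i + 1 = j + 1 then a else 0) = inner ℝ (cx M j z + η • (v j).1) a := by
        rw [Finset.sum_eq_single j]
        · simp
        · intro i _ hi; simp [hi]
        · intro h; exact absurd (Finset.mem_range.2 (by omega)) h
      rw [e1, e2] at h2
      rw [inner_sub_left]; exact h2
    have h3 := ext_inner_right ℝ (x := cx M (j + 1) z - (cx M j z + η • (v j).1)) (y := 0)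
      (fun a => by rw [h1 a, inner_zero_left])
    exact sub_eq_zero.1 h3
  refine ⟨fun i => if i < M + 1 then (cx M i z, cy M i z) else (cx M M z + η • (v M).1, 0),
    ?_, ?_, ?_, ?_⟩
  · intro i hi
    simp only [hi, if_true]
    by_cases hi2 : i < M
    · have : i + 1 < M + 1 := by omega
      simp only [this, if_true]
      refine Prod.ext ?_ ?_
      · exact hY i hi2
      · exact hX i hi
    · have hiM : i = M := by omega
      subst hiM
      simp only [lt_irrefl, if_false]
      have h5 := hX i hi
      have h6 := cy_last z
      refine Prod.ext ?_ ?_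
      · simp only [hv, h6]; rfl
      · rw [h6] at h5
        refine h5.trans ?_
        simp only [hv, h6]; rfl
  · simp [cy_zero]
  · simp
  · intro hw
    refine Prod.ext ?_ ?_
    · ext1 ⟨i, hi⟩
      have := hw i hi.le
      simp only [hi, if_true] at this
      have := congrArg Prod.fst this
      rwa [cx_of_lt hi] at this
    · ext1 ⟨i, hi⟩
      have := hw (i + 1) (by omega)
      simp only [show i + 1 < M + 1 by omega, if_true] at this
      have := congrArg Prod.snd this
      rwa [cy_of hi] at this

theorem rel_act {a : ℝ} (ha : a ≤ 1) {h : ℝ → ℝ → X × X → ℝ}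
    {D : ℝ → ℝ → X × X → (X × X →L[ℝ] ℝ)}
    (hh : HomHam a h D) (ho : Orbits a D) :
    ∃ N0 : ℕ, ∀ M ≥ N0, Dfm.Rel (act (X := X) M (h 1)) (act M (h a)) := by
  obtain ⟨N0, hN0⟩ := no_dorb hh ho
  refine ⟨N0, fun M hM => ?_⟩
  refine Dfm.deform (fun s => act M (h s)) (fun s => actD M (D s)) a 1 ha
    (fun s hs z => act_hasFDeriv (hh.hasD s hs) z) (act_cont hh) (actD_cont hh)
    (fun s hs c z => act_hom (hh.hom s hs) c z) ?_
  intro s hs z hz h0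
  obtain ⟨w, h1, h2, h3, h4⟩ := crit_dorb (D s) z h0
  exact hz (h4 (hN0 (M + 1) (by omega) (by omega) s hs w h1 h2 h3))

end Disc
end PartM3b

open Set
set_option linter.unusedSectionVars false
noncomputable section PartM3c

namespace Disc

section ext
variable {V : Type*} [NormedAddCommGroup V] [NormedSpace ℝ V]

abbrev iota (V : Type*) [NormedAddCommGroup V] [NormedSpace ℝ V] : V →L[ℝ] ℝ × ℝ × V :=
  (ContinuousLinearMap.inr ℝ ℝ (ℝ × V)).comp (ContinuousLinearMap.inr ℝ ℝ V)

lemma iota_hasFDeriv (s t : ℝ) (w : V) : HasFDerivAt (fun w : V => (s, t, w)) (iota V) w := by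
  have := (hasFDerivAt_const (𝕜 := ℝ) s w).prodMk
    ((hasFDerivAt_const (𝕜 := ℝ) t w).prodMk (hasFDerivAt_id (𝕜 := ℝ) w))
  refine this.congr_fderiv ?_
  ext v <;> simp

lemma clm_norm_smul (c : ℝ) (f : V →L[ℝ] ℝ) : ‖c • f‖ = ‖c‖ * ‖f‖ := norm_smul c f

lemma clm_norm_zero : ‖(0 : V →L[ℝ] ℝ)‖ = 0 := norm_zero
lemma clm_norm_sub_le (f g : V →L[ℝ] ℝ) : ‖f - g‖ ≤ ‖f‖ + ‖g‖ := norm_sub_le f g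

variable [FiniteDimensional ℝ V]

theorem hom_gen {a : ℝ} (h : ℝ → ℝ → V → ℝ)
    (hs : ∀ s ∈ Icc a 1, ∀ t ∈ Icc (0 : ℝ) 1, ∀ w, w ≠ 0 →
      ContDiffAt ℝ 2 (fun q : ℝ × ℝ × V => h q.1 q.2.1 q.2.2) (s, t, w))
    (hom : ∀ s ∈ Icc a 1, ∀ t ∈ Icc (0 : ℝ) 1, ∀ (c : ℝ) w, h s t (c • w) = c ^ 2 * h s t w) :
    (∀ s ∈ Icc a 1, ∀ t ∈ Icc (0 : ℝ) 1, ∀ w, HasFDerivAt (h s t) (fderiv ℝ (h s t) w) w) ∧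
    ContinuousOn (fun q : ℝ × ℝ × V => h q.1 q.2.1 q.2.2) (Icc a 1 ×ˢ Icc (0 : ℝ) 1 ×ˢ univ) ∧
    ContinuousOn (fun q : ℝ × ℝ × V => fderiv ℝ (h q.1 q.2.1) q.2.2)
      (Icc a 1 ×ˢ Icc (0 : ℝ) 1 ×ˢ univ) ∧
    (∀ s ∈ Icc a 1, ∀ t ∈ Icc (0 : ℝ) 1, ∀ (c : ℝ) w,
      fderiv ℝ (h s t) (c • w) = c • fderiv ℝ (h s t) w) ∧
    (∃ C, 0 ≤ C ∧ ∀ s ∈ Icc a 1, ∀ t ∈ Icc (0 : ℝ) 1, ∀ w, ‖fderiv ℝ (h s t) w‖ ≤ C * ‖w‖) ∧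
    (∀ c1 c2 : ℝ, 0 < c1 → ∃ L, 0 ≤ L ∧ ∀ s ∈ Icc a 1, ∀ t ∈ Icc (0 : ℝ) 1, ∀ w W,
    c1 ≤ ‖W‖ → ‖W‖ ≤ c2 → ‖fderiv ℝ (h s t) w - fderiv ℝ (h s t) W‖ ≤ L * ‖w - W‖) := by
  set G : ℝ × ℝ × V → ℝ := fun q => h q.1 q.2.1 q.2.2 with hG
  set F : ℝ × ℝ × V → (V →L[ℝ] ℝ) := fun q => (fderiv ℝ G q).comp (iota V) with hF
  have hFc : ∀ s ∈ Icc a 1, ∀ t ∈ Icc (0 : ℝ) 1, ∀ w, w ≠ 0 → ContDiffAt ℝ 1 F (s, t, w) := by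
    intro s hs' t ht w hw
    have := (hs s hs' t ht w hw).fderiv_right (m := 1) (by norm_num)
    exact this.clm_comp contDiffAt_const
  have hDw : ∀ s ∈ Icc a 1, ∀ t ∈ Icc (0 : ℝ) 1, ∀ w, w ≠ 0 →
      HasFDerivAt (h s t) (F (s, t, w)) w := by
    intro s hs' t ht w hw
    have h1 := ((hs s hs' t ht w hw).differentiableAt (by norm_num)).hasFDerivAt
    exact h1.comp w (iota_hasFDeriv s t w)
  have hDF : ∀ s ∈ Icc a 1, ∀ t ∈ Icc (0 : ℝ) 1, ∀ w, w ≠ 0 → fderiv ℝ (h s t) w = F (s, t, w) :=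
    fun s hs' t ht w hw => (hDw s hs' t ht w hw).fderiv
  have cpt : ∀ A : Set V, IsCompact A → IsCompact (Icc a 1 ×ˢ Icc (0 : ℝ) 1 ×ˢ A) :=
    fun A hA => isCompact_Icc.prod (isCompact_Icc.prod hA)
  have sph : ∀ w ∈ Metric.sphere (0 : V) 1, w ≠ 0 := by
    intro w hw h0
    simp [h0] at hw
  obtain ⟨C0, hC0⟩ := (cpt _ (isCompact_sphere (0 : V) 1)).exists_bound_of_continuousOn
    (f := G) (by
      rintro ⟨s, t, w⟩ ⟨h1, h2, h3⟩
      exact (hs s h1 t h2 w (sph w h3)).continuousAt.continuousWithinAt)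
  obtain ⟨C1, hC1⟩ := (cpt _ (isCompact_sphere (0 : V) 1)).exists_bound_of_continuousOn
    (f := F) (by
      rintro ⟨s, t, w⟩ ⟨h1, h2, h3⟩
      exact (hFc s h1 t h2 w (sph w h3)).continuousAt.continuousWithinAt)
  have nrm : ∀ w : V, w ≠ 0 → ‖w‖⁻¹ • w ∈ Metric.sphere (0 : V) 1 := by
    intro w hw
    simp [norm_smul, norm_ne_zero_iff.2 hw]
  have nrm2 : ∀ w : V, w ≠ 0 → ‖w‖ • (‖w‖⁻¹ • w) = w := by
    intro w hw
    rw [smul_smul, mul_inv_cancel₀ (norm_ne_zero_iff.2 hw), one_smul]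
  have h00 : ∀ s ∈ Icc a 1, ∀ t ∈ Icc (0 : ℝ) 1, h s t 0 = 0 := by
    intro s hs' t ht
    have := hom s hs' t ht 0 0
    simpa using this
  have hbd : ∀ s ∈ Icc a 1, ∀ t ∈ Icc (0 : ℝ) 1, ∀ w, ‖h s t w‖ ≤ |C0| * ‖w‖ ^ 2 := by
    intro s hs' t ht w
    rcases eq_or_ne w 0 with rfl | hw
    · simp [h00 s hs' t ht]
    · rw [← nrm2 w hw, hom s hs' t ht, nrm2 w hw, norm_mul]
      have := hC0 (s, t, ‖w‖⁻¹ • w) ⟨hs', ht, nrm w hw⟩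
      have h2 : ‖h s t (‖w‖⁻¹ • w)‖ ≤ |C0| := this.trans (le_abs_self _)
      rw [norm_pow, norm_norm]
      nlinarith [sq_nonneg ‖w‖]
  have hz : ∀ s ∈ Icc a 1, ∀ t ∈ Icc (0 : ℝ) 1, HasFDerivAt (h s t) (0 : V →L[ℝ] ℝ) 0 := by
    intro s hs' t ht
    rw [hasFDerivAt_iff_isLittleO_nhds_zero]
    simp only [zero_add, h00 s hs' t ht, zero_apply, sub_zero]
    have h1 : (fun w => h s t w) =O[nhds 0] (fun w : V => ‖w‖ ^ 2) :=
      Asymptotics.IsBigO.of_bound |C0| (Filter.Eventually.of_forall fun w => by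
        simpa using hbd s hs' t ht w)
    refine h1.trans_isLittleO ?_
    exact Asymptotics.isLittleO_norm_pow_id one_lt_two
  have hD0 : ∀ s ∈ Icc a 1, ∀ t ∈ Icc (0 : ℝ) 1, fderiv ℝ (h s t) 0 = 0 :=
    fun s hs' t ht => (hz s hs' t ht).fderiv
  have hasD : ∀ s ∈ Icc a 1, ∀ t ∈ Icc (0 : ℝ) 1, ∀ w,
      HasFDerivAt (h s t) (fderiv ℝ (h s t) w) w := by
    intro s hs' t ht w
    rcases eq_or_ne w 0 with rfl | hw
    · rw [hD0 s hs' t ht]; exact hz s hs' t ht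
    · rw [hDF s hs' t ht w hw]; exact hDw s hs' t ht w hw
  have homD : ∀ s ∈ Icc a 1, ∀ t ∈ Icc (0 : ℝ) 1, ∀ (c : ℝ) w,
      fderiv ℝ (h s t) (c • w) = c • fderiv ℝ (h s t) w := by
    intro s hs' t ht c w
    rcases eq_or_ne c 0 with rfl | hc
    · simp [hD0 s hs' t ht]
    · have h1 : HasFDerivAt (fun w => h s t (c • w))
          ((fderiv ℝ (h s t) (c • w)).comp (c • ContinuousLinearMap.id ℝ V)) w :=
        (hasD s hs' t ht (c • w)).comp w ((hasFDerivAt_id w).const_smul c)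
      have h2 : HasFDerivAt (fun w => h s t (c • w)) (c ^ 2 • fderiv ℝ (h s t) w) w := by
        have := (hasD s hs' t ht w).const_mul (c ^ 2)
        exact this.congr_of_eventuallyEq (Filter.Eventually.of_forall fun w => hom s hs' t ht c w)
      have h3 := h1.unique h2
      refine ContinuousLinearMap.ext fun v => ?_
      have h4 := congrArg (fun f : V →L[ℝ] ℝ => f v) h3
      simp at h4
      have h5 : c * (fderiv ℝ (h s t) (c • w) v) = c * (c * fderiv ℝ (h s t) w v) := by
        rw [h4]; ring
      simpa using mul_left_cancel₀ hc h5
  have bd : ∀ s ∈ Icc a 1, ∀ t ∈ Icc (0 : ℝ) 1, ∀ w, ‖fderiv ℝ (h s t) w‖ ≤ |C1| * ‖w‖ := by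
    intro s hs' t ht w
    rcases eq_or_ne w 0 with rfl | hw
    · rw [hD0 s hs' t ht]
      refine le_of_eq (clm_norm_zero.trans ?_)
      simp
    · rw [← nrm2 w hw, homD s hs' t ht, nrm2 w hw]
      refine (le_of_eq (clm_norm_smul _ _)).trans ?_
      rw [norm_norm, mul_comm]
      refine mul_le_mul_of_nonneg_right ?_ (norm_nonneg _)
      rw [hDF s hs' t ht _ (sph _ (nrm w hw))]
      exact (hC1 (s, t, ‖w‖⁻¹ • w) ⟨hs', ht, nrm w hw⟩).trans (le_abs_self _)
  have tz : ∀ (s t : ℝ), Filter.Tendsto (fun q : ℝ × ℝ × V => ‖q.2.2‖)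
      (nhdsWithin (s, t, 0) (Icc a 1 ×ˢ Icc (0 : ℝ) 1 ×ˢ univ)) (nhds 0) := by
    intro s t
    have : Continuous (fun q : ℝ × ℝ × V => ‖q.2.2‖) := by fun_prop
    have h1 := this.tendsto (s, t, (0 : V))
    simp only [norm_zero] at h1
    exact h1.mono_left nhdsWithin_le_nhds
  refine ⟨hasD, ?_, ?_, homD, ⟨|C1|, abs_nonneg _, bd⟩, ?_⟩
  · rintro ⟨s, t, w⟩ ⟨h1, h2, -⟩
    rcases eq_or_ne w 0 with rfl | hw
    · refine Metric.continuousWithinAt_iff.2 ?_ |>.congr_of_eventuallyEq Filter.EventuallyEq.rfl rfl |> id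
      have : Filter.Tendsto (fun q : ℝ × ℝ × V => |C0| * ‖q.2.2‖ ^ 2)
        (nhdsWithin (s, t, 0) (Icc a 1 ×ˢ Icc (0 : ℝ) 1 ×ˢ univ)) (nhds 0) := by
        simpa using ((tz s t).pow 2).const_mul |C0|
      have h3 : Filter.Tendsto (fun q : ℝ × ℝ × V => h q.1 q.2.1 q.2.2)
        (nhdsWithin (s, t, 0) (Icc a 1 ×ˢ Icc (0 : ℝ) 1 ×ˢ univ)) (nhds 0) := by
        refine squeeze_zero_norm' ?_ this
        filter_upwards [self_mem_nhdsWithin] with q hq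
        exact hbd _ hq.1 _ hq.2.1 _
      have h4 : ContinuousWithinAt (fun q : ℝ × ℝ × V => h q.1 q.2.1 q.2.2)
        (Icc a 1 ×ˢ Icc (0 : ℝ) 1 ×ˢ univ) (s, t, 0) := by
        unfold ContinuousWithinAt
        simpa only [h00 s h1 t h2] using h3
      exact Metric.continuousWithinAt_iff.1 h4
    · exact (hs s h1 t h2 w hw).continuousAt.continuousWithinAt
  · rintro ⟨s, t, w⟩ ⟨h1, h2, -⟩
    rcases eq_or_ne w 0 with rfl | hw
    · have : Filter.Tendsto (fun q : ℝ × ℝ × V => |C1| * ‖q.2.2‖)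
        (nhdsWithin (s, t, 0) (Icc a 1 ×ˢ Icc (0 : ℝ) 1 ×ˢ univ)) (nhds 0) := by
        simpa using (tz s t).const_mul |C1|
      have h3 : Filter.Tendsto (fun q : ℝ × ℝ × V => fderiv ℝ (h q.1 q.2.1) q.2.2)
        (nhdsWithin (s, t, 0) (Icc a 1 ×ˢ Icc (0 : ℝ) 1 ×ˢ univ)) (nhds 0) := by
        refine squeeze_zero_norm' ?_ this
        filter_upwards [self_mem_nhdsWithin] with q hq
        exact bd _ hq.1 _ hq.2.1 _
      unfold ContinuousWithinAt
      simpa only [hD0 s h1 t h2] using h3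
    · have h3 := (hFc s h1 t h2 w hw).continuousAt.continuousWithinAt
        (s := Icc a 1 ×ˢ Icc (0 : ℝ) 1 ×ˢ univ)
      refine h3.congr_of_eventuallyEq ?_ (hDF s h1 t h2 w hw)
      have h5 : ∀ᶠ q : ℝ × ℝ × V in nhds (s, t, w), q.2.2 ≠ 0 := by
        have : Continuous (fun q : ℝ × ℝ × V => q.2.2) := by fun_prop
        exact this.continuousAt.eventually_ne hw
      filter_upwards [self_mem_nhdsWithin, nhdsWithin_le_nhds h5] with q hq hq2
      exact hDF _ hq.1 _ hq.2.1 _ hq2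
  · intro c1 c2 hc1
    have hAc : IsCompact {w : V | c1 / 2 ≤ ‖w‖ ∧ ‖w‖ ≤ c2 + c1 / 2} := by
      refine Metric.isCompact_of_isClosed_isBounded ?_ ?_
      · exact (isClosed_le continuous_const continuous_norm).inter
          (isClosed_le continuous_norm continuous_const)
      · refine (Metric.isBounded_closedBall (x := (0 : V)) (r := c2 + c1 / 2)).subset ?_
        intro w hw
        simpa using hw.2
    have hne : ∀ w : V, c1 / 2 ≤ ‖w‖ → w ≠ 0 := by
      rintro w hw rfl
      simp at hw; linarith
    obtain ⟨L1, hL1⟩ := (cpt _ hAc).exists_bound_of_continuousOn (f := fderiv ℝ F) (by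
      rintro ⟨s, t, w⟩ ⟨h1, h2, h3⟩
      exact ((hFc s h1 t h2 w (hne w h3.1)).fderiv_right (m := 0)
        (by norm_num)).continuousAt.continuousWithinAt)
    have hi : 0 ≤ ‖iota V‖ := norm_nonneg _
    have hA : 0 ≤ |L1| * ‖iota V‖ := by positivity
    have hB : 0 ≤ |C1| * (1 + 4 * |c2| / c1) := by positivity
    refine ⟨|L1| * ‖iota V‖ + |C1| * (1 + 4 * |c2| / c1), by positivity, ?_⟩
    intro s hs' t ht w W hW1 hW2
    have hn := norm_nonneg (w - W)
    rcases le_or_gt ‖w - W‖ (c1 / 2) with hle | hgt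
    · have hball : ∀ v ∈ Metric.closedBall W (c1 / 2), c1 / 2 ≤ ‖v‖ ∧ ‖v‖ ≤ c2 + c1 / 2 := by
        intro v hv
        rw [mem_closedBall_iff_norm] at hv
        have e1 := norm_sub_norm_le W v
        have e2 := norm_sub_norm_le v W
        rw [norm_sub_rev] at e1
        constructor <;> linarith
      have key := Convex.norm_image_sub_le_of_norm_hasFDerivWithin_le
        (f := fun v => F (s, t, v)) (f' := fun v => (fderiv ℝ F (s, t, v)).comp (iota V))
        (s := Metric.closedBall W (c1 / 2)) (C := |L1| * ‖iota V‖) (x := W) (y := w) ?_ ?_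
        (convex_closedBall _ _) (Metric.mem_closedBall_self (by linarith))
        (by rw [mem_closedBall_iff_norm]; exact hle)
      · rw [hDF s hs' t ht w (hne w (hball w (by rw [mem_closedBall_iff_norm]; exact hle)).1),
          hDF s hs' t ht W (hne W (by linarith))]
        refine key.trans ?_
        nlinarith
      · intro v hv
        have h1 := ((hFc s hs' t ht v (hne v (hball v hv).1)).differentiableAt
          (by norm_num)).hasFDerivAt
        exact (h1.comp v (iota_hasFDeriv s t v)).hasFDerivWithinAt
      · intro v hv
        refine (ContinuousLinearMap.opNorm_comp_le _ _).trans ?_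
        exact mul_le_mul_of_nonneg_right
          ((hL1 (s, t, v) ⟨hs', ht, hball v hv⟩).trans (le_abs_self _)) hi
    · have e1 := bd s hs' t ht w
      have e2 := bd s hs' t ht W
      have e3 := clm_norm_sub_le (fderiv ℝ (h s t) w) (fderiv ℝ (h s t) W)
      have e4 : ‖w‖ ≤ ‖w - W‖ + ‖W‖ := by simpa using norm_add_le (w - W) W
      have e5 : ‖w‖ + ‖W‖ ≤ (1 + 4 * |c2| / c1) * ‖w - W‖ := by
        have : 4 * |c2| / c1 * ‖w - W‖ ≥ 4 * |c2| / c1 * (c1 / 2) :=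
          mul_le_mul_of_nonneg_left hgt.le (by positivity)
        have h6 : 4 * |c2| / c1 * (c1 / 2) = 2 * |c2| := by field_simp; ring
        have := le_abs_self c2
        linarith
      have e6 : |C1| * (‖w‖ + ‖W‖) ≤ |C1| * ((1 + 4 * |c2| / c1) * ‖w - W‖) :=
        mul_le_mul_of_nonneg_left e5 (abs_nonneg _)
      nlinarith

end ext

variable {X : Type*} [NormedAddCommGroup X] [InnerProductSpace ℝ X] [FiniteDimensional ℝ X]

theorem homHam_of_smooth {a : ℝ} (h : ℝ → ℝ → X × X → ℝ)
    (hs : ∀ s ∈ Icc a 1, ∀ t ∈ Icc (0 : ℝ) 1, ∀ w, w ≠ 0 →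
      ContDiffAt ℝ 2 (fun q : ℝ × ℝ × (X × X) => h q.1 q.2.1 q.2.2) (s, t, w))
    (hom : ∀ s ∈ Icc a 1, ∀ t ∈ Icc (0 : ℝ) 1, ∀ (c : ℝ) w, h s t (c • w) = c ^ 2 * h s t w) :
    HomHam a h (fun s t w => fderiv ℝ (h s t) w) := by
  obtain ⟨h1, h2, h3, h4, h5, h6⟩ := hom_gen (V := X × X) h hs hom
  exact ⟨h1, h2, h3, hom, h4, h5, h6⟩

end Disc
end PartM3c

open Set
set_option linter.unusedSectionVars false
noncomputable section PartM4

namespace Idx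

variable {E : Type*} [NormedAddCommGroup E] [InnerProductSpace ℝ E]

lemma sum_blocks (f : ℕ → ℝ) (L J : ℕ) :
    ∑ i ∈ Finset.range (J * L), f i = ∑ j ∈ Finset.range J, ∑ r ∈ Finset.range L, f (j * L + r) := by
  induction J with
  | zero => simp
  | succ J ih => rw [Nat.succ_mul, Finset.sum_range_add, ih, Finset.sum_range_succ]

lemma sum_parts (Xs Ys : ℕ → E) (m : ℕ) :
    ∑ i ∈ Finset.range (m + 1), inner ℝ (Ys i - Ys (i + 1)) (Xs i)
      = inner ℝ (Ys 0) (Xs 0) + ∑ i ∈ Finset.range m, inner ℝ (Ys (i + 1)) (Xs (i + 1) - Xs i)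
        - inner ℝ (Ys (m + 1)) (Xs m) := by
  induction m with
  | zero => simp [inner_sub_left]
  | succ m ih =>
    rw [Finset.sum_range_succ, ih, Finset.sum_range_succ (n := m)]
    simp only [inner_sub_left, inner_sub_right]
    ring

lemma chain (x : ℕ → E) (b r : ℕ) (hx : x b = 0) :
    ‖x (b + r)‖ ^ 2 ≤ r * ∑ s ∈ Finset.range r, ‖x (b + s + 1) - x (b + s)‖ ^ 2 := by
  have h1 : x (b + r) = ∑ s ∈ Finset.range r, (x (b + s + 1) - x (b + s)) := by
    have := Finset.sum_range_sub (fun s => x (b + s)) r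
    simp only [add_zero, hx, sub_zero] at this
    exact this.symm
  have h2 : ‖x (b + r)‖ ≤ ∑ s ∈ Finset.range r, ‖x (b + s + 1) - x (b + s)‖ := by
    rw [h1]; exact norm_sum_le _ _
  have h3 := sq_sum_le_card_mul_sum_sq (s := Finset.range r)
    (f := fun s => ‖x (b + s + 1) - x (b + s)‖)
  rw [Finset.card_range] at h3
  refine le_trans ?_ h3
  exact pow_le_pow_left₀ (norm_nonneg _) h2 2

lemma poincare (x : ℕ → E) (L J M : ℕ) (hM : M + 1 = J * L)
    (hx : ∀ j < J, x (j * L) = 0) :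
    ∑ i ∈ Finset.range (M + 1), ‖x i‖ ^ 2
      ≤ (L : ℝ) ^ 2 * ∑ i ∈ Finset.range M, ‖x (i + 1) - x i‖ ^ 2 := by
  set e : ℕ → ℝ := fun i => if i < M then ‖x (i + 1) - x i‖ ^ 2 else 0 with he
  have he0 : ∀ i, 0 ≤ e i := by intro i; simp only [he]; split_ifs <;> positivity
  have hs : ∑ i ∈ Finset.range M, ‖x (i + 1) - x i‖ ^ 2 = ∑ i ∈ Finset.range (M + 1), e i := by
    rw [Finset.sum_range_succ]
    have : e M = 0 := by simp [he]
    rw [this, add_zero]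
    refine Finset.sum_congr rfl fun i hi => ?_
    simp [he, Finset.mem_range.1 hi]
  rw [hs, hM, sum_blocks, sum_blocks, Finset.mul_sum]
  refine Finset.sum_le_sum fun j hj => ?_
  have hj' := Finset.mem_range.1 hj
  have : ∀ r ∈ Finset.range L, ‖x (j * L + r)‖ ^ 2
      ≤ (L : ℝ) * ∑ s ∈ Finset.range L, e (j * L + s) := by
    intro r hr
    have hr' := Finset.mem_range.1 hr
    refine (chain x (j * L) r (hx j hj')).trans ?_
    have hsub : ∑ s ∈ Finset.range r, ‖x (j * L + s + 1) - x (j * L + s)‖ ^ 2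
        ≤ ∑ s ∈ Finset.range L, e (j * L + s) := by
      refine le_trans (le_of_eq ?_) (Finset.sum_le_sum_of_subset_of_nonneg
        (Finset.range_mono hr'.le) (fun i _ _ => he0 _))
      refine Finset.sum_congr rfl fun s hs => ?_
      have hs' := Finset.mem_range.1 hs
      have : j * L + L ≤ J * L := by
        have := Nat.mul_le_mul_right L (Nat.succ_le_of_lt hj')
        rwa [Nat.succ_mul] at this
      have h3 : j * L + s < M := by omega
      simp [he, h3]
    have hrL : (r : ℝ) ≤ L := by exact_mod_cast hr'.le
    exact mul_le_mul hrL hsub (Finset.sum_nonneg fun _ _ => by positivity) (by positivity)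
  refine (Finset.sum_le_sum this).trans (le_of_eq ?_)
  rw [Finset.sum_const, Finset.card_range, nsmul_eq_mul]
  ring

/-- tent function -/
def tent (P r : ℕ) : ℝ := min (r : ℝ) (2 * P - r)

lemma tent_zero (P : ℕ) : tent P 0 = 0 := by simp [tent]
lemma tent_end (P : ℕ) : tent P (2 * P) = 0 := by simp [tent]
lemma tent_lo {P r : ℕ} (h : r ≤ P) : tent P r = r := by
  have : (r : ℝ) ≤ P := by exact_mod_cast h
  simp only [tent]; apply min_eq_left; linarith
lemma tent_hi {P r : ℕ} (h : P ≤ r) : tent P r = 2 * P - r := by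
  have : (P : ℝ) ≤ r := by exact_mod_cast h
  simp only [tent]; apply min_eq_right; linarith

lemma tent_step (P r : ℕ) : (tent P r - tent P (r + 1)) ^ 2 = 1 := by
  rcases lt_or_ge r P with h | h
  · rw [tent_lo h.le, tent_lo (Nat.succ_le_of_lt h)]; push_cast; ring
  · rw [tent_hi h, tent_hi (h.trans (Nat.le_succ r))]; push_cast; ring

lemma sum_sq_lb (m : ℕ) : (m : ℝ) ^ 3 / 3 ≤ ∑ r ∈ Finset.range m, ((r : ℝ) + 1) ^ 2 := by
  induction m with
  | zero => simp
  | succ m ih =>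
    rw [Finset.sum_range_succ]
    push_cast
    have : (0 : ℝ) ≤ m := by positivity
    nlinarith

lemma tent_sum (P : ℕ) : (P : ℝ) ^ 3 / 3 ≤ ∑ r ∈ Finset.range (2 * P), tent P (r + 1) ^ 2 := by
  refine (sum_sq_lb P).trans ?_
  refine le_trans (le_of_eq ?_) (Finset.sum_le_sum_of_subset_of_nonneg
        (Finset.range_mono (by omega : P ≤ 2 * P)) (fun i _ _ => by positivity))
  refine Finset.sum_congr rfl fun r hr => ?_
  rw [tent_lo (Nat.succ_le_of_lt (Finset.mem_range.1 hr))]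
  push_cast; ring

lemma bpart (P k : ℕ) (hP : 0 < P) (c : ℝ) (hc : 0 < c) (hcP : 4 ≤ c * P) (cs : ℕ → ℝ) (η ξ : ℕ → ℝ)
    (hη : ∀ j < k, ∀ r ≤ 2 * P, η (j * (2 * P) + r) = cs j * tent P r)
    (hne : (∃ j < k, cs j ≠ 0) ∨ (∃ i < k * (2 * P), ξ i ≠ 0)) :
    ∑ i ∈ Finset.range (k * (2 * P)),
      ((η i - η (i + 1)) * ξ i - c / 2 * (ξ i ^ 2 + η (i + 1) ^ 2)) < 0 := by
  by_cases h : ∃ j < k, cs j ≠ 0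
  · have h1 : ∀ i ∈ Finset.range (k * (2 * P)),
        ((η i - η (i + 1)) * ξ i - c / 2 * (ξ i ^ 2 + η (i + 1) ^ 2))
        ≤ (η i - η (i + 1)) ^ 2 / (2 * c) - c / 2 * η (i + 1) ^ 2 := by
      intro i _
      have : (η i - η (i + 1)) ^ 2 / (2 * c) - c / 2 * η (i + 1) ^ 2 -
        ((η i - η (i + 1)) * ξ i - c / 2 * (ξ i ^ 2 + η (i + 1) ^ 2))
        = (η i - η (i + 1) - c * ξ i) ^ 2 / (2 * c) := by field_simp; ring
      have h2 : 0 ≤ (η i - η (i + 1) - c * ξ i) ^ 2 / (2 * c) := by positivity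
      linarith
    refine (Finset.sum_le_sum h1).trans_lt ?_
    rw [sum_blocks (fun i => (η i - η (i + 1)) ^ 2 / (2 * c) - c / 2 * η (i + 1) ^ 2)]
    have hP' : (0 : ℝ) < P := by exact_mod_cast hP
    set δ : ℝ := P / c - c / 2 * ((P : ℝ) ^ 3 / 3) with hδ
    have hδ0 : δ < 0 := by
      have e1 : (P : ℝ) / c * (c * P) ^ 2 = c * P ^ 3 := by field_simp
      have e2 : 16 ≤ (c * P) ^ 2 := by nlinarith
      have e3 : 0 < (P : ℝ) / c := by positivity
      rw [hδ]
      nlinarith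
    have h3 : ∀ j ∈ Finset.range k, ∑ r ∈ Finset.range (2 * P),
        ((η (j * (2 * P) + r) - η (j * (2 * P) + r + 1)) ^ 2 / (2 * c)
          - c / 2 * η (j * (2 * P) + r + 1) ^ 2) ≤ cs j ^ 2 * δ := by
      intro j hj
      have hj' := Finset.mem_range.1 hj
      have h4 : ∀ r ∈ Finset.range (2 * P),
        ((η (j * (2 * P) + r) - η (j * (2 * P) + r + 1)) ^ 2 / (2 * c)
          - c / 2 * η (j * (2 * P) + r + 1) ^ 2)
          = cs j ^ 2 * (1 / (2 * c) - c / 2 * tent P (r + 1) ^ 2) := by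
        intro r hr
        have hr' := Finset.mem_range.1 hr
        rw [hη j hj' r hr'.le, add_assoc, hη j hj' (r + 1) hr', ← mul_sub, mul_pow, tent_step]
        ring
      rw [Finset.sum_congr rfl h4, ← Finset.mul_sum, Finset.sum_sub_distrib, Finset.sum_const,
        Finset.card_range, ← Finset.mul_sum]
      refine mul_le_mul_of_nonneg_left ?_ (sq_nonneg _)
      have h5 := tent_sum P
      have h6 : (2 * P) • (1 / (2 * c)) = P / c := by
        rw [nsmul_eq_mul]; push_cast; field_simp
      rw [h6, hδ]
      have := mul_le_mul_of_nonneg_left h5 (by positivity : 0 ≤ c / 2)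
      linarith
    refine (Finset.sum_le_sum h3).trans_lt ?_
    rw [← Finset.sum_mul]
    refine mul_neg_of_pos_of_neg ?_ hδ0
    obtain ⟨j, hj, hj0⟩ := h
    exact Finset.sum_pos' (fun _ _ => sq_nonneg _) ⟨j, Finset.mem_range.2 hj, by positivity⟩
  · have hcs : ∀ j < k, cs j = 0 := by
      intro j hj; by_contra h0; exact h ⟨j, hj, h0⟩
    obtain ⟨i0, hi0, hξ⟩ := hne.resolve_left h
    have hη0 : ∀ i ≤ k * (2 * P), η i = 0 := by
      intro i hi
      rcases Nat.eq_zero_or_pos k with rfl | hk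
      · simp at hi0
      have hd := Nat.div_add_mod i (2 * P)
      have hm := Nat.mod_lt i (show 0 < 2 * P by omega)
      rcases eq_or_lt_of_le hi with he | hl
      · have hk1 : k - 1 < k := by omega
        have := hη (k - 1) hk1 (2 * P) le_rfl
        rw [hcs _ hk1, zero_mul] at this
        rw [he, ← this]
        congr 1
        rw [← Nat.succ_mul]; congr 1; omega
      · have hlt : i / (2 * P) < k := Nat.div_lt_of_lt_mul (by rwa [mul_comm] at hl)
        have := hη _ hlt _ hm.le
        rw [hcs _ hlt, zero_mul] at this
        rw [← this]; congr 1
        rw [mul_comm]; exact hd.symm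
    have h1 : ∀ i ∈ Finset.range (k * (2 * P)),
        ((η i - η (i + 1)) * ξ i - c / 2 * (ξ i ^ 2 + η (i + 1) ^ 2)) = -(c / 2) * ξ i ^ 2 := by
      intro i hi
      have hi' := Finset.mem_range.1 hi
      rw [hη0 i hi'.le, hη0 (i + 1) hi']; ring
    rw [Finset.sum_congr rfl h1, ← Finset.mul_sum]
    refine mul_neg_of_neg_of_pos (by linarith) ?_
    exact Finset.sum_pos' (fun _ _ => sq_nonneg _) ⟨i0, Finset.mem_range.2 hi0, by positivity⟩

lemma apart (x y : ℕ → E) (L J M : ℕ) (hM : M + 1 = J * L) (hx : ∀ j < J, x (j * L) = 0)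
    (A : ℝ) (hA : 0 ≤ A) (hAJ : A < J) (hy0 : y 0 = 0) (hyN : y (M + 1) = 0)
    (hy : ∀ i < M, y (i + 1) = -(L : ℝ) • (x (i + 1) - x i)) :
    ∑ i ∈ Finset.range (M + 1), (inner ℝ (y i - y (i + 1)) (x i)
      + ((M + 1 : ℕ) : ℝ)⁻¹ * (A / 2) * (‖x i‖ ^ 2 + ‖y (i + 1)‖ ^ 2)) ≤ 0 ∧
    ((∃ i < M + 1, x i ≠ 0) → ∑ i ∈ Finset.range (M + 1), (inner ℝ (y i - y (i + 1)) (x i)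
      + ((M + 1 : ℕ) : ℝ)⁻¹ * (A / 2) * (‖x i‖ ^ 2 + ‖y (i + 1)‖ ^ 2)) < 0) := by
  have hJ : (0 : ℝ) < J := lt_of_le_of_lt hA hAJ
  have hL : (0 : ℝ) < L := by
    rcases Nat.eq_zero_or_pos L with rfl | h
    · simp at hM
    · exact_mod_cast h
  set T := ∑ i ∈ Finset.range M, ‖x (i + 1) - x i‖ ^ 2 with hT
  have hT0 : 0 ≤ T := Finset.sum_nonneg fun _ _ => by positivity
  have hp := poincare x L J M hM hx
  have hyy : ∑ i ∈ Finset.range (M + 1), ‖y (i + 1)‖ ^ 2 = (L : ℝ) ^ 2 * T := by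
    rw [Finset.sum_range_succ, hyN, hT, Finset.mul_sum]
    simp only [norm_zero, ne_eq, OfNat.ofNat_ne_zero, not_false_eq_true, zero_pow, add_zero]
    refine Finset.sum_congr rfl fun i hi => ?_
    rw [hy i (Finset.mem_range.1 hi), norm_smul, mul_pow]
    simp
  have hxy : ∑ i ∈ Finset.range (M + 1), inner ℝ (y i - y (i + 1)) (x i) = -(L : ℝ) * T := by
    rw [sum_parts, hy0, hyN, hT, Finset.mul_sum]
    simp only [inner_zero_left, zero_add, sub_zero]
    refine Finset.sum_congr rfl fun i hi => ?_
    rw [hy i (Finset.mem_range.1 hi), real_inner_smul_left, real_inner_self_eq_norm_sq]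
  have hN : ((M + 1 : ℕ) : ℝ) = J * L := by rw [hM]; push_cast; ring
  have key : ∑ i ∈ Finset.range (M + 1), (inner ℝ (y i - y (i + 1)) (x i)
      + ((M + 1 : ℕ) : ℝ)⁻¹ * (A / 2) * (‖x i‖ ^ 2 + ‖y (i + 1)‖ ^ 2)) ≤ -(L * T * (1 - A / J)) := by
    rw [Finset.sum_add_distrib, ← Finset.mul_sum, Finset.sum_add_distrib, hxy, hyy, hN]
    have h1 : ((J : ℝ) * L)⁻¹ * (A / 2) * (∑ i ∈ Finset.range (M + 1), ‖x i‖ ^ 2 + (L : ℝ) ^ 2 * T)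
        ≤ ((J : ℝ) * L)⁻¹ * (A / 2) * ((L : ℝ) ^ 2 * T + (L : ℝ) ^ 2 * T) :=
      mul_le_mul_of_nonneg_left (by linarith) (by positivity)
    have h2 : ((J : ℝ) * L)⁻¹ * (A / 2) * ((L : ℝ) ^ 2 * T + (L : ℝ) ^ 2 * T) = L * T * (A / J) := by
      field_simp; ring
    linarith
  have hAJ' : 0 < 1 - A / J := by rw [sub_pos, div_lt_one hJ]; exact hAJ
  refine ⟨key.trans ?_, fun ⟨i, hi, hxi⟩ => key.trans_lt ?_⟩
  · have : 0 ≤ L * T * (1 - A / J) := by positivity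
    linarith
  · have hTp : 0 < T := by
      have h1 : 0 < ∑ i ∈ Finset.range (M + 1), ‖x i‖ ^ 2 :=
        Finset.sum_pos' (fun _ _ => sq_nonneg _) ⟨i, Finset.mem_range.2 hi, by positivity⟩
      by_contra h
      have : T = 0 := le_antisymm (not_lt.1 h) hT0
      rw [← hT, this] at hp
      linarith
    have : 0 < L * T * (1 - A / J) := by positivity
    linarith

end Idx
end PartM4

open Set
set_option linter.unusedSectionVars false
noncomputable section PartM4b

namespace Idx
open Disc

variable {E : Type*} [NormedAddCommGroup E] [InnerProductSpace ℝ E] [FiniteDimensional ℝ E]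

abbrev XX (E : Type*) := WithLp 2 (E × ℝ)

/-- extension by zero -/
def ex {F : Type*} [Zero F] {N : ℕ} (x : Fin N → F) (i : ℕ) : F := if h : i < N then x ⟨i, h⟩ else 0

lemma ex_cont {F : Type*} [Zero F] [TopologicalSpace F] {N : ℕ} (i : ℕ) :
    Continuous fun x : Fin N → F => ex x i := by
  unfold ex
  split_ifs
  · fun_prop
  · exact continuous_const

lemma ex_neg {F : Type*} [AddGroup F] {N : ℕ} (x : Fin N → F) (i : ℕ) : ex (-x) i = - ex x i := by
  unfold ex
  split_ifs <;> simp

lemma ex_ne {F : Type*} [Zero F] {N : ℕ} {x : Fin N → F} (h : x ≠ 0) : ∃ i < N, ex x i ≠ 0 := by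
  obtain ⟨i, hi⟩ := Function.ne_iff.1 h
  exact ⟨i, i.2, by simpa [ex] using hi⟩

abbrev Par (E : Type*) (N k : ℕ) := (Fin N → E) × (Fin N → ℝ) × (Fin k → ℝ)

def ys (L : ℕ) {N k : ℕ} (u : Par E N k) (i : ℕ) : E :=
  if 1 ≤ i ∧ i < N then -(L : ℝ) • (ex u.1 i - ex u.1 (i - 1)) else 0

def ηs (P : ℕ) {N k : ℕ} (u : Par E N k) (i : ℕ) : ℝ :=
  ex u.2.2 (i / (2 * P)) * tent P (i % (2 * P))

/-- the embedding of parameters -/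
def io (L P M k : ℕ) (u : Par E (M + 1) k) : ZZ (XX E) M :=
  (fun i => WithLp.toLp 2 (ex u.1 i, ex u.2.1 i),
   fun i => WithLp.toLp 2 (ys L u (i + 1), ηs P u (i + 1)))

lemma io_cont (L P M k : ℕ) : Continuous (io (E := E) L P M k) := by
  unfold io
  refine Continuous.prodMk (continuous_pi fun i => ?_) (continuous_pi fun i => ?_)
  · refine (WithLp.prod_continuous_toLp 2 E ℝ).comp (Continuous.prodMk ?_ ?_)
    · exact (ex_cont _).comp continuous_fst
    · exact (ex_cont _).comp (continuous_fst.comp continuous_snd)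
  · refine (WithLp.prod_continuous_toLp 2 E ℝ).comp (Continuous.prodMk ?_ ?_)
    · unfold ys
      split_ifs
      · exact (((ex_cont _).comp continuous_fst).sub ((ex_cont _).comp continuous_fst)).const_smul _
      · exact continuous_const
    · unfold ηs
      exact ((ex_cont _).comp (continuous_snd.comp continuous_snd)).mul continuous_const

lemma io_neg (L P M k : ℕ) (u : Par E (M + 1) k) : io L P M k (-u) = - io L P M k u := by
  unfold io
  ext1
  · funext i
    simp only [Prod.fst_neg, Prod.snd_neg, ex_neg, Pi.neg_apply, ← WithLp.toLp_neg, Prod.neg_mk]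
  · funext i
    simp only [Prod.snd_neg, Pi.neg_apply, ← WithLp.toLp_neg, Prod.neg_mk]
    congr 2
    · unfold ys
      split_ifs
      · simp only [Prod.fst_neg, ex_neg, ← smul_neg]; congr 1; abel
      · simp
    · unfold ηs
      simp [ex_neg]

lemma cx_io {L P M k : ℕ} (u : Par E (M + 1) k) {i : ℕ} (hi : i < M + 1) :
    cx M i (io L P M k u) = WithLp.toLp 2 (ex u.1 i, ex u.2.1 i) := by
  rw [cx_of_lt hi]; rfl

lemma cy_io {L P M k : ℕ} (hM : M + 1 = k * (2 * P)) (u : Par E (M + 1) k) {i : ℕ}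
    (hi : i ≤ M + 1) :
    cy M i (io L P M k u) = WithLp.toLp 2 (ys L u i, ηs P u i) := by
  rcases i with _ | i
  · rw [cy_zero]
    simp [ys, ηs, tent_zero]
    rfl
  · rcases eq_or_lt_of_le hi with h | h
    · have : i = M := by omega
      subst this
      rw [cy_last]
      simp [ys, ηs, hM, tent_zero]
      rfl
    · rw [cy_of (by omega : i < M)]; rfl

lemma ηs_spec {P N k : ℕ} (hP : 0 < P) (u : Par E N k) (j : ℕ) (r : ℕ) (hr : r ≤ 2 * P) :
    ηs P u (j * (2 * P) + r) = ex u.2.2 j * tent P r := by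
  unfold ηs
  rcases eq_or_lt_of_le hr with h | h
  · have e1 : j * (2 * P) + r = (j + 1) * (2 * P) := by rw [h]; ring
    rw [e1, Nat.mul_mod_left, tent_zero, h, tent_end]; simp
  · rw [mul_comm j, Nat.mul_add_div (by omega), Nat.div_eq_of_lt h, Nat.mul_add_mod, Nat.mod_eq_of_lt h,
      add_zero]

lemma inner_toLp (a c : E) (b d : ℝ) :
    inner ℝ (WithLp.toLp 2 (a, b) : XX E) (WithLp.toLp 2 (c, d)) = inner ℝ a c + b * d := by
  rw [WithLp.prod_inner_apply]
  simp [mul_comm]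

lemma act_io_neg {L P M k J : ℕ} (hP : 0 < P) (hML : M + 1 = J * L) (hMk : M + 1 = k * (2 * P))
    {A κ : ℝ} (hA : 0 ≤ A) (hAJ : A < J) (hκ : 8 * k ≤ κ) (hk : 0 < k)
    (h : ℝ → XX E × XX E → ℝ)
    (hlb : ∀ t ∈ Icc (0 : ℝ) 1, ∀ w : XX E × XX E,
      κ / 2 * (w.1.snd ^ 2 + w.2.snd ^ 2) - A / 2 * (‖w.1.fst‖ ^ 2 + ‖w.2.fst‖ ^ 2) ≤ h t w)
    (u : Par E (M + 1) k) (hu : u ≠ 0) (hx : ∀ j < J, ex u.1 (j * L) = 0) :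
    act M h (io L P M k u) < 0 := by
  have hN : (0 : ℝ) < (M + 1 : ℕ) := by positivity
  have hkr : (0 : ℝ) < k := by exact_mod_cast hk
  set c := κ / (M + 1 : ℕ) with hc
  have hκ0 : 0 < κ := by linarith
  have hc0 : 0 < c := by positivity
  have hcP : 4 ≤ c * P := by
    have hPr : (0 : ℝ) < P := by exact_mod_cast hP
    have : ((M + 1 : ℕ) : ℝ) = k * (2 * P) := by rw [hMk]; push_cast; ring
    rw [hc, this]
    have e : κ / (k * (2 * P)) * P = κ / (2 * k) := by field_simp
    rw [e, le_div_iff₀ (by positivity)]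
    linarith
  obtain ⟨ha1, ha2⟩ := apart (ex u.1) (ys L u) L J M hML hx A hA hAJ (by simp [ys]) (by simp [ys])
    (by intro i hi; have : i + 1 < M + 1 := by omega
        simp [ys, hi])
  have hb := bpart P k hP c hc0 hcP (ex u.2.2) (ηs P u) (ex u.2.1)
    (fun j _ r hr => ηs_spec hP u j r hr)
  rw [← hMk] at hb
  have hle : act M h (io L P M k u) ≤
      ∑ i ∈ Finset.range (M + 1), (inner ℝ (ys L u i - ys L u (i + 1)) (ex u.1 i)
      + ((M + 1 : ℕ) : ℝ)⁻¹ * (A / 2) * (‖ex u.1 i‖ ^ 2 + ‖ys L u (i + 1)‖ ^ 2)) +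
      ∑ i ∈ Finset.range (M + 1), ((ηs P u i - ηs P u (i + 1)) * ex u.2.1 i
        - c / 2 * (ex u.2.1 i ^ 2 + ηs P u (i + 1) ^ 2)) := by
    rw [← Finset.sum_add_distrib]
    unfold act
    refine Finset.sum_le_sum fun i hi => ?_
    have hi' := Finset.mem_range.1 hi
    rw [cx_io u hi', cy_io hMk u hi'.le, cy_io hMk u (show i + 1 ≤ M + 1 from hi'), ← WithLp.toLp_sub, Prod.mk_sub_mk,
      inner_toLp]
    have h1 := hlb _ (tmem (M := M) hi'.le)
      (WithLp.toLp 2 (ex u.1 i, ex u.2.1 i), WithLp.toLp 2 (ys L u (i + 1), ηs P u (i + 1)))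
    have h2 := mul_le_mul_of_nonneg_left h1 (inv_nonneg.2 hN.le)
    have h3 : c / 2 = (((M + 1 : ℕ) : ℝ))⁻¹ * (κ / 2) := by rw [hc]; field_simp
    rw [h3]
    simp only [WithLp.toLp_fst, WithLp.toLp_snd] at h2 ⊢
    linarith
  refine hle.trans_lt ?_
  by_cases hx0 : u.1 = 0
  · refine add_neg_of_nonpos_of_neg ha1 (hb ?_)
    by_cases hc0 : u.2.2 = 0
    · right
      refine ex_ne fun h0 => hu ?_
      exact Prod.ext hx0 (Prod.ext h0 hc0)
    · left; exact ex_ne hc0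
  · have := ha2 (ex_ne hx0)
    by_cases hz : (∃ j < k, ex u.2.2 j ≠ 0) ∨ ∃ i < M + 1, ex u.2.1 i ≠ 0
    · exact add_neg this (hb hz)
    · push Not at hz
      refine add_neg_of_neg_of_nonpos this (Finset.sum_nonpos fun i hi => ?_)
      have hi' := Finset.mem_range.1 hi
      have hη : ∀ i, ηs P u i = 0 := by
        intro i
        unfold ηs
        by_cases hlt : i / (2 * P) < k
        · rw [hz.1 _ hlt, zero_mul]
        · simp [ex, hlt]
      rw [hη, hη, hz.2 i hi']; simp

/-- target map -/
def tgt (M : ℕ) (z : ZZ (XX E) M) : Fin (M + 1) → XX E := fun i =>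
  if (i : ℕ) = 0 then cx M 0 z
  else cy M i z - ((M + 1 : ℕ) : ℝ) • (cx M i z - cx M (i - 1) z)

lemma tgt_cont (M : ℕ) : Continuous (tgt (E := E) M) := by
  unfold tgt
  refine continuous_pi fun i => ?_
  split_ifs
  · exact (cx M 0).continuous
  · fun_prop

lemma tgt_neg (M : ℕ) (z : ZZ (XX E) M) : tgt M (-z) = - tgt M z := by
  funext i
  simp only [tgt, Pi.neg_apply, map_neg]
  split_ifs
  · rfl
  · rw [neg_sub_neg, neg_sub, ← neg_sub (cx M i z), smul_neg]; abel

lemma act_tgt {M : ℕ} (h : ℝ → XX E × XX E → ℝ)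
    (hub : ∀ t ∈ Icc (0 : ℝ) 1, ∀ w : XX E × XX E, h t w ≤ 1 / 2 * (‖w.1‖ ^ 2 + ‖w.2‖ ^ 2))
    (z : ZZ (XX E) M) (hz : tgt M z = 0) : 0 ≤ act M h z := by
  have hN : (0 : ℝ) < (M + 1 : ℕ) := by positivity
  set N : ℝ := ((M + 1 : ℕ) : ℝ) with hNdef
  have hx0 : cx M 0 z = 0 := by
    have := congrFun hz ⟨0, by omega⟩
    simpa [tgt] using this
  have hy : ∀ i < M, cy M (i + 1) z = N • (cx M (i + 1) z - cx M i z) := by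
    intro i hi
    have := congrFun hz ⟨i + 1, by omega⟩
    simp only [tgt, Nat.add_eq_zero_iff, one_ne_zero, and_false, if_false, Pi.zero_apply,
      Nat.add_sub_cancel] at this
    exact sub_eq_zero.1 this
  set T := ∑ i ∈ Finset.range M, ‖cx M (i + 1) z - cx M i z‖ ^ 2 with hT
  have hp := poincare (fun i => cx M i z) (M + 1) 1 M (by omega)
    (by intro j hj; interval_cases j; simpa using hx0)
  have hyy : ∑ i ∈ Finset.range (M + 1), ‖cy M (i + 1) z‖ ^ 2 = N ^ 2 * T := by
    rw [Finset.sum_range_succ, cy_last, hT, Finset.mul_sum]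
    simp only [norm_zero, ne_eq, OfNat.ofNat_ne_zero, not_false_eq_true, zero_pow, add_zero]
    refine Finset.sum_congr rfl fun i hi => ?_
    rw [hy i (Finset.mem_range.1 hi), norm_smul, mul_pow]
    simp
  have hxy : ∑ i ∈ Finset.range (M + 1), inner ℝ (cy M i z - cy M (i + 1) z) (cx M i z)
      = N * T := by
    rw [sum_parts (fun i => cx M i z) (fun i => cy M i z), cy_zero, cy_last, hT, Finset.mul_sum]
    simp only [inner_zero_left, zero_add, sub_zero]
    refine Finset.sum_congr rfl fun i hi => ?_
    rw [hy i (Finset.mem_range.1 hi), real_inner_smul_left, real_inner_self_eq_norm_sq]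
  have hle : N * T - N⁻¹ * (1 / 2) * (∑ i ∈ Finset.range (M + 1), ‖cx M i z‖ ^ 2 + N ^ 2 * T)
      ≤ act M h z := by
    rw [← hxy, ← hyy, ← Finset.sum_add_distrib, Finset.mul_sum, ← Finset.sum_sub_distrib]
    unfold act
    refine Finset.sum_le_sum fun i hi => ?_
    have hi' := Finset.mem_range.1 hi
    have h2 := mul_le_mul_of_nonneg_left (hub _ (tmem (M := M) hi'.le) (cx M i z, cy M (i + 1) z))
      (inv_nonneg.2 hN.le)
    simp only at h2
    linarith
  refine le_trans ?_ hle
  have h3 : N⁻¹ * (1 / 2) * (∑ i ∈ Finset.range (M + 1), ‖cx M i z‖ ^ 2 + N ^ 2 * T) ≤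
      N⁻¹ * (1 / 2) * (N ^ 2 * T + N ^ 2 * T) :=
    mul_le_mul_of_nonneg_left (by linarith) (by positivity)
  have h4 : N⁻¹ * (1 / 2) * (N ^ 2 * T + N ^ 2 * T) = N * T := by field_simp; ring
  linarith

theorem index_contra {J k : ℕ} {A κ : ℝ} (hA : 0 ≤ A) (hAJ : A < J)
    (hk : k = Module.finrank ℝ E * J + 1) (hκ : 8 * k ≤ κ)
    (h1 h0 : ℝ → XX E × XX E → ℝ)
    (hlb : ∀ t ∈ Icc (0 : ℝ) 1, ∀ w : XX E × XX E,
      κ / 2 * (w.1.snd ^ 2 + w.2.snd ^ 2) - A / 2 * (‖w.1.fst‖ ^ 2 + ‖w.2.fst‖ ^ 2) ≤ h1 t w)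
    (hub : ∀ t ∈ Icc (0 : ℝ) 1, ∀ w : XX E × XX E, h0 t w ≤ 1 / 2 * (‖w.1‖ ^ 2 + ‖w.2‖ ^ 2))
    (hrel : ∃ N0, ∀ M ≥ N0, Dfm.Rel (act (X := XX E) M h1) (act M h0)) : False := by
  obtain ⟨N0, hN0⟩ := hrel
  have hJ : 0 < J := by
    have : (0 : ℝ) < J := lt_of_le_of_lt hA hAJ
    exact_mod_cast this
  have hk0 : 0 < k := by omega
  set Q := N0 + 1 with hQ
  set P := J * Q with hP
  set L := 2 * k * Q with hL
  have hP0 : 0 < P := by positivity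
  have hpos : N0 + 1 ≤ k * (2 * P) := by
    have h1 : 1 ≤ k * (2 * J) := Nat.mul_pos hk0 (by omega)
    calc N0 + 1 = 1 * Q := by rw [one_mul]
      _ ≤ (k * (2 * J)) * Q := Nat.mul_le_mul_right _ h1
      _ = k * (2 * P) := by rw [hP]; ring
  obtain ⟨M, hM⟩ : ∃ M, M + 1 = k * (2 * P) := ⟨k * (2 * P) - 1, by omega⟩
  have hML : M + 1 = J * L := by rw [hM, hP, hL]; ring
  obtain ⟨Φ, hΦc, hΦo, hΦn⟩ := hN0 M (by omega)
  let ℓ : Par E (M + 1) k →ₗ[ℝ] (Fin J → E) :=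
    { toFun := fun u j => ex u.1 (j * L)
      map_add' := by
        intro u v; funext j; simp only [ex, Pi.add_apply, Prod.fst_add]; split_ifs <;> simp
      map_smul' := by
        intro c v; funext j; simp only [ex, Pi.smul_apply, Prod.smul_fst]; split_ifs <;> simp }
  have hker : ∀ u : LinearMap.ker ℓ, ∀ j < J, ex u.1.1 (j * L) = 0 := by
    intro u j hj
    exact congrFun (LinearMap.mem_ker.1 u.2) ⟨j, hj⟩
  have hneg : ∀ u : LinearMap.ker ℓ, u ≠ 0 → act M h1 (io L P M k u.1) < 0 := by
    intro u hu
    exact act_io_neg hP0 hML hM hA hAJ hκ hk0 h1 hlb u.1 (fun h => hu (Subtype.ext h)) (hker u)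
  refine BU.borsuk_ulam (A := LinearMap.ker ℓ) (B := Fin (M + 1) → XX E) ?_
    (fun u => tgt M (Φ (io L P M k u.1))) ?_ ?_ ?_
  · have hr := LinearMap.finrank_range_add_finrank_ker ℓ
    have hr2 : Module.finrank ℝ (LinearMap.range ℓ) ≤ Module.finrank ℝ (Fin J → E) :=
      Submodule.finrank_le _
    have hX : Module.finrank ℝ (XX E) = Module.finrank ℝ E + 1 := by
      rw [LinearEquiv.finrank_eq (WithLp.linearEquiv 2 ℝ (E × ℝ))]
      simp
    rw [Module.finrank_pi_fintype] at hr2 ⊢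
    simp only [Finset.sum_const, Finset.card_univ, Fintype.card_fin, smul_eq_mul, hX] at hr2 ⊢
    have hp : Module.finrank ℝ (Par E (M + 1) k) = (M + 1) * Module.finrank ℝ E + (M + 1) + k := by
      rw [Module.finrank_prod, Module.finrank_prod, Module.finrank_pi_fintype]
      simp [add_assoc]
    rw [hp] at hr
    have h5 : Module.finrank ℝ E * J = J * Module.finrank ℝ E := mul_comm _ _
    have h6 : (M + 1) * (Module.finrank ℝ E + 1) = (M + 1) * Module.finrank ℝ E + (M + 1) := by ring
    rw [h6]
    omega
  · refine (tgt_cont M).comp_continuousOn (hΦc.comp ?_ ?_)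
    · exact ((io_cont L P M k).comp continuous_subtype_val).continuousOn
    · intro u hu; exact hneg u hu
  · intro u hu
    have : io L P M k (-u : LinearMap.ker ℓ).1 = - io L P M k u.1 := by
      rw [← io_neg]; rfl
    simp only [this, hΦo _ (hneg u hu), tgt_neg]
  · intro u hu h
    have := act_tgt h0 hub _ h
    exact absurd (hΦn _ (hneg u hu)) (not_lt.2 this)

end Idx
end PartM4b

open Set
set_option linter.unusedSectionVars false
noncomputable section PartM5a

namespace Sy

section gen
variable {V : Type*} [NormedAddCommGroup V] [InnerProductSpace ℝ V]

/-- symplectic form -/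
def Om (a b : V × V) : ℝ := inner ℝ a.1 b.2 - inner ℝ a.2 b.1
/-- euclidean inner product -/
def ip (a b : V × V) : ℝ := inner ℝ a.1 b.1 + inner ℝ a.2 b.2
/-- complex structure -/
def JJ (a : V × V) : V × V := (-a.2, a.1)
/-- rotation -/
def rot (α : ℝ) (a : V × V) : V × V := Real.cos α • a + Real.sin α • JJ a

lemma Om_add_left (a b c : V × V) : Om (a + b) c = Om a c + Om b c := by
  simp [Om, inner_add_left]; ring
lemma Om_add_right (a b c : V × V) : Om a (b + c) = Om a b + Om a c := by
  simp [Om, inner_add_right]; ring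
lemma Om_smul_left (r : ℝ) (a c : V × V) : Om (r • a) c = r * Om a c := by
  simp [Om, real_inner_smul_left]; ring
lemma Om_smul_right (r : ℝ) (a c : V × V) : Om a (r • c) = r * Om a c := by
  simp [Om, real_inner_smul_right]; ring
lemma Om_swap (a b : V × V) : Om a b = - Om b a := by
  simp only [Om, real_inner_comm b.1, real_inner_comm b.2]; ring
lemma Om_JJ_left (a b : V × V) : Om (JJ a) b = - ip a b := by
  simp [Om, JJ, ip]; ring
lemma Om_JJ_right (a b : V × V) : Om a (JJ b) = ip a b := by
  simp [Om, JJ, ip]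
lemma Om_zero_left (b : V × V) : Om 0 b = 0 := by simp [Om]
lemma Om_self (b : V × V) : Om b b = 0 := by simp [Om, real_inner_comm]
lemma ip_comm (a b : V × V) : ip a b = ip b a := by
  simp only [ip, real_inner_comm b.1, real_inner_comm b.2]
lemma ip_add_right (a b c : V × V) : ip a (b + c) = ip a b + ip a c := by
  simp [ip, inner_add_right]; ring
lemma ip_add_left (a b c : V × V) : ip (a + b) c = ip a c + ip b c := by
  simp [ip, inner_add_left]; ring
lemma ip_smul_right (r : ℝ) (a c : V × V) : ip a (r • c) = r * ip a c := by
  simp [ip, real_inner_smul_right]; ring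
lemma ip_smul_left (r : ℝ) (a c : V × V) : ip (r • a) c = r * ip a c := by
  simp [ip, real_inner_smul_left]; ring
lemma ip_JJ (a : V × V) : ip a (JJ a) = 0 := by
  simp [ip, JJ, real_inner_comm]
lemma ip_JJ_JJ (a b : V × V) : ip (JJ a) (JJ b) = ip a b := by
  simp [ip, JJ]; ring
lemma ip_JJ_right (a b : V × V) : ip a (JJ b) = - Om a b := by
  simp [ip, JJ, Om]; ring
lemma ip_JJ_left (a b : V × V) : ip (JJ a) b = Om a b := by
  simp [ip, JJ, Om]; ring
lemma JJ_JJ (a : V × V) : JJ (JJ a) = -a := by simp [JJ]; rfl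
lemma JJ_add (a b : V × V) : JJ (a + b) = JJ a + JJ b := by
  simp [JJ, add_comm]
lemma JJ_smul (r : ℝ) (a : V × V) : JJ (r • a) = r • JJ a := by simp [JJ]

lemma cs (α : ℝ) : Real.cos α * Real.cos α + Real.sin α * Real.sin α = 1 := by
  have := Real.cos_sq_add_sin_sq α; nlinarith

lemma Om_rot (α : ℝ) (a b : V × V) : Om (rot α a) (rot α b) = Om a b := by
  simp only [rot, Om_add_left, Om_add_right, Om_smul_left, Om_smul_right, Om_JJ_left, Om_JJ_right,
    ip_JJ_right, ip_add_left, ip_smul_left, ip_JJ_left]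
  linear_combination (Om a b) * cs α
lemma ip_rot (α : ℝ) (a b : V × V) : ip (rot α a) (rot α b) = ip a b := by
  simp only [rot, ip_add_left, ip_add_right, ip_smul_left, ip_smul_right, ip_JJ_left, ip_JJ_right,
    Om_JJ_right, Om_add_left, Om_smul_left, Om_JJ_left]
  linear_combination (ip a b) * cs α
lemma rot_add (α β : ℝ) (a : V × V) : rot α (rot β a) = rot (α + β) a := by
  simp only [rot, JJ_add, JJ_smul, JJ_JJ, Real.cos_add, Real.sin_add]
  module
lemma rot_zero (a : V × V) : rot 0 a = a := by simp [rot]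
lemma rot_pi (a : V × V) : rot Real.pi a = -a := by simp [rot]
lemma rot_vadd (α : ℝ) (a b : V × V) : rot α (a + b) = rot α a + rot α b := by
  simp only [rot, JJ_add]; module
lemma rot_smul (α r : ℝ) (a : V × V) : rot α (r • a) = r • rot α a := by
  simp only [rot, JJ_smul]; module
lemma rot_JJ (α : ℝ) (a : V × V) : rot α (JJ a) = JJ (rot α a) := by
  simp only [rot, JJ_add, JJ_smul]
lemma rot_inj (α : ℝ) (a : V × V) : rot α (rot (-α) a) = a := by
  rw [rot_add, add_neg_cancel, rot_zero]
lemma rot_inj' (α : ℝ) (a : V × V) : rot (-α) (rot α a) = a := by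
  rw [rot_add, neg_add_cancel, rot_zero]

/-- J as a continuous linear map -/
def JL : V × V →L[ℝ] V × V :=
  (-(ContinuousLinearMap.snd ℝ V V)).prod (ContinuousLinearMap.fst ℝ V V)
lemma JL_apply (a : V × V) : JL a = JJ a := rfl

/-- rot as a continuous linear map -/
def rotL (α : ℝ) : V × V →L[ℝ] V × V :=
  Real.cos α • ContinuousLinearMap.id ℝ (V × V) + Real.sin α • JL
lemma rotL_apply (α : ℝ) (a : V × V) : rotL α a = rot α a := by
  simp [rotL, rot, JL_apply]

lemma rot_hasDerivAt {α : ℝ → ℝ} {α' : ℝ} {w : ℝ → V × V} {w' : V × V} {t : ℝ}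
    (hα : HasDerivAt α α' t) (hw : HasDerivAt w w' t) :
    HasDerivAt (fun t => rot (α t) (w t)) (rot (α t) (α' • JJ (w t) + w')) t := by
  have h1 := hα.cos.smul hw
  have h2 := hα.sin.smul ((JL (V := V)).hasFDerivAt.comp_hasDerivAt t hw)
  have h3 := h1.add h2
  refine HasDerivAt.congr_deriv (f' := _) h3 ?_
  simp only [rot, JJ_add, JJ_smul, JJ_JJ, Function.comp, JL_apply]
  module

/-- bilinear derivative facts -/
lemma Om_hasFDerivAt {F : Type*} [NormedAddCommGroup F] [NormedSpace ℝ F] {f g : F → V × V}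
    {f' g' : F →L[ℝ] V × V} {x : F} (hf : HasFDerivAt f f' x) (hg : HasFDerivAt g g' x) :
    ∃ L : F →L[ℝ] ℝ, HasFDerivAt (fun x => Om (f x) (g x)) L x ∧
      ∀ v, L v = Om (f' v) (g x) + Om (f x) (g' v) := by
  have h1 := (hf.fst.inner ℝ hg.snd).fun_sub (hf.snd.inner ℝ hg.fst)
  refine ⟨_, h1, fun v => ?_⟩
  simp [Om]
  ring

lemma Om_contDiff {F : Type*} [NormedAddCommGroup F] [NormedSpace ℝ F] {f g : F → V × V}
    {k : WithTop ℕ∞} (hf : ContDiff ℝ k f) (hg : ContDiff ℝ k g) :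
    ContDiff ℝ k (fun x => Om (f x) (g x)) := by
  unfold Om
  exact ((hf.fst.inner ℝ hg.snd).sub (hf.snd.inner ℝ hg.fst))

lemma ip_hasDerivAt {f g : ℝ → V × V}
    {f' g' : V × V} {x : ℝ} (hf : HasDerivAt f f' x) (hg : HasDerivAt g g' x) :
    HasDerivAt (fun x => ip (f x) (g x)) (ip f' (g x) + ip (f x) g') x := by
  have h1 : HasDerivAt (fun x => inner ℝ (f x).1 (g x).1)
    (inner ℝ (f x).1 g'.1 + inner ℝ f'.1 (g x).1) x :=
    HasDerivAt.inner ℝ (hf.fst) (hg.fst)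
  have h2 : HasDerivAt (fun x => inner ℝ (f x).2 (g x).2)
    (inner ℝ (f x).2 g'.2 + inner ℝ f'.2 (g x).2) x :=
    HasDerivAt.inner ℝ (hf.snd) (hg.snd)
  have h3 := h1.add h2
  refine h3.congr_deriv ?_
  simp [ip]; ring

end gen

open Idx
variable {E : Type*} [NormedAddCommGroup E] [InnerProductSpace ℝ E] [FiniteDimensional ℝ E]

/-- assemble a point of `X × X` -/
def mkL : (E × E) × (ℝ × ℝ) →L[ℝ] XX E × XX E :=
  LinearMap.toContinuousLinearMap
  { toFun := fun q => (WithLp.toLp 2 (q.1.1, q.2.1), WithLp.toLp 2 (q.1.2, q.2.2))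
    map_add' := by intro a b; rfl
    map_smul' := by intro a b; rfl }

def zp : XX E × XX E →L[ℝ] E × E :=
  LinearMap.toContinuousLinearMap
  { toFun := fun w => (w.1.fst, w.2.fst)
    map_add' := by intro a b; rfl
    map_smul' := by intro a b; rfl }

def zt : XX E × XX E →L[ℝ] ℝ × ℝ :=
  LinearMap.toContinuousLinearMap
  { toFun := fun w => (w.1.snd, w.2.snd)
    map_add' := by intro a b; rfl
    map_smul' := by intro a b; rfl }

lemma zp_mkL (p : E × E) (ζ : ℝ × ℝ) : zp (mkL (p, ζ)) = p := rfl
lemma zt_mkL (p : E × E) (ζ : ℝ × ℝ) : zt (mkL (p, ζ)) = ζ := rfl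
lemma mkL_eta (w : XX E × XX E) : mkL (zp w, zt w) = w := rfl
lemma Om_split (a b : XX E × XX E) : Om a b = Om (zp a) (zp b) + Om (zt a) (zt b) := by
  have e1 : zp a = (a.1.fst, a.2.fst) := rfl
  have e2 : zp b = (b.1.fst, b.2.fst) := rfl
  have e3 : zt a = (a.1.snd, a.2.snd) := rfl
  have e4 : zt b = (b.1.snd, b.2.snd) := rfl
  simp only [Om, WithLp.prod_inner_apply, e1, e2, e3, e4]
  simp; ring
lemma ip_split (a b : XX E × XX E) : ip a b = ip (zp a) (zp b) + ip (zt a) (zt b) := by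
  have e1 : zp a = (a.1.fst, a.2.fst) := rfl
  have e2 : zp b = (b.1.fst, b.2.fst) := rfl
  have e3 : zt a = (a.1.snd, a.2.snd) := rfl
  have e4 : zt b = (b.1.snd, b.2.snd) := rfl
  simp only [ip, WithLp.prod_inner_apply, e1, e2, e3, e4]
  simp; ring
lemma zp_JJ (a : XX E × XX E) : zp (JJ a) = JJ (zp a) := rfl
lemma zt_JJ (a : XX E × XX E) : zt (JJ a) = JJ (zt a) := rfl
lemma zp_rot (α : ℝ) (a : XX E × XX E) : zp (rot α a) = rot α (zp a) := by
  simp [rot, zp_JJ]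
lemma zt_rot (α : ℝ) (a : XX E × XX E) : zt (rot α a) = rot α (zt a) := by
  simp [rot, zt_JJ]

lemma ip_self_nonneg {V : Type*} [NormedAddCommGroup V] [InnerProductSpace ℝ V] (a : V × V) :
    0 ≤ ip a a := by
  simp only [ip, real_inner_self_eq_norm_sq]; positivity
lemma ip_self_pos {V : Type*} [NormedAddCommGroup V] [InnerProductSpace ℝ V] {a : V × V}
    (h : a ≠ 0) : 0 < ip a a := by
  simp only [ip, real_inner_self_eq_norm_sq]
  by_contra h0
  have h1 : ‖a.1‖ ^ 2 = 0 := by nlinarith [sq_nonneg ‖a.1‖, sq_nonneg ‖a.2‖]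
  have h2 : ‖a.2‖ ^ 2 = 0 := by nlinarith [sq_nonneg ‖a.1‖, sq_nonneg ‖a.2‖]
  apply h
  ext1
  · simpa using h1
  · simpa using h2
lemma ip_self_norm {V : Type*} [NormedAddCommGroup V] [InnerProductSpace ℝ V] (a : V × V) :
    ‖a‖ ^ 2 ≤ ip a a ∧ ip a a ≤ 2 * ‖a‖ ^ 2 := by
  simp only [ip, real_inner_self_eq_norm_sq]
  have h1 := norm_fst_le a
  have h2 := norm_snd_le a
  have h3 := norm_nonneg a.1
  have h4 := norm_nonneg a.2
  constructor
  · rcases max_choice ‖a.1‖ ‖a.2‖ with h | h <;> rw [Prod.norm_def, h] <;> nlinarith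
  · nlinarith

lemma ip_contDiff {F V : Type*} [NormedAddCommGroup V] [InnerProductSpace ℝ V]
    [NormedAddCommGroup F] [NormedSpace ℝ F] {f g : F → V × V}
    {k : WithTop ℕ∞} (hf : ContDiff ℝ k f) (hg : ContDiff ℝ k g) :
    ContDiff ℝ k (fun x => ip (f x) (g x)) := by
  unfold ip
  exact ((hf.fst.inner ℝ hg.fst).add (hf.snd.inner ℝ hg.snd))

end Sy
end PartM5a

open Set
set_option linter.unusedSectionVars false
noncomputable section PartM5b

namespace Fl
open Sy

section nondeg
variable {V : Type*} [NormedAddCommGroup V] [InnerProductSpace ℝ V]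
lemma Om_nondeg {a b : V × V} (h : ∀ v, Om a v = Om b v) : a = b := by
  have h1 : ∀ v, Om (a - b) v = 0 := by
    intro v
    have := h v
    have e : a = (a - b) + b := by abel
    rw [e, Om_add_left] at this
    linarith
  by_contra hne
  have h2 := ip_self_pos (sub_ne_zero.mpr hne)
  have h3 := h1 (JJ (a - b))
  rw [Om_JJ_right] at h3
  linarith
end nondeg

variable {n : ℕ}

lemma hamVF_spec {H : ℝ → Phase n → ℝ} {t : ℝ} {p : Phase n} (hd : DifferentiableAt ℝ (H t) p)
    (v : Phase n) : fderiv ℝ (H t) p v = Om (hamVF H t p) v := by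
  have h1 : HasFDerivAt (fun y => H t (p.1, y))
      ((fderiv ℝ (H t) p).comp (ContinuousLinearMap.inr ℝ _ _)) p.2 := by
    have h0 : HasFDerivAt (H t) (fderiv ℝ (H t) p) (p.1, p.2) := hd.hasFDerivAt
    exact h0.comp p.2 (hasFDerivAt_prodMk_right p.1 p.2)
  have h2 : HasFDerivAt (fun x => H t (x, p.2))
      ((fderiv ℝ (H t) p).comp (ContinuousLinearMap.inl ℝ _ _)) p.1 := by
    have h0 : HasFDerivAt (H t) (fderiv ℝ (H t) p) (p.1, p.2) := hd.hasFDerivAt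
    exact h0.comp p.1 (hasFDerivAt_prodMk_left p.1 p.2)
  have g1 : ∀ u, inner ℝ (gradient (fun y => H t (p.1, y)) p.2) u = fderiv ℝ (H t) p (0, u) := by
    intro u
    unfold gradient
    rw [InnerProductSpace.toDual_symm_apply, h1.fderiv]
    simp
  have g2 : ∀ u, inner ℝ (gradient (fun x => H t (x, p.2)) p.1) u = fderiv ℝ (H t) p (u, 0) := by
    intro u
    unfold gradient
    rw [InnerProductSpace.toDual_symm_apply, h2.fderiv]
    simp
  have e : v = (v.1, 0) + (0, v.2) := by simp
  conv_lhs => rw [e, map_add, ← g1, ← g2]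
  simp only [Om, hamVF, inner_neg_left]
  ring

lemma hamVF_unique {H : ℝ → Phase n → ℝ} {t : ℝ} {p q : Phase n} (hd : DifferentiableAt ℝ (H t) p)
    (h : ∀ v, fderiv ℝ (H t) p v = Om q v) : hamVF H t p = q :=
  Om_nondeg fun v => by rw [← hamVF_spec hd, h]

lemma smooth_t {H : ℝ → Phase n → ℝ} (hH : IsHamiltonian n H) (t : ℝ) :
    ContDiff ℝ (⊤ : ℕ∞) (H t) :=
  hH.smooth.comp (contDiff_const.prodMk contDiff_id)

lemma diff_t {H : ℝ → Phase n → ℝ} (hH : IsHamiltonian n H) (t : ℝ) (p : Phase n) :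
    DifferentiableAt ℝ (H t) p := (smooth_t hH t).differentiable (by simp) p

lemma hamVF_zero {H : ℝ → Phase n → ℝ} (hH : IsHamiltonian n H) {K : Set (Phase n)}
    (hK : IsCompact K) (h0 : ∀ t p, p ∉ K → H t p = 0) (t : ℝ) {p : Phase n} (hp : p ∉ K) :
    hamVF H t p = 0 := by
  apply hamVF_unique (diff_t hH t p)
  intro v
  have : H t =ᶠ[nhds p] fun _ => 0 := by
    filter_upwards [hK.isClosed.isOpen_compl.mem_nhds hp] with q hq using h0 t q hq
  rw [this.fderiv_eq, Om_zero_left]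
  simp

lemma flow_const {H : ℝ → Phase n → ℝ} {g : ℝ → Phase n → Phase n} (hH : IsHamiltonian n H)
    (hg : IsHamFlow n H g) {K : Set (Phase n)}
    (hK : IsCompact K) (h0 : ∀ t p, p ∉ K → H t p = 0) {t1 : ℝ} {p : Phase n}
    (hp : g t1 p ∉ K) (t : ℝ) : g t p = g t1 p := by
  have hc : Continuous (fun t => g t p) :=
    continuous_iff_continuousAt.mpr fun t => (hg.deriv p t).continuousAt
  have hcl : IsClopen {t | g t p = g t1 p} := by
    refine ⟨isClosed_eq hc continuous_const, ?_⟩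
    rw [Metric.isOpen_iff]
    intro s hs
    have hs' : g s p = g t1 p := hs
    have h1 : (fun t => g t p) ⁻¹' Kᶜ ∈ nhds s := by
      refine hc.continuousAt.preimage_mem_nhds (hK.isClosed.isOpen_compl.mem_nhds ?_)
      change g s p ∉ K
      rw [hs']; exact hp
    obtain ⟨ε, hε, hb⟩ := Metric.mem_nhds_iff.mp h1
    refine ⟨ε, hε, fun r hr => ?_⟩
    have h2 : Set.EqOn (deriv fun t => g t p) 0 (Metric.ball s ε) := by
      intro r hr
      have h3 := hb hr
      rw [(hg.deriv p r).deriv, hamVF_zero hH hK h0 r h3]; rfl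
    have := Metric.isOpen_ball.is_const_of_deriv_eq_zero (convex_ball s ε).isPreconnected
      (fun r _ => (hg.deriv p r).differentiableAt.differentiableWithinAt) h2 hr
      (Metric.mem_ball_self hε)
    change g r p = g t1 p
    rw [← hs']; exact this
  have := hcl.eq_univ ⟨t1, rfl⟩
  have h4 : t ∈ {t | g t p = g t1 p} := by rw [this]; trivial
  exact h4

lemma flow_ball {H : ℝ → Phase n → ℝ} {g : ℝ → Phase n → Phase n} (hH : IsHamiltonian n H)
    (hg : IsHamFlow n H g) {p : Phase n} (hp : p ∈ BallB n) (t : ℝ) : g t p ∈ BallB n := by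
  obtain ⟨K, hK, hKB, h0⟩ := hH.support
  by_contra h
  have h1 := flow_const hH hg hK h0 (t1 := t) (p := p) (fun h' => h (hKB h')) 0
  rw [hg.init] at h1
  rw [← h1] at h; exact h hp

lemma flow_out {H : ℝ → Phase n → ℝ} {g : ℝ → Phase n → Phase n} (hH : IsHamiltonian n H)
    (hg : IsHamFlow n H g) {p : Phase n} (hp : p ∉ BallB n) (t : ℝ) : g t p = p := by
  obtain ⟨K, hK, hKB, h0⟩ := hH.support
  have h1 := flow_const hH hg hK h0 (t1 := 0) (p := p)
    (by rw [hg.init]; exact fun h' => hp (hKB h')) t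
  rw [h1, hg.init]

end Fl
end PartM5b

open Set
set_option linter.unusedSectionVars false
noncomputable section PartM5c

namespace Fl
open Sy
variable {n : ℕ}

/-- the action density along a trajectory -/
def dens (K : ℝ → Phase n → ℝ) (g : ℝ → Phase n → Phase n) (q : Phase n) (t : ℝ) : ℝ :=
  Om (hamVF K t (g t q)) (g t q) - 2 * K t (g t q)

lemma action_zero (hn : 1 ≤ n) {K : ℝ → Phase n → ℝ} {g : ℝ → Phase n → Phase n}
    (hK : IsHamiltonian n K) (hg : IsHamFlow n K g) (h1 : ∀ x, (g 1 (x, 0)).2 = 0)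
    (x : EuclideanSpace ℝ (Fin n)) : ∫ t in (0:ℝ)..1, dens K g (x, 0) t = 0 := by
  obtain ⟨e, he⟩ : ∃ e : EuclideanSpace ℝ (Fin n), ‖e‖ = 10 :=
    ⟨EuclideanSpace.single ⟨0, hn⟩ 10, by simp⟩
  have hout : ((e, 0) : Phase n) ∉ BallB n := by
    simp only [BallB, quadNorm, mem_ofPred_eq, he]
    have := Real.pi_gt_three
    rw [not_lt, div_le_iff₀ Real.pi_pos]
    simp; nlinarith
  set P : ℝ × ℝ → Phase n := fun z => g z.2 (x + z.1 • (e - x), 0) with hP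
  have hPs : ContDiff ℝ (⊤ : ℕ∞) P := by
    apply hg.smooth.comp (contDiff_snd.prodMk _)
    exact (contDiff_const.add (contDiff_fst.smul contDiff_const)).prodMk contDiff_const
  have hPd : ∀ z, HasFDerivAt P (fderiv ℝ P z) z := fun z =>
    (hPs.differentiable (by simp) z).hasFDerivAt
  have hDs : ContDiff ℝ (⊤ : ℕ∞) (fderiv ℝ P) := hPs.fderiv_right (by norm_cast)
  have hDd : ∀ z, HasFDerivAt (fderiv ℝ P) (fderiv ℝ (fderiv ℝ P) z) z := fun z =>
    (hDs.differentiable (by simp) z).hasFDerivAt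
  have hv : ∀ (v : ℝ × ℝ) z, HasFDerivAt (fun z => fderiv ℝ P z v)
      ((ContinuousLinearMap.apply ℝ (Phase n) v).comp (fderiv ℝ (fderiv ℝ P) z)) z := fun v z =>
    (ContinuousLinearMap.apply ℝ (Phase n) v).hasFDerivAt.comp z (hDd z)
  have hvs : ∀ (v : ℝ × ℝ), ContDiff ℝ (⊤ : ℕ∞) (fun z => fderiv ℝ P z v) := fun v =>
    (ContinuousLinearMap.apply ℝ (Phase n) v).contDiff.comp hDs
  have hPt : ∀ z, fderiv ℝ P z (0, 1) = hamVF K z.2 (P z) := by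
    intro z
    have a1 : HasDerivAt (fun t => P (z.1, t)) (fderiv ℝ P z (0, 1)) z.2 := by
      have b1 : HasDerivAt (fun t : ℝ => (z.1, t)) ((0 : ℝ), (1 : ℝ)) z.2 :=
        (hasDerivAt_const z.2 z.1).prodMk (hasDerivAt_id z.2)
      exact (hPd z).comp_hasDerivAt z.2 b1
    exact a1.unique (hg.deriv (x + z.1 • (e - x), 0) z.2)
  have hPr : ∀ z, HasDerivAt (fun r => P (r, z.2)) (fderiv ℝ P z (1, 0)) z.1 := by
    intro z
    have b1 : HasDerivAt (fun r : ℝ => (r, z.2)) ((1 : ℝ), (0 : ℝ)) z.1 :=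
      (hasDerivAt_id z.1).prodMk (hasDerivAt_const z.1 z.2)
    exact (hPd z).comp_hasDerivAt z.1 b1
  set f : ℝ × ℝ → ℝ := fun z => Om (fderiv ℝ P z (0, 1)) (P z) - 2 * K z.2 (P z) with hf
  set G : ℝ × ℝ → ℝ := fun z => - Om (fderiv ℝ P z (1, 0)) (P z) with hG
  have hKP : ContDiff ℝ (⊤ : ℕ∞) (fun z => K z.2 (P z)) :=
    hK.smooth.comp (contDiff_snd.prodMk hPs)
  have hfs : ContDiff ℝ (⊤ : ℕ∞) f := (Om_contDiff (hvs _) hPs).sub (contDiff_const.mul hKP)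
  have hGs : ContDiff ℝ (⊤ : ℕ∞) G := (Om_contDiff (hvs _) hPs).neg
  have hfd := fun z => (hfs.differentiable (by simp) z).hasFDerivAt
  have hGd := fun z => (hGs.differentiable (by simp) z).hasFDerivAt
  have hdiv : ∀ z, fderiv ℝ f z (1, 0) + fderiv ℝ G z (0, 1) = 0 := by
    intro z
    obtain ⟨L1, hL1, e1⟩ := Om_hasFDerivAt (hv (0, 1) z) (hPd z)
    obtain ⟨L2, hL2, e2⟩ := Om_hasFDerivAt (hv (1, 0) z) (hPd z)
    have hKd := (hKP.differentiable (by simp) z).hasFDerivAt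
    have ef : fderiv ℝ f z = L1 - (2 : ℝ) • fderiv ℝ (fun z => K z.2 (P z)) z :=
      (hL1.fun_sub (hKd.const_mul 2)).fderiv
    have eG : fderiv ℝ G z = - L2 := hL2.neg.fderiv
    have eK : fderiv ℝ (fun z => K z.2 (P z)) z (1, 0)
        = Om (hamVF K z.2 (P z)) (fderiv ℝ P z (1, 0)) := by
      rw [← hamVF_spec (diff_t hK z.2 (P z))]
      have c1 : HasDerivAt (fun r => K z.2 (P (r, z.2)))
          (fderiv ℝ (fun z => K z.2 (P z)) z (1, 0)) z.1 := by
        have b1 : HasDerivAt (fun r : ℝ => (r, z.2)) ((1 : ℝ), (0 : ℝ)) z.1 :=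
          (hasDerivAt_id z.1).prodMk (hasDerivAt_const z.1 z.2)
        exact hKd.comp_hasDerivAt z.1 b1
      have c2 : HasDerivAt (fun r => K z.2 (P (r, z.2)))
          (fderiv ℝ (K z.2) (P z) (fderiv ℝ P z (1, 0))) z.1 :=
        HasFDerivAt.comp_hasDerivAt z.1 ((diff_t hK z.2 (P z)).hasFDerivAt) (hPr z)
      exact c1.unique c2
    have hsym := (hPs.contDiffAt (x := z)).isSymmSndFDerivAt
      (by rw [minSmoothness_of_isRCLikeNormedField]; exact WithTop.coe_le_coe.mpr le_top) (1, 0) (0, 1)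
    rw [ef, eG]
    simp only [sub_apply, smul_apply,
      neg_apply, e1, e2, eK, ContinuousLinearMap.comp_apply,
      ContinuousLinearMap.apply_apply, hPt, smul_eq_mul, hsym]
    rw [Om_swap (fderiv ℝ P z (1, 0)) (hamVF K z.2 (P z))]
    ring
  have hgreen := MeasureTheory.integral2_divergence_prod_of_hasFDerivAt f G
    (fderiv ℝ f) (fderiv ℝ G) 0 0 1 1 hfs.continuous.continuousOn hGs.continuous.continuousOn
    (fun z _ => hfd z) (fun z _ => hGd z) (by simp [hdiv])
  have hz : ∀ t0 : ℝ, (∀ y, (g t0 (y, 0)).2 = 0) → ∀ r, G (r, t0) = 0 := by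
    intro t0 ht r
    have b1 : (P (r, t0)).2 = 0 := ht _
    have b2 : (fderiv ℝ P (r, t0) (1, 0)).2 = 0 := by
      have c1 : HasDerivAt (fun r => (P (r, t0)).2) (fderiv ℝ P (r, t0) (1, 0)).2 r :=
        (hPr (r, t0)).snd
      have c2 : HasDerivAt (fun r => (P (r, t0)).2) 0 r := by
        have : (fun r => (P (r, t0)).2) = fun _ => 0 := by
          funext r; exact ht _
        rw [this]; exact hasDerivAt_const _ _
      exact c1.unique c2
    simp [hG, Om, b1, b2]
  have hf1 : ∀ t, f (1, t) = 0 := by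
    intro t
    have b1 : P (1, t) = (e, 0) := by
      simp only [hP, one_smul, add_sub_cancel]
      exact flow_out hK hg hout t
    obtain ⟨S, hS, hSB, h0⟩ := hK.support
    simp only [hf, hPt, b1]
    rw [hamVF_zero hK hS h0 t (fun h => hout (hSB h)), h0 t _ (fun h => hout (hSB h)), Om_zero_left]
    simp
  have hf0 : ∀ t, f (0, t) = dens K g (x, 0) t := by
    intro t
    simp only [hf, hPt, dens]
    simp [hP]
  simp only [hdiv, hz 1 h1, hz 0 (fun y => by rw [hg.init]), hf1, hf0] at hgreen
  simp at hgreen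
  linarith

end Fl
end PartM5c

open Set
set_option linter.unusedSectionVars false
noncomputable section PartM5d

namespace Lf
open Sy Idx
variable {E : Type*} [NormedAddCommGroup E] [InnerProductSpace ℝ E] [FiniteDimensional ℝ E]

/-- squared norm -/
def N (w : XX E × XX E) : ℝ := ip w w
/-- squared norm of the extra coordinate -/
def n0 (w : XX E × XX E) : ℝ := ip (zt w) (zt w)
/-- unnormalised projection -/
def qq (w : XX E × XX E) : E × E := (zt w).1 • zp w - (zt w).2 • JJ (zp w)
/-- projection to the ball -/
def pp (w : XX E × XX E) : E × E := (√(Real.pi * N w * n0 w))⁻¹ • qq w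

open Classical in
/-- the homogeneous lift of a function on the ball -/
def lift (k : E × E → ℝ) (w : XX E × XX E) : ℝ :=
  if n0 w = 0 then 0 else Real.pi * N w * k (pp w)

lemma N_smul (c : ℝ) (w : XX E × XX E) : N (c • w) = c ^ 2 * N w := by
  simp only [N, ip_smul_left, ip_smul_right]; ring
lemma n0_smul (c : ℝ) (w : XX E × XX E) : n0 (c • w) = c ^ 2 * n0 w := by
  simp only [n0, map_smul, ip_smul_left, ip_smul_right]; ring
lemma qq_smul (c : ℝ) (w : XX E × XX E) : qq (c • w) = c ^ 2 • qq w := by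
  simp only [qq, map_smul, JJ_smul, Prod.smul_fst, Prod.smul_snd, smul_eq_mul]
  module
lemma pp_smul {c : ℝ} (hc : c ≠ 0) (w : XX E × XX E) : pp (c • w) = pp w := by
  simp only [pp, qq_smul, N_smul, n0_smul]
  have e : Real.pi * (c ^ 2 * N w) * (c ^ 2 * n0 w) = (c ^ 2) ^ 2 * (Real.pi * N w * n0 w) := by ring
  rw [e, Real.sqrt_mul (by positivity), Real.sqrt_sq (by positivity), smul_smul]
  congr 1
  field_simp
lemma lift_smul (k : E × E → ℝ) (c : ℝ) (w : XX E × XX E) : lift k (c • w) = c ^ 2 * lift k w := by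
  by_cases hc : c = 0
  · subst hc
    have h : n0 ((0 : ℝ) • w) = 0 := by rw [n0_smul]; simp
    simp only [lift, h, if_true]; ring
  · simp only [lift, n0_smul, N_smul, pp_smul hc]
    by_cases h : n0 w = 0
    · simp [h]
    · simp only [h, mul_eq_zero, pow_eq_zero_iff, ne_eq, OfNat.ofNat_ne_zero, not_false_eq_true, hc,
        or_self, if_false]
      ring
lemma N_rot (γ : ℝ) (w : XX E × XX E) : N (rot γ w) = N w := ip_rot γ w w
lemma n0_rot (γ : ℝ) (w : XX E × XX E) : n0 (rot γ w) = n0 w := by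
  simp only [n0, zt_rot, ip_rot]
lemma qq_rot (γ : ℝ) (w : XX E × XX E) : qq (rot γ w) = qq w := by
  simp only [qq, zt_rot, zp_rot]
  generalize zt w = ζ
  generalize zp w = z
  simp only [rot, JJ_add, JJ_smul, JJ_JJ]
  have := cs γ
  simp only [JJ, Prod.fst_add, Prod.snd_add, Prod.smul_fst, Prod.smul_snd, smul_eq_mul]
  match_scalars
  · linear_combination ζ.1 * this
  · linear_combination -ζ.2 * this
lemma lift_rot (k : E × E → ℝ) (γ : ℝ) (w : XX E × XX E) : lift k (rot γ w) = lift k w := by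
  simp only [lift, n0_rot, N_rot, pp, qq_rot]
lemma n0_nonneg (w : XX E × XX E) : 0 ≤ n0 w := ip_self_nonneg _
lemma n0_le_N (w : XX E × XX E) : n0 w ≤ N w := by
  simp only [n0, N, ip_split w w]; linarith [ip_self_nonneg (zp w)]
lemma ip_qq (w : XX E × XX E) : ip (qq w) (qq w) = n0 w * (N w - n0 w) := by
  have e : qq w = (zt w).1 • zp w + (-(zt w).2) • JJ (zp w) := by simp only [qq]; module
  rw [e]
  simp only [N, n0, ip_split w w, ip_add_left, ip_add_right, ip_smul_left, ip_smul_right,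
    ip_JJ_left, ip_JJ_right, Om_self, Om_add_left, Om_smul_left, Om_JJ_left]
  have : ip (zt w) (zt w) = (zt w).1 ^ 2 + (zt w).2 ^ 2 := by simp [ip, sq]
  rw [this]; ring_nf
lemma ip_pp {w : XX E × XX E} (h : 0 < n0 w) :
    ip (pp w) (pp w) = (1 / Real.pi) * ((N w - n0 w) / N w) := by
  have hN : 0 < N w := h.trans_le (n0_le_N w)
  have hp := Real.pi_pos
  simp only [pp, ip_smul_left, ip_smul_right, ip_qq]
  have hs : √(Real.pi * N w * n0 w) ^ 2 = Real.pi * N w * n0 w := Real.sq_sqrt (by positivity)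
  have hs0 : 0 < √(Real.pi * N w * n0 w) := Real.sqrt_pos.mpr (by positivity)
  rw [← mul_assoc, ← mul_inv, ← sq, hs]
  field_simp

/-- radius of the extra coordinate -/
def cc (p : E × E) : ℝ := √(1 / Real.pi - ip p p)
/-- section over the ball -/
def sec (p : E × E) : XX E × XX E := mkL (p, (cc p, 0))

lemma cc_sq {p : E × E} (hp : ip p p < 1 / Real.pi) : cc p ^ 2 = 1 / Real.pi - ip p p :=
  Real.sq_sqrt (by linarith)
lemma cc_pos {p : E × E} (hp : ip p p < 1 / Real.pi) : 0 < cc p := Real.sqrt_pos.mpr (by linarith)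
lemma n0_sec (p : E × E) : n0 (sec p) = cc p ^ 2 := by
  simp [n0, sec, zt_mkL, ip, sq]
lemma N_sec {p : E × E} (hp : ip p p < 1 / Real.pi) : N (sec p) = 1 / Real.pi := by
  have h := cc_sq hp
  have : N (sec p) = ip p p + n0 (sec p) := by simp only [N, ip_split, n0]; rfl
  rw [this, n0_sec]; linarith
lemma lift_sec (k : E × E → ℝ) {p : E × E} (hp : ip p p < 1 / Real.pi) : lift k (sec p) = k p := by
  have hc := cc_pos hp
  have hpi := Real.pi_pos
  have e1 : pp (sec p) = p := by
    simp only [pp, N_sec hp, n0_sec]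
    have : qq (sec p) = cc p • p := by simp [qq, sec, zt_mkL, zp_mkL]
    rw [this, mul_one_div_cancel hpi.ne', one_mul, Real.sqrt_sq hc.le, smul_smul,
      inv_mul_cancel₀ hc.ne', one_smul]
  have e2 : n0 (sec p) ≠ 0 := by rw [n0_sec]; positivity
  simp only [lift, e2, if_false, e1, N_sec hp]
  rw [mul_one_div_cancel hpi.ne', one_mul]

lemma zp_contDiff {m : WithTop ℕ∞} : ContDiff ℝ m (fun w : XX E × XX E => zp w) :=
  ContinuousLinearMap.contDiff (𝕜 := ℝ) (E := XX E × XX E) (F := E × E) zp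
lemma zt_contDiff {m : WithTop ℕ∞} : ContDiff ℝ m (fun w : XX E × XX E => zt w) :=
  ContinuousLinearMap.contDiff (𝕜 := ℝ) (E := XX E × XX E) (F := ℝ × ℝ) zt
lemma N_contDiff {m : WithTop ℕ∞} : ContDiff ℝ m (N (E := E)) := ip_contDiff contDiff_id contDiff_id
lemma n0_contDiff {m : WithTop ℕ∞} : ContDiff ℝ m (n0 (E := E)) :=
  ip_contDiff zt_contDiff zt_contDiff
lemma qq_contDiff {m : WithTop ℕ∞} : ContDiff ℝ m (qq (E := E)) := by
  have h1 : ContDiff ℝ m (fun w : XX E × XX E => (zt w).1) := contDiff_fst.comp zt_contDiff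
  have h2 : ContDiff ℝ m (fun w : XX E × XX E => (zt w).2) := contDiff_snd.comp zt_contDiff
  have h3 : ContDiff ℝ m (fun w : XX E × XX E => JL (zp w)) :=
    (JL (V := E)).contDiff.comp zp_contDiff
  exact (h1.smul zp_contDiff).sub (h2.smul h3)

lemma pp_contDiffAt {m : WithTop ℕ∞} {w : XX E × XX E} (h : 0 < n0 w) : ContDiffAt ℝ m pp w := by
  have hN : 0 < N w := h.trans_le (n0_le_N w)
  have hp := Real.pi_pos
  have h1 : 0 < Real.pi * N w * n0 w := by positivity
  have h2 : ContDiffAt ℝ m (fun w : XX E × XX E => Real.pi * N w * n0 w) w :=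
    ((contDiff_const.mul N_contDiff).mul n0_contDiff).contDiffAt
  exact ContDiffAt.smul (ContDiffAt.inv (h2.sqrt h1.ne') (Real.sqrt_pos.mpr h1).ne')
    qq_contDiff.contDiffAt

lemma N_pos {w : XX E × XX E} (h : w ≠ 0) : 0 < N w := ip_self_pos h

lemma lift_zero_near {Q : Type*} [NormedAddCommGroup Q] [NormedSpace ℝ Q]
    (k : Q → E × E → ℝ) (q0 : Q) {w0 : XX E × XX E} (hw : w0 ≠ 0) (h0 : 0 = n0 w0) {ρ : ℝ}
    (hρ : ρ < 1 / Real.pi) (hs : ∀ᶠ q in nhds q0, ∀ p, ρ < ip p p → k q p = 0) :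
    ∀ᶠ z : Q × (XX E × XX E) in nhds (q0, w0), lift (k z.1) z.2 = 0 := by
  have h1 : ∀ᶠ z : Q × (XX E × XX E) in nhds (q0, w0), ∀ p, ρ < ip p p → k z.1 p = 0 :=
    ((continuous_fst (X := Q) (Y := XX E × XX E)).tendsto (q0, w0)).eventually hs
  have hc : ContinuousAt (fun w : XX E × XX E => (1 / Real.pi) * ((N w - n0 w) / N w)) w0 := by
    refine continuousAt_const.mul (ContinuousAt.div ?_ ?_ (N_pos hw).ne')
    · exact ((N_contDiff (m := 0)).continuous.sub (n0_contDiff (m := 0)).continuous).continuousAt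
    · exact (N_contDiff (m := 0)).continuous.continuousAt
  have h2 : ∀ᶠ w in nhds w0, ρ < (1 / Real.pi) * ((N w - n0 w) / N w) := by
    apply hc.eventually_const_lt
    beta_reduce
    rw [← h0, sub_zero, div_self (N_pos hw).ne', mul_one]
    exact hρ
  have h3 : ∀ᶠ z : Q × (XX E × XX E) in nhds (q0, w0),
      ρ < (1 / Real.pi) * ((N z.2 - n0 z.2) / N z.2) :=
    ((continuous_snd (X := Q) (Y := XX E × XX E)).tendsto (q0, w0)).eventually h2
  filter_upwards [h1, h3] with z hz1 hz3
  unfold lift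
  split_ifs with h
  · rfl
  · have h4 : 0 < n0 z.2 := lt_of_le_of_ne (n0_nonneg _) (Ne.symm h)
    rw [hz1 (pp z.2) (by rw [ip_pp h4]; exact hz3), mul_zero]

lemma lift_smooth {Q : Type*} [NormedAddCommGroup Q] [NormedSpace ℝ Q] {m : WithTop ℕ∞}
    (k : Q → E × E → ℝ) (q0 : Q) {w0 : XX E × XX E} (hw : w0 ≠ 0)
    (hk : ∀ p, ContDiffAt ℝ m (fun z : Q × (E × E) => k z.1 z.2) (q0, p)) {ρ : ℝ}
    (hρ : ρ < 1 / Real.pi) (hs : ∀ᶠ q in nhds q0, ∀ p, ρ < ip p p → k q p = 0) :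
    ContDiffAt ℝ m (fun z : Q × (XX E × XX E) => lift (k z.1) z.2) (q0, w0) := by
  rcases (n0_nonneg w0).eq_or_lt with h0 | h0
  · have hev := lift_zero_near k q0 hw h0 hρ hs
    exact (contDiffAt_const (c := (0 : ℝ))).congr_of_eventuallyEq hev
  · have hev : (fun z : Q × (XX E × XX E) => lift (k z.1) z.2) =ᶠ[nhds (q0, w0)]
        fun z => Real.pi * N z.2 * k z.1 (pp z.2) := by
      have h1 : ∀ᶠ z : Q × (XX E × XX E) in nhds (q0, w0), 0 < n0 z.2 :=
        ((n0_contDiff (m := 0)).continuous.comp continuous_snd).continuousAt.eventually_const_lt h0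
      filter_upwards [h1] with z hz
      simp [lift, hz.ne']
    refine ContDiffAt.congr_of_eventuallyEq ?_ hev
    refine ContDiffAt.mul ?_ ?_
    · exact (contDiff_const.mul (N_contDiff.comp contDiff_snd)).contDiffAt
    · have h2 : ContDiffAt ℝ m (fun z : Q × (XX E × XX E) => (z.1, pp z.2)) (q0, w0) :=
        contDiff_fst.contDiffAt.prodMk
          (ContDiffAt.comp (q0, w0) (pp_contDiffAt h0) contDiff_snd.contDiffAt)
      exact ContDiffAt.comp (q0, w0) (hk (pp w0)) h2

end Lf
end PartM5d

open Set
set_option linter.unusedSectionVars false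
noncomputable section PartM5e

namespace Lf
open Sy Idx
variable {E : Type*} [NormedAddCommGroup E] [InnerProductSpace ℝ E] [FiniteDimensional ℝ E]

lemma mkL_hasDerivAt {a : ℝ → E × E} {a' : E × E} {b : ℝ → ℝ × ℝ} {b' : ℝ × ℝ} {t : ℝ}
    (ha : HasDerivAt a a' t) (hb : HasDerivAt b b' t) :
    HasDerivAt (fun t => mkL (a t, b t)) (mkL (a', b')) t :=
  HasFDerivAt.comp_hasDerivAt (F := (E × E) × (ℝ × ℝ)) (E := XX E × XX E) t
    (ContinuousLinearMap.hasFDerivAt (𝕜 := ℝ) (E := (E × E) × (ℝ × ℝ)) (F := XX E × XX E) mkL)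
    (ha.prodMk hb)

/-- derivative of the section -/
def dsec (p u : E × E) : XX E × XX E := mkL (u, (- ip p u / cc p, 0))

lemma sec_hasDerivAt {p : ℝ → E × E} {p' : E × E} {t : ℝ} (hp : HasDerivAt p p' t)
    (h : ip (p t) (p t) < 1 / Real.pi) : HasDerivAt (fun t => sec (p t)) (dsec (p t) p') t := by
  have h1 : HasDerivAt (fun t => cc (p t)) (- ip (p t) p' / cc (p t)) t := by
    have h2 := ((ip_hasDerivAt hp hp).const_sub (1 / Real.pi)).sqrt (by linarith : _ ≠ _)
    refine h2.congr_deriv ?_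
    rw [ip_comm p' (p t)]
    unfold cc
    have := cc_pos h
    unfold cc at this
    field_simp
    ring
  exact mkL_hasDerivAt hp (h1.prodMk (hasDerivAt_const t (0 : ℝ)))

lemma lift_deriv {k : E × E → ℝ} (hk : Differentiable ℝ k)
    (hl : ∀ w, w ≠ 0 → DifferentiableAt ℝ (lift k) w) {p X : E × E}
    (hp : ip p p < 1 / Real.pi) (hX : ∀ u, fderiv ℝ k p u = Om X u) (v : XX E × XX E) :
    fderiv ℝ (lift k) (sec p) v
      = Om ((Real.pi * (Om X p - 2 * k p)) • JJ (sec p) + dsec p X) v := by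
  have hc := cc_pos hp
  have hpi := Real.pi_pos
  have hne : sec p ≠ 0 := by
    intro h
    have h1 := N_sec hp
    rw [h] at h1
    have h2 : N (0 : XX E × XX E) = 0 := by simp [N, ip]
    rw [h2] at h1
    have : 0 < 1 / Real.pi := by positivity
    linarith
  have hD := (hl _ hne).hasFDerivAt
  set D := fderiv ℝ (lift k) (sec p) with hDdef
  have A1 : D (sec p) = 2 * k p := by
    have b1 : HasDerivAt (fun s : ℝ => (1 + s) • sec p) (sec p) 0 := by
      have := ((hasDerivAt_id (0 : ℝ)).const_add 1).smul_const (sec p)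
      simpa using this
    have hD' : HasFDerivAt (lift k) D ((1 + (0 : ℝ)) • sec p) := by simpa using hD
    have b2 := hD'.comp_hasDerivAt (0 : ℝ) b1
    have b3 : HasDerivAt (fun s : ℝ => (1 + s) ^ 2 * k p) (2 * k p) 0 := by
      have := (((hasDerivAt_id (0 : ℝ)).const_add 1).pow 2).mul_const (k p)
      simpa using this
    have b4 : (lift k ∘ fun s : ℝ => (1 + s) • sec p) = fun s : ℝ => (1 + s) ^ 2 * k p := by
      funext s; simp [lift_smul, lift_sec k hp]
    rw [b4] at b2
    exact b2.unique b3
  have A2 : D (JJ (sec p)) = 0 := by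
    have b1 := rot_hasDerivAt (hasDerivAt_id (0 : ℝ)) (hasDerivAt_const (0 : ℝ) (sec p))
    have b1' : HasDerivAt (fun s : ℝ => rot s (sec p)) (JJ (sec p)) 0 := by
      simpa [rot_zero] using b1
    have hD' : HasFDerivAt (lift k) D (rot (0 : ℝ) (sec p)) := by rw [rot_zero]; exact hD
    have b2 := hD'.comp_hasDerivAt (0 : ℝ) b1'
    have b4 : (lift k ∘ fun s : ℝ => rot s (sec p)) = fun s : ℝ => k p := by
      funext s; simp [lift_rot, lift_sec k hp]
    rw [b4] at b2
    exact b2.unique (hasDerivAt_const _ _)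
  have A3 : ∀ u, D (dsec p u) = Om X u := by
    intro u
    have b0 : HasDerivAt (fun s : ℝ => p + s • u) u 0 := by
      have := ((hasDerivAt_id (0 : ℝ)).smul_const u).const_add p
      simpa using this
    have b1 := sec_hasDerivAt b0 (by simpa using hp)
    simp only [zero_smul, add_zero] at b1
    have hD' : HasFDerivAt (lift k) D (sec (p + (0 : ℝ) • u)) := by simpa using hD
    have b2 := hD'.comp_hasDerivAt (0 : ℝ) b1
    have b3 : HasDerivAt (fun s : ℝ => k (p + s • u)) (Om X u) 0 := by
      rw [← hX]
      have h1 : HasFDerivAt k (fderiv ℝ k p) (p + (0 : ℝ) • u) := by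
        simpa using (hk p).hasFDerivAt
      exact h1.comp_hasDerivAt (0 : ℝ) b0
    have hev : (lift k ∘ fun s : ℝ => sec (p + s • u)) =ᶠ[nhds 0] fun s : ℝ => k (p + s • u) := by
      have c1 : Continuous (fun s : ℝ => ip (p + s • u) (p + s • u)) := by
        have : ContDiff ℝ 0 (fun s : ℝ => p + s • u) :=
          contDiff_const.add (contDiff_id.smul contDiff_const)
        exact (ip_contDiff this this).continuous
      have c2 : ∀ᶠ s : ℝ in nhds 0, ip (p + s • u) (p + s • u) < 1 / Real.pi :=
        c1.continuousAt.eventually_lt_const (by simpa using hp)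
      filter_upwards [c2] with s hs
      exact lift_sec k hs
    exact (b2.congr_of_eventuallyEq hev.symm).unique b3
  set a := Real.pi * ip (sec p) v with ha
  set b := (zt v).2 / cc p with hb
  set u := zp v - a • p - b • JJ p with hu
  have zps : zp (sec p) = p := rfl
  have zts : zt (sec p) = (cc p, 0) := rfl
  have hcs := cc_sq hp
  have hipv : ip (sec p) v = ip p (zp v) + cc p * (zt v).1 := by
    rw [ip_split, zps, zts]; simp [ip]; ring
  have hdec : v = a • sec p + b • JJ (sec p) + dsec p u := by
    have e1 : zp v = zp (a • sec p + b • JJ (sec p) + dsec p u) := by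
      have : zp (dsec p u) = u := rfl
      rw [map_add, map_add, map_smul, map_smul, zp_JJ, zps, this, hu]
      abel
    have hipu : ip p u = ip p (zp v) - a * ip p p := by
      have : u = zp v + (-a) • p + (-b) • JJ p := by rw [hu]; module
      rw [this]
      simp only [ip_add_right, ip_smul_right, ip_JJ]
      ring
    have e2 : zt v = zt (a • sec p + b • JJ (sec p) + dsec p u) := by
      have : zt (dsec p u) = (- ip p u / cc p, 0) := rfl
      rw [map_add, map_add, map_smul, map_smul, zt_JJ, zts, this]
      simp only [JJ]
      have f2 : (zt v).2 = b * cc p := by rw [hb]; field_simp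
      have f1 : (zt v).1 = a * cc p - ip p u / cc p := by
        rw [hipu]
        have g1 : a * (1 / Real.pi) = ip p (zp v) + cc p * (zt v).1 := by
          rw [ha, ← hipv]; field_simp
        have g2 : cc p * (zt v).1 = a * cc p ^ 2 - (ip p (zp v) - a * ip p p) := by
          rw [hcs]; linarith
        field_simp
        linarith
      ext
      · simp [f1]; ring
      · simp [f2]
    rw [← mkL_eta v, e1, e2, mkL_eta]
  have hL : D v = 2 * a * k p + Om X u := by
    conv_lhs => rw [hdec]
    rw [map_add, map_add, map_smul, map_smul, A1, A2, A3]
    simp; ring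
  have hXu : Om X u = Om X (zp v) - a * Om X p - b * ip X p := by
    have : u = zp v + (-a) • p + (-b) • JJ p := by rw [hu]; module
    rw [this]
    simp only [Om_add_right, Om_smul_right, Om_JJ_right]
    ring
  have hds : Om (dsec p X) v = Om X (zp v) - b * ip X p := by
    have q1 : zp (dsec p X) = X := rfl
    have q2 : zt (dsec p X) = (- ip p X / cc p, 0) := rfl
    rw [Om_split, q1, q2, ip_comm X p, hb]
    simp [Om]; ring
  rw [hL, Om_add_left, Om_smul_left, Om_JJ_left, hds, hXu, ha]
  ring

lemma lift_deriv_rot {k : E × E → ℝ}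
    (hl : ∀ w, w ≠ 0 → DifferentiableAt ℝ (lift k) w) {w : XX E × XX E} (hw : w ≠ 0)
    (α : ℝ) (v : XX E × XX E) :
    fderiv ℝ (lift k) (rot α w) v = fderiv ℝ (lift k) w (rot (-α) v) := by
  have h1 : lift k = fun w => lift k (rot (-α) w) := by funext w; rw [lift_rot]
  have hr : HasFDerivAt (fun w : XX E × XX E => rot (-α) w) (rotL (-α)) (rot α w) := by
    have : (fun w : XX E × XX E => rot (-α) w) = fun w => rotL (-α) w := by
      funext w; rw [rotL_apply]
    rw [this]
    exact (rotL (V := XX E) (-α)).hasFDerivAt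
  have hd : HasFDerivAt (lift k) (fderiv ℝ (lift k) w) (rot (-α) (rot α w)) := by
    rw [rot_inj']; exact (hl w hw).hasFDerivAt
  have h2 := hd.comp (rot α w) hr
  have h3 : HasFDerivAt (lift k) ((fderiv ℝ (lift k) w).comp (rotL (-α))) (rot α w) := by
    refine h2.congr_of_eventuallyEq ?_
    exact Filter.Eventually.of_forall fun w => (lift_rot k (-α) w).symm
  rw [h3.fderiv]
  simp [rotL_apply]

lemma N_hasFDerivAt (w : XX E × XX E) :
    ∃ L : XX E × XX E →L[ℝ] ℝ, HasFDerivAt (N (E := E)) L w ∧ ∀ v, L v = 2 * ip w v := by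
  have h := ((N_contDiff (E := E) (m := 1)).differentiable (by simp) w).hasFDerivAt
  refine ⟨_, h, fun v => ?_⟩
  have b0 : HasDerivAt (fun s : ℝ => w + s • v) v 0 := by
    have := ((hasDerivAt_id (0 : ℝ)).smul_const v).const_add w
    simpa using this
  have h' : HasFDerivAt (N (E := E)) (fderiv ℝ N w) (w + (0 : ℝ) • v) := by simpa using h
  have b1 := h'.comp_hasDerivAt (0 : ℝ) b0
  have b2 := ip_hasDerivAt b0 b0
  have b3 := b1.unique b2
  rw [b3]
  simp only [zero_smul, add_zero, ip_comm v w]; ring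

/-- the full lifted Hamiltonian -/
def full (θ : ℝ) (k : E × E → ℝ) (w : XX E × XX E) : ℝ := lift k w + θ / 2 * N w

lemma sgrad_full {k : E × E → ℝ} {θ : ℝ} {w Y : XX E × XX E}
    (hl : DifferentiableAt ℝ (lift k) w) (hY : ∀ v, fderiv ℝ (lift k) w v = Om Y v) :
    Disc.sgrad (fderiv ℝ (full θ k) w) = Y + (-θ) • JJ w := by
  apply Disc.sgrad_unique
  intro v
  obtain ⟨L, hL, e⟩ := N_hasFDerivAt w
  have h : HasFDerivAt (full θ k) (fderiv ℝ (lift k) w + (θ / 2) • L) w :=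
    hl.hasFDerivAt.add (hL.const_mul (θ / 2))
  rw [h.fderiv]
  change _ = Om (Y + (-θ) • JJ w) v
  rw [Om_add_left, Om_smul_left, Om_JJ_left, ← hY]
  have : (fderiv ℝ (lift k) w + (θ / 2) • L) v = fderiv ℝ (lift k) w v + θ / 2 * L v := rfl
  rw [this, e]
  ring

end Lf
end PartM5e

open Set
set_option linter.unusedSectionVars false
noncomputable section PartM5f

namespace Lf
open Sy Idx Fl

section generic
variable {E : Type*} [NormedAddCommGroup E] [InnerProductSpace ℝ E] [FiniteDimensional ℝ E]

/-- a time-dependent function on the ball all of whose trajectories starting on the zero section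
return to it with zero action -/
structure Good (k : ℝ → E × E → ℝ) : Prop where
  smooth : ContDiff ℝ (⊤ : ℕ∞) (fun q : ℝ × (E × E) => k q.1 q.2)
  supp : ∃ ρ, 0 ≤ ρ ∧ ρ < 1 / Real.pi ∧ ∀ t p, ρ < ip p p → k t p = 0
  orb : ∀ x : E, ip (x, (0 : E)) (x, 0) < 1 / Real.pi → ∃ p X : ℝ → E × E, ∃ β : ℝ → ℝ,
    p 0 = (x, 0) ∧ (p 1).2 = 0 ∧ β 0 = 0 ∧ β 1 = 0 ∧
    ∀ t, HasDerivAt p (X t) t ∧ ip (p t) (p t) < 1 / Real.pi ∧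
      (∀ u, fderiv ℝ (k t) (p t) u = Om (X t) u) ∧
      HasDerivAt β (Real.pi * (Om (X t) (p t) - 2 * k t (p t))) t

/-- integral curve of the symplectic gradient -/
def IsOrb (h : ℝ → XX E × XX E → ℝ) (W : ℝ → XX E × XX E) : Prop :=
  ∀ t, HasDerivAt W (Disc.sgrad (fderiv ℝ (h t) (W t))) t

lemma Good.diff {k : ℝ → E × E → ℝ} (hk : Good k) (t : ℝ) : Differentiable ℝ (k t) :=
  (hk.smooth.comp (contDiff_const.prodMk contDiff_id)).differentiable (by simp)

lemma Good.lift_diff {k : ℝ → E × E → ℝ} (hk : Good k) (t : ℝ) {w : XX E × XX E} (hw : w ≠ 0) :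
    DifferentiableAt ℝ (lift (k t)) w := by
  obtain ⟨ρ, _, hρ, h⟩ := hk.supp
  have h1 := lift_smooth (m := 1) k t hw
    (fun p => (hk.smooth.of_le (by exact_mod_cast le_top)).contDiffAt) hρ
    (Filter.Eventually.of_forall fun t p hp => h t p hp)
  have h2 : ContDiffAt ℝ 1 (fun w => (t, w)) w := contDiff_prodMk_right t |>.contDiffAt
  have h3 := ContDiffAt.comp w h1 h2
  exact h3.differentiableAt (by simp)

lemma N_zero : N (0 : XX E × XX E) = 0 := by simp [N, ip]

lemma orbit_core {k : ℝ → E × E → ℝ} (hk : Good k) (θ α0 : ℝ)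
    (x : E) (hx : ip (x, (0 : E)) (x, 0) < 1 / Real.pi) :
    ∃ W : ℝ → XX E × XX E,
      W 0 = rot α0 (sec (x, 0)) ∧ IsOrb (fun t => full θ (k t)) W ∧
      (∀ t, ip (W t) (W t) = 1 / Real.pi) ∧
      ∃ x1 : E, W 1 = rot (α0 - θ) (sec (x1, 0)) := by
  obtain ⟨p, X, β, hp0, hp1, hβ0, hβ1, ho⟩ := hk.orb x hx
  have hpB := fun t => (ho t).2.1
  have hpi := Real.pi_pos
  have hne : ∀ t, sec (p t) ≠ 0 := by
    intro t h
    have h1 := N_sec (hpB t)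
    rw [h, N_zero] at h1
    have : 0 < 1 / Real.pi := by positivity
    linarith
  have hip : ∀ (γ : ℝ) t, ip (rot γ (sec (p t))) (rot γ (sec (p t))) = 1 / Real.pi := by
    intro γ t; rw [ip_rot]; exact N_sec (hpB t)
  refine ⟨fun t => rot (α0 + β t - θ * t) (sec (p t)), ?_, ?_, fun t => hip _ t, (p 1).1, ?_⟩
  · simp only [hβ0, hp0]; simp
  · intro t
    obtain ⟨hd, _, hX, hβd⟩ := ho t
    set b := Real.pi * (Om (X t) (p t) - 2 * k t (p t)) with hb
    have hα : HasDerivAt (fun t => α0 + β t - θ * t) (b - θ) t := by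
      have := (hβd.const_add α0).fun_sub ((hasDerivAt_id t).const_mul θ)
      simpa using this
    have hs : HasDerivAt (fun t => sec (p t)) (dsec (p t) (X t)) t := sec_hasDerivAt hd (hpB t)
    have hW : HasDerivAt (fun t => rot (α0 + β t - θ * t) (sec (p t)))
        (rot (α0 + β t - θ * t) ((b - θ) • JJ (sec (p t)) + dsec (p t) (X t))) t :=
      rot_hasDerivAt (V := XX E) (w := fun t => sec (p t)) hα hs
    refine hW.congr_deriv ?_
    set γ := α0 + β t - θ * t with hγ
    have hne' : rot γ (sec (p t)) ≠ 0 := by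
      intro h
      have := hip γ t
      rw [h] at this
      simp [ip] at this
      linarith
    have hY : ∀ v, fderiv ℝ (lift (k t)) (rot γ (sec (p t))) v
        = Om (rot γ (b • JJ (sec (p t)) + dsec (p t) (X t))) v := by
      intro v
      rw [lift_deriv_rot (fun w hw => hk.lift_diff t hw) (hne t),
        lift_deriv (hk.diff t) (fun w hw => hk.lift_diff t hw) (hpB t) hX]
      conv_rhs => rw [← rot_inj γ v, Om_rot]
    rw [sgrad_full (hk.lift_diff t hne') hY, ← rot_JJ, ← rot_smul, ← rot_vadd]
    congr 1
    module
  · have e : p 1 = ((p 1).1, 0) := by ext1 <;> simp [hp1]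
    beta_reduce
    rw [← e, hβ1]
    congr 1; ring

lemma orbit_zero {k : ℝ → E × E → ℝ} (hk : Good k) (θ : ℝ)
    (w : XX E × XX E) (hw : w ≠ 0) (h0 : n0 w = 0) :
    IsOrb (fun t => full θ (k t)) (fun t => rot (-θ * t) w) := by
  intro t
  have hα : HasDerivAt (fun t => -θ * t) (-θ) t := by
    simpa using (hasDerivAt_id t).const_mul (-θ)
  have hW := rot_hasDerivAt hα (hasDerivAt_const t w)
  refine hW.congr_deriv ?_
  have hne : rot (-θ * t) w ≠ 0 := by
    intro h
    have h1 : N (rot (-θ * t) w) = N w := N_rot (-θ * t) w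
    rw [h, N_zero] at h1
    have h2 := N_pos hw
    linarith
  have hY : ∀ v, fderiv ℝ (lift (k t)) (rot (-θ * t) w) v = Om 0 v := by
    intro v
    obtain ⟨ρ, _, hρ, h⟩ := hk.supp
    have h1 := lift_zero_near k t hne (by rw [n0_rot, h0]) hρ
      (Filter.Eventually.of_forall fun t p hp => h t p hp)
    have h2 : Filter.Tendsto (fun w : XX E × XX E => (t, w)) (nhds (rot (-θ * t) w))
      (nhds (t, rot (-θ * t) w)) := (Continuous.prodMk_right t).tendsto _
    have h3 : lift (k t) =ᶠ[nhds (rot (-θ * t) w)] fun _ => 0 := h2.eventually h1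
    rw [h3.fderiv_eq, Om_zero_left]
    simp
  rw [sgrad_full (hk.lift_diff t hne) hY, ← rot_JJ, ← rot_smul, add_zero, zero_add]

end generic

variable {n : ℕ}

lemma quadNorm_eq (p : Phase n) : quadNorm p = ip p p := by
  simp [quadNorm, ip]

lemma supp_rho {K : ℝ → Phase n → ℝ} (hK : IsHamiltonian n K) :
    ∃ ρ, 0 ≤ ρ ∧ ρ < 1 / Real.pi ∧ ∀ t p, ρ < ip p p → K t p = 0 := by
  obtain ⟨S, hS, hSB, h0⟩ := hK.support
  have hc : Continuous (fun p : Phase n => ip p p) :=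
    (ip_contDiff (k := 0) contDiff_id contDiff_id).continuous
  rcases S.eq_empty_or_nonempty with h | h
  · refine ⟨0, le_rfl, by have := Real.pi_pos; positivity, fun t p _ => h0 t p (by simp [h])⟩
  · obtain ⟨p0, hp0, hmax⟩ := hS.exists_isMaxOn h hc.continuousOn
    refine ⟨ip p0 p0, ip_self_nonneg _, ?_, fun t p hp => h0 t p fun hpS => ?_⟩
    · have := hSB hp0
      simpa [BallB, quadNorm_eq] using this
    · have := hmax hpS
      simp only [mem_ofPred_eq] at this
      linarith

lemma dens_cont {K : ℝ → Phase n → ℝ} {g : ℝ → Phase n → Phase n}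
    (hK : IsHamiltonian n K) (hg : IsHamFlow n K g) (q : Phase n) : Continuous (dens K g q) := by
  have h1 : ContDiff ℝ (⊤ : ℕ∞) (fun t => g t q) :=
    hg.smooth.comp (contDiff_id.prodMk contDiff_const)
  have h2 : Continuous (fun t => hamVF K t (g t q)) := by
    have := h1.continuous_deriv (by simp)
    have e : deriv (fun t => g t q) = fun t => hamVF K t (g t q) := by
      funext t; exact (hg.deriv q t).deriv
    rwa [e] at this
  have h3 : Continuous (fun t => K t (g t q)) :=
    (hK.smooth.comp (contDiff_id.prodMk h1)).continuous
  have h4 : Continuous (fun t => Om (hamVF K t (g t q)) (g t q)) := by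
    have h5 := h1.continuous
    exact (h2.fst.inner h5.snd).sub (h2.snd.inner h5.fst)
  exact h4.sub (h3.const_mul 2)

lemma good_of_flow (hn : 1 ≤ n) {K : ℝ → Phase n → ℝ} {g : ℝ → Phase n → Phase n}
    (hK : IsHamiltonian n K) (hg : IsHamFlow n K g) (h1 : ∀ x, (g 1 (x, 0)).2 = 0) : Good K := by
  refine ⟨hK.smooth, supp_rho hK, fun x hx => ?_⟩
  refine ⟨fun t => g t (x, 0), fun t => hamVF K t (g t (x, 0)),
    fun t => Real.pi * ∫ s in (0:ℝ)..t, dens K g (x, 0) s, hg.init _, h1 x, by simp, ?_,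
    fun t => ⟨hg.deriv _ t, ?_, fun u => hamVF_spec (diff_t hK t _) u, ?_⟩⟩
  · simp only []; rw [action_zero hn hK hg h1]; simp
  · have := flow_ball hK hg (p := (x, 0)) (by simpa [BallB, quadNorm_eq] using hx) t
    simpa [BallB, quadNorm_eq] using this
  · exact ((dens_cont hK hg (x, 0)).integral_hasStrictDerivAt 0 t).hasDerivAt.const_mul _

end Lf
end PartM5f

open Set
set_option linter.unusedSectionVars false
noncomputable section PartM5g

namespace Lf
open Sy Idx
variable {E : Type*} [NormedAddCommGroup E] [InnerProductSpace ℝ E] [FiniteDimensional ℝ E]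

/-- scaled family -/
def ks (k : ℝ → E × E → ℝ) (s t : ℝ) (p : E × E) : ℝ := s ^ 2 * k t (s⁻¹ • p)

lemma ks_smooth {k : ℝ → E × E → ℝ} (hk : Good k) {s : ℝ} (hs : s ≠ 0) (t : ℝ) (p : E × E) :
    ContDiffAt ℝ (⊤ : ℕ∞) (fun z : (ℝ × ℝ) × (E × E) => ks k z.1.1 z.1.2 z.2) ((s, t), p) := by
  have h1 : ContDiffAt ℝ (⊤ : ℕ∞) (fun z : (ℝ × ℝ) × (E × E) => z.1.1) ((s, t), p) :=
    (contDiff_fst.comp contDiff_fst).contDiffAt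
  have h2 : ContDiffAt ℝ (⊤ : ℕ∞) (fun z : (ℝ × ℝ) × (E × E) => z.1.2) ((s, t), p) :=
    (contDiff_snd.comp contDiff_fst).contDiffAt
  have h3 : ContDiffAt ℝ (⊤ : ℕ∞) (fun z : (ℝ × ℝ) × (E × E) => z.1.1⁻¹ • z.2) ((s, t), p) :=
    (h1.inv hs).smul contDiff_snd.contDiffAt
  exact (h1.pow 2).mul (hk.smooth.contDiffAt.comp _ (h2.prodMk h3))

lemma ks_supp {k : ℝ → E × E → ℝ} {ρ : ℝ} (h : ∀ t p, ρ < ip p p → k t p = 0)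
    {s : ℝ} (hs : 0 < s) (t : ℝ) (p : E × E) (hp : s ^ 2 * ρ < ip p p) : ks k s t p = 0 := by
  unfold ks
  rw [h, mul_zero]
  rw [ip_smul_left, ip_smul_right]
  have : s⁻¹ * (s⁻¹ * ip p p) = ip p p / s ^ 2 := by field_simp
  rw [this, lt_div_iff₀ (by positivity)]
  linarith

lemma ks_good {k : ℝ → E × E → ℝ} (hk : Good k) {s : ℝ} (hs : 0 < s) (hs1 : s ≤ 1) :
    Good (ks k s) := by
  obtain ⟨ρ, hρ0, hρ, h⟩ := hk.supp
  have hs2 : s ^ 2 ≤ 1 := by nlinarith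
  have hsupp : ∀ t p, ρ < ip p p → ks k s t p = 0 := fun t p hp =>
    ks_supp h hs t p (lt_of_le_of_lt (by nlinarith) hp)
  refine ⟨?_, ⟨ρ, hρ0, hρ, hsupp⟩, fun x hx => ?_⟩
  · rw [contDiff_iff_contDiffAt]
    intro q
    have h1 : ContDiffAt ℝ (⊤ : ℕ∞) (fun q : ℝ × (E × E) => ((s, q.1), q.2)) q :=
      ((contDiff_const.prodMk contDiff_fst).prodMk contDiff_snd).contDiffAt
    have h2 := ContDiffAt.comp (g := fun z : (ℝ × ℝ) × (E × E) => ks k z.1.1 z.1.2 z.2)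
      q (ks_smooth hk hs.ne' q.1 q.2) h1
    exact h2
  have hsc : ∀ p : E × E, ip (s • p) (s • p) = s ^ 2 * ip p p := by
    intro p; rw [ip_smul_left, ip_smul_right]; ring
  have hfd : ∀ t p u, fderiv ℝ (ks k s t) (s • p) u = s * fderiv ℝ (k t) p u := by
    intro t p u
    have b1 : HasFDerivAt (fun p : E × E => s⁻¹ • p) (s⁻¹ • ContinuousLinearMap.id ℝ (E × E)) (s • p) :=
      (hasFDerivAt_id (s • p)).const_smul s⁻¹
    have b2 : HasFDerivAt (k t) (fderiv ℝ (k t) p) (s⁻¹ • s • p) := by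
      rw [smul_smul, inv_mul_cancel₀ hs.ne', one_smul]; exact (hk.diff t p).hasFDerivAt
    have b3 : HasFDerivAt (ks k s t) _ (s • p) := (b2.comp (s • p) b1).const_mul (s ^ 2)
    rw [b3.fderiv]
    simp
    field_simp
  have hxs : ((x, 0) : E × E) = s • (s⁻¹ • x, 0) := by simp [smul_smul, hs.ne']
  by_cases hin : ip (s⁻¹ • x, (0 : E)) (s⁻¹ • x, 0) < 1 / Real.pi
  · obtain ⟨p, X, β, hp0, hp1, hβ0, hβ1, ho⟩ := hk.orb _ hin
    refine ⟨fun t => s • p t, fun t => s • X t, fun t => s ^ 2 * β t, ?_, ?_, ?_, ?_, fun t => ?_⟩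
    · simp only [hp0]; exact hxs.symm
    · simp [hp1]
    · simp [hβ0]
    · simp [hβ1]
    · obtain ⟨o1, o2, o3, o4⟩ := ho t
      refine ⟨o1.const_smul s, ?_, fun u => ?_, ?_⟩
      · rw [hsc]
        nlinarith [ip_self_nonneg (p t)]
      · rw [hfd, o3, Om_smul_left]
      · refine (o4.const_mul (s ^ 2)).congr_deriv ?_
        rw [Om_smul_left, Om_smul_right]
        unfold ks
        rw [smul_smul, inv_mul_cancel₀ hs.ne', one_smul]
        ring
  · rw [not_lt] at hin
    have hz : ∀ t, ks k s t =ᶠ[nhds (x, 0)] fun _ => 0 := by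
      intro t
      have c1 : Continuous (fun p : E × E => ip p p) :=
        (ip_contDiff (k := 0) contDiff_id contDiff_id).continuous
      have c2 : ∀ᶠ p in nhds ((x, 0) : E × E), s ^ 2 * ρ < ip p p := by
        apply c1.continuousAt.eventually_const_lt
        beta_reduce
        rw [hxs, hsc]
        have : 0 < s ^ 2 := by positivity
        nlinarith
      filter_upwards [c2] with p hp using ks_supp h hs t p hp
    refine ⟨fun t => (x, 0), fun t => 0, fun t => 0, rfl, rfl, rfl, rfl, fun t =>
      ⟨hasDerivAt_const _ _, hx, fun u => ?_, ?_⟩⟩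
    · rw [(hz t).fderiv_eq, Om_zero_left]; simp
    · rw [Om_zero_left, (hz t).eq_of_nhds]
      simpa using hasDerivAt_const t (0 : ℝ)

lemma orbit_all {k : ℝ → E × E → ℝ} (hk : Good k) (x0 : XX E) (hx0 : ‖x0‖ = 1 / √Real.pi) :
    ∃ W : ℝ → XX E × XX E, W 0 = (x0, 0) ∧ IsOrb (fun t => full (1 / 2) (k t)) W ∧
      (∀ t, ip (W t) (W t) = 1 / Real.pi) ∧
      Real.sin (1 / 2) * (1 / √Real.pi) ≤ ‖(W 1).2‖ := by
  have hpi := Real.pi_pos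
  have hsq : ‖x0‖ ^ 2 = 1 / Real.pi := by rw [hx0, div_pow, Real.sq_sqrt hpi.le]; simp
  have hpp : 0 < 1 / Real.pi := by positivity
  have hsin : 0 < Real.sin (1 / 2) :=
    Real.sin_pos_of_pos_of_lt_pi (by norm_num) (by linarith [Real.pi_gt_three])
  have hend : ∀ (γ : ℝ) (y : XX E), |Real.sin γ| = Real.sin (1 / 2) → ip (y, 0) (y, 0) = 1 / Real.pi →
      Real.sin (1 / 2) * (1 / √Real.pi) ≤ ‖(rot γ (y, (0 : XX E))).2‖ := by
    intro γ y hγ hy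
    have e1 : (rot γ (y, (0 : XX E))).2 = Real.sin γ • y := by simp [rot, JJ]
    have e2 : ‖y‖ = 1 / √Real.pi := by
      have : ‖y‖ ^ 2 = 1 / Real.pi := by
        rw [← hy]; simp only [ip, real_inner_self_eq_norm_sq]; simp
      rw [← Real.sqrt_sq (norm_nonneg y), this, Real.sqrt_div zero_le_one, Real.sqrt_one]
    rw [e1, norm_smul, Real.norm_eq_abs, hγ, e2]
  have hne : x0 ≠ 0 := by
    intro h; rw [h] at hsq; simp at hsq; linarith
  have hip0 : ip (x0, (0 : XX E)) (x0, 0) = 1 / Real.pi := by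
    simp only [ip, real_inner_self_eq_norm_sq]; simp [hsq]
  have hdec : ‖x0.fst‖ ^ 2 + x0.snd ^ 2 = 1 / Real.pi := by
    rw [← hsq, WithLp.prod_norm_sq_eq_of_L2]; simp
  by_cases hξ : x0.snd = 0
  · refine ⟨fun t => rot (-(1 / 2) * t) (x0, 0), ?_, ?_, ?_, ?_⟩
    · simp [rot_zero]
    · refine orbit_zero hk (1 / 2) (x0, 0) ?_ ?_
      · intro h; exact hne (congrArg Prod.fst h)
      · have : zt (x0, (0 : XX E)) = (x0.snd, 0) := rfl
        rw [n0, this, hξ]; simp [ip]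
    · intro t; beta_reduce; rw [ip_rot, hip0]
    · refine hend _ x0 ?_ hip0
      rw [mul_one, Real.sin_neg, abs_neg, abs_of_pos hsin]
  · have hsnd : 0 < x0.snd ^ 2 := by positivity
    have main : ∀ (x : E) (α0 : ℝ), ‖x‖ = ‖x0.fst‖ →
        rot α0 (sec (x, 0)) = (x0, 0) → |Real.sin (α0 - 1 / 2)| = Real.sin (1 / 2) →
        ∃ W : ℝ → XX E × XX E, W 0 = (x0, 0) ∧ IsOrb (fun t => full (1 / 2) (k t)) W ∧
          (∀ t, ip (W t) (W t) = 1 / Real.pi) ∧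
          Real.sin (1 / 2) * (1 / √Real.pi) ≤ ‖(W 1).2‖ := by
      intro x α0 hx hr hs
      obtain ⟨W, w0, w1, w2, x1, w3⟩ := orbit_core hk (1 / 2) α0 x (by
        simp only [ip, real_inner_self_eq_norm_sq]; simp only [norm_zero, hx]
        linarith)
      refine ⟨W, w0.trans hr, w1, w2, ?_⟩
      have e : sec (x1, (0 : E)) = (WithLp.toLp 2 (x1, cc (x1, (0 : E))), (0 : XX E)) := rfl
      have h4 := w2 1
      rw [w3, ip_rot, e] at h4
      rw [w3, e]
      exact hend _ _ hs h4
    have hcc : ∀ x : E, ‖x‖ = ‖x0.fst‖ → cc (x, (0 : E)) = |x0.snd| := by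
      intro x hx
      have : 1 / Real.pi - ip (x, (0 : E)) (x, 0) = x0.snd ^ 2 := by
        simp only [ip, real_inner_self_eq_norm_sq]; simp only [norm_zero, hx]
        linarith
      rw [cc, this, Real.sqrt_sq_eq_abs]
    rcases lt_or_gt_of_ne hξ with hneg | hpos
    · refine main (-x0.fst) Real.pi (norm_neg _) ?_ ?_
      · rw [rot_pi, sec, hcc _ (norm_neg _), abs_of_neg hneg]
        have : mkL ((-x0.fst, (0 : E)), (-x0.snd, (0 : ℝ))) = -(x0, (0 : XX E)) := by
          have := map_neg (mkL (E := E)) ((x0.fst, (0 : E)), (x0.snd, (0 : ℝ)))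
          simp only [Prod.neg_mk, neg_zero] at this
          rw [this]; rfl
        rw [this, neg_neg]
      · rw [Real.sin_pi_sub, abs_of_pos hsin]
    · refine main x0.fst 0 rfl ?_ ?_
      · rw [rot_zero, sec, hcc _ rfl, abs_of_pos hpos]; rfl
      · rw [zero_sub, Real.sin_neg, abs_neg, abs_of_pos hsin]

end Lf
end PartM5g

open Set
set_option linter.unusedSectionVars false
noncomputable section PartM5h

namespace Lf
open Sy Idx
variable {E : Type*} [NormedAddCommGroup E] [InnerProductSpace ℝ E] [FiniteDimensional ℝ E]

lemma good_bdd {k : ℝ → E × E → ℝ} (hk : Good k) :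
    ∃ C, 0 ≤ C ∧ ∀ t ∈ Icc (0 : ℝ) 1, ∀ p, k t p ≤ C := by
  obtain ⟨ρ, hρ0, hρ, h⟩ := hk.supp
  have c1 : Continuous (fun p : E × E => ip p p) :=
    (ip_contDiff (k := 0) contDiff_id contDiff_id).continuous
  have hcpt : IsCompact {p : E × E | ip p p ≤ ρ} := by
    refine Metric.isCompact_of_isClosed_isBounded (isClosed_le c1 continuous_const) ?_
    refine (Metric.isBounded_closedBall (x := (0 : E × E)) (r := ρ + 1)).subset fun p hp => ?_
    rw [mem_closedBall_zero_iff]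
    have h1 := (ip_self_norm p).1
    have h2 : ip p p ≤ ρ := hp
    nlinarith [norm_nonneg p]
  have hc2 := (isCompact_Icc (a := (0 : ℝ)) (b := 1)).prod hcpt
  obtain ⟨C, hC⟩ := hc2.exists_bound_of_continuousOn hk.smooth.continuous.continuousOn
  refine ⟨max C 0, le_max_right _ _, fun t ht p => ?_⟩
  by_cases hp : ip p p ≤ ρ
  · have := hC (t, p) ⟨ht, hp⟩
    rw [Real.norm_eq_abs] at this
    exact ((le_abs_self _).trans this).trans (le_max_left _ _)
  · rw [h t p (not_le.mp hp)]; exact le_max_right _ _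

lemma full_smul (θ : ℝ) (k : E × E → ℝ) (c : ℝ) (w : XX E × XX E) :
    full θ k (c • w) = c ^ 2 * full θ k w := by
  simp only [full, lift_smul, N_smul]; ring

lemma full_smooth {k : ℝ → E × E → ℝ} (hk : Good k) (θ : ℝ) {s : ℝ} (hs : 0 < s) (hs1 : s ≤ 1)
    (t : ℝ) {w : XX E × XX E} (hw : w ≠ 0) :
    ContDiffAt ℝ 2 (fun q : ℝ × ℝ × (XX E × XX E) => full θ (ks k q.1 q.2.1) q.2.2) (s, t, w) := by
  obtain ⟨ρ, hρ0, hρ, h⟩ := hk.supp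
  obtain ⟨ρ', hρ1, hρ2⟩ := exists_between hρ
  have hs2 : s ^ 2 ≤ 1 := by nlinarith
  have h1 := lift_smooth (m := 2) (fun q : ℝ × ℝ => ks k q.1 q.2) (s, t) hw
    (fun p => (ks_smooth hk hs.ne' t p).of_le (WithTop.coe_le_coe.mpr le_top)) hρ2 (by
      have c1 : ContinuousAt (fun q : ℝ × ℝ => q.1 ^ 2 * ρ) (s, t) := by fun_prop
      have c2 : ∀ᶠ q : ℝ × ℝ in nhds (s, t), q.1 ^ 2 * ρ < ρ' :=
        c1.eventually_lt_const (lt_of_le_of_lt (by simp only []; nlinarith) hρ1)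
      have c3 : ∀ᶠ q : ℝ × ℝ in nhds (s, t), 0 < q.1 :=
        continuous_fst.continuousAt.eventually_const_lt hs
      filter_upwards [c2, c3] with q h2 h3 p hp
      exact ks_supp h h3 q.2 p (h2.trans hp))
  have e1 : ContDiff ℝ 2 (fun q : ℝ × ℝ × (XX E × XX E) => ((q.1, q.2.1), q.2.2)) := by fun_prop
  have h2 := ContDiffAt.comp
    (g := fun z : (ℝ × ℝ) × (XX E × XX E) => lift (ks k z.1.1 z.1.2) z.2)
    (s, t, w) h1 e1.contDiffAt
  have h3 : ContDiffAt ℝ 2 (fun q : ℝ × ℝ × (XX E × XX E) => θ / 2 * N q.2.2) (s, t, w) :=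
    (contDiff_const.mul (N_contDiff.comp (contDiff_snd.comp contDiff_snd))).contDiffAt
  exact h2.add h3

lemma N_eq (w : XX E × XX E) : N w = ‖w.1‖ ^ 2 + ‖w.2‖ ^ 2 := by
  simp only [N, ip, real_inner_self_eq_norm_sq]

lemma n0_eq (w : XX E × XX E) : n0 w = w.1.snd ^ 2 + w.2.snd ^ 2 := by
  have : zt w = (w.1.snd, w.2.snd) := rfl
  rw [n0, this]; simp [ip, sq]

lemma N_sub (w : XX E × XX E) : N w - n0 w = ‖w.1.fst‖ ^ 2 + ‖w.2.fst‖ ^ 2 := by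
  have : zp w = (w.1.fst, w.2.fst) := rfl
  rw [N, ip_split, n0, this]; simp [ip]

theorem good_contra {k : ℝ → E × E → ℝ} (hk : Good k) {J : ℕ} {M R : ℝ} (hM : 0 ≤ M)
    (hlow : ∀ t ∈ Icc (0 : ℝ) 1, ∀ p, ip p p < 1 / Real.pi →
      -M + R * (1 - Real.pi * ip p p) ≤ k t p)
    (hJ : 2 * Real.pi * M < J)
    (hR : 8 * ((Module.finrank ℝ E * J + 1 : ℕ) : ℝ) ≤ 2 * Real.pi * R - 2 * Real.pi * M) :
    False := by
  have hpi := Real.pi_pos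
  obtain ⟨C, hC0, hC⟩ := good_bdd hk
  set a : ℝ := 1 / (1 + 4 * Real.pi * C) with ha
  have hden : 1 ≤ 1 + 4 * Real.pi * C := by
    have : 0 ≤ 4 * Real.pi * C := by positivity
    linarith
  have ha0 : 0 < a := by positivity
  have ha1 : a ≤ 1 := by rw [ha, div_le_one (by linarith)]; exact hden
  have haC : Real.pi * a ^ 2 * C ≤ 1 / 4 := by
    have h1 : a * (1 + 4 * Real.pi * C) = 1 := by rw [ha]; field_simp
    have h2 : Real.pi * C * a ≤ 1 / 4 := by nlinarith
    have h3 : 0 ≤ Real.pi * C * a := by positivity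
    nlinarith
  set h : ℝ → ℝ → XX E × XX E → ℝ := fun s t w => full (1 / 2) (ks k s t) w with hh
  have hom : Disc.HomHam a h (fun s t w => fderiv ℝ (h s t) w) := by
    refine Disc.homHam_of_smooth h ?_ ?_
    · intro s hs t _ w hw
      exact full_smooth hk (1 / 2) (ha0.trans_le hs.1) hs.2 t hw
    · intro s _ t _ c w
      exact full_smul _ _ c w
  have horb : Disc.Orbits a (fun s t w => fderiv ℝ (h s t) w) := by
    refine ⟨1 / √Real.pi, 1 / 4, 1, Real.sin (1 / 2) * (1 / √Real.pi), by positivity, by norm_num,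
      ?_, ?_⟩
    · have := Real.sin_pos_of_pos_of_lt_pi (x := 1 / 2) (by norm_num)
        (by linarith [Real.pi_gt_three])
      positivity
    · intro s hs x0 hx0
      obtain ⟨W, w0, w1, w2, w3⟩ := orbit_all (ks_good hk (ha0.trans_le hs.1) hs.2) x0 hx0
      refine ⟨W, w0, fun t _ => w1 t, fun t _ => ?_, w3⟩
      obtain ⟨n1, n2⟩ := ip_self_norm (W t)
      rw [w2 t] at n1 n2
      have p1 : 1 / Real.pi ≤ 1 := by
        rw [div_le_one hpi]; linarith [Real.pi_gt_three]
      have p2 : 1 / 8 ≤ 1 / Real.pi := by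
        apply one_div_le_one_div_of_le hpi; linarith [Real.pi_lt_four]
      have := norm_nonneg (W t)
      constructor <;> nlinarith
  obtain ⟨N0, hrel⟩ := Disc.rel_act ha1 hom horb
  refine index_contra (E := E) (J := J) (A := 2 * Real.pi * M)
    (κ := 2 * Real.pi * R - 2 * Real.pi * M) (by positivity) hJ rfl hR (h 1) (h a) ?_ ?_
    ⟨N0, hrel⟩
  · intro t ht w
    rw [← n0_eq, ← N_sub]
    have e1 : ks k 1 t = k t := by funext p; simp [ks]
    have hNn : 0 ≤ N w := (n0_nonneg w).trans (n0_le_N w)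
    have h2 : Real.pi * R * n0 w - Real.pi * M * N w ≤ lift (k t) w := by
      unfold lift
      split_ifs with h0
      · rw [h0]
        have : 0 ≤ Real.pi * M * N w := by positivity
        linarith
      · have hn0 : 0 < n0 w := lt_of_le_of_ne (n0_nonneg w) (Ne.symm h0)
        have hN : 0 < N w := hn0.trans_le (n0_le_N w)
        have hip := ip_pp hn0
        have hlt : ip (pp w) (pp w) < 1 / Real.pi := by
          rw [hip]
          have : (N w - n0 w) / N w < 1 := by rw [div_lt_one hN]; linarith
          have h5 : 0 < 1 / Real.pi := by positivity
          nlinarith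
        have h3 := hlow t ht (pp w) hlt
        have e3 : 1 - Real.pi * ip (pp w) (pp w) = n0 w / N w := by
          rw [hip]; field_simp; ring
        rw [e3] at h3
        have h4 := mul_le_mul_of_nonneg_left h3 (by positivity : 0 ≤ Real.pi * N w)
        have e4 : Real.pi * N w * (-M + R * (n0 w / N w))
          = Real.pi * R * n0 w - Real.pi * M * N w := by field_simp; ring
        linarith
    simp only [hh, full, e1]
    nlinarith
  · intro t ht w
    rw [← N_eq]
    have hNn : 0 ≤ N w := (n0_nonneg w).trans (n0_le_N w)
    have h2 : lift (ks k a t) w ≤ 1 / 4 * N w := by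
      unfold lift
      split_ifs with h0
      · positivity
      · unfold ks
        have h3 := hC t ht (a⁻¹ • pp w)
        have h4 : Real.pi * N w * (a ^ 2 * k t (a⁻¹ • pp w)) ≤ Real.pi * N w * (a ^ 2 * C) := by
          gcongr
        nlinarith
    simp only [hh, full]
    nlinarith

end Lf
end PartM5h

open Set
set_option linter.unusedSectionVars false
noncomputable section PartM6

namespace Rad
open Sy Fl Lf

section gen
variable {V : Type*} [NormedAddCommGroup V] [InnerProductSpace ℝ V]

lemma rot_contDiff {F : Type*} [NormedAddCommGroup F] [NormedSpace ℝ F] {a : F → ℝ} {w : F → V × V}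
    {k : WithTop ℕ∞} (ha : ContDiff ℝ k a) (hw : ContDiff ℝ k w) :
    ContDiff ℝ k (fun x => rot (a x) (w x)) := by
  have h := (ha.cos.smul hw).add (ha.sin.smul ((JL (V := V)).contDiff.comp hw))
  exact h

lemma rot_hasFDerivAt {F : Type*} [NormedAddCommGroup F] [NormedSpace ℝ F] {a : F → ℝ}
    {w : F → V × V} {a' : F →L[ℝ] ℝ} {w' : F →L[ℝ] V × V} {x : F}
    (ha : HasFDerivAt a a' x) (hw : HasFDerivAt w w' x) :
    ∃ L : F →L[ℝ] V × V, HasFDerivAt (fun x => rot (a x) (w x)) L x ∧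
      ∀ v, L v = rot (a x) (w' v) + a' v • JJ (rot (a x) (w x)) := by
  have h := (ha.cos.smul hw).add (ha.sin.smul ((JL (V := V)).hasFDerivAt.comp x hw))
  refine ⟨_, h, fun v => ?_⟩
  simp [rot, JJ_add, JJ_smul, JJ_JJ, JL_apply]
  module

lemma ip_hasFDerivAt (q : V × V) : ∃ L : V × V →L[ℝ] ℝ, HasFDerivAt (fun p => ip p p) L q ∧
    ∀ v, L v = 2 * ip q v := by
  have h := ((hasFDerivAt_fst (𝕜 := ℝ) (p := q)).inner ℝ (hasFDerivAt_fst (𝕜 := ℝ) (p := q))).add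
    ((hasFDerivAt_snd (𝕜 := ℝ) (p := q)).inner ℝ (hasFDerivAt_snd (𝕜 := ℝ) (p := q)))
  refine ⟨_, h, fun v => ?_⟩
  simp [ip, real_inner_comm]
  ring

/-- radial flow -/
def rad (f : ℝ → ℝ) (t : ℝ) (p : V × V) : V × V := rot (-(2 * t * deriv f (ip p p))) p

lemma ip_rad (f : ℝ → ℝ) (t : ℝ) (p : V × V) : ip (rad f t p) (rad f t p) = ip p p := ip_rot _ _ _

lemma rad_inv (f : ℝ → ℝ) (t : ℝ) (p : V × V) : rad f t (rad f (-t) p) = p := by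
  unfold rad
  rw [ip_rot, rot_add]
  convert rot_zero p using 2
  ring

lemma rad_inv' (f : ℝ → ℝ) (t : ℝ) (p : V × V) : rad f (-t) (rad f t p) = p := by
  have := rad_inv f (-t) p
  rwa [neg_neg] at this

variable {f : ℝ → ℝ} (hf : ContDiff ℝ (⊤ : ℕ∞) f)
include hf

lemma df_smooth : ContDiff ℝ (⊤ : ℕ∞) (deriv f) := by
  rw [show ((⊤ : ℕ∞) : WithTop ℕ∞) = ((⊤ : ℕ∞) : WithTop ℕ∞) + 1 from rfl] at hf
  exact (contDiff_succ_iff_deriv.mp hf).2.2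

lemma rad_smooth {F : Type*} [NormedAddCommGroup F] [NormedSpace ℝ F] {τ : F → ℝ} {w : F → V × V}
    (hτ : ContDiff ℝ (⊤ : ℕ∞) τ) (hw : ContDiff ℝ (⊤ : ℕ∞) w) :
    ContDiff ℝ (⊤ : ℕ∞) (fun x => rad f (τ x) (w x)) := by
  have h1 := (df_smooth hf).comp (ip_contDiff hw hw)
  exact rot_contDiff ((contDiff_const.mul hτ).mul h1).neg hw

lemma rad_hasFDerivAt (t : ℝ) (q : V × V) : ∃ L : V × V →L[ℝ] V × V,
    HasFDerivAt (rad f t) L q ∧ ∀ v, L v = rot (-(2 * t * deriv f (ip q q))) v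
      - (4 * t * deriv (deriv f) (ip q q) * ip q v) • JJ (rad f t q) := by
  obtain ⟨L, hL, hLv⟩ := ip_hasFDerivAt q
  have h1 : HasDerivAt (deriv f) (deriv (deriv f) (ip q q)) (ip q q) :=
    ((df_smooth hf).differentiable (by simp) _).hasDerivAt
  have h2 := ((HasDerivAt.comp_hasFDerivAt (f := fun p : V × V => ip p p) q h1 hL).const_mul (2 * t)).neg
  obtain ⟨L2, h3, h4⟩ := rot_hasFDerivAt h2 (hasFDerivAt_id q)
  refine ⟨L2, h3, fun v => ?_⟩
  rw [h4]
  simp [hLv, rad]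
  module

lemma f_hasFDerivAt (q : V × V) : ∃ L : V × V →L[ℝ] ℝ,
    HasFDerivAt (fun p => f (ip p p)) L q ∧ ∀ v, L v = 2 * deriv f (ip q q) * ip q v := by
  obtain ⟨L, hL, hLv⟩ := ip_hasFDerivAt q
  have h1 : HasDerivAt f (deriv f (ip q q)) (ip q q) :=
    (hf.differentiable (by simp) _).hasDerivAt
  refine ⟨_, HasDerivAt.comp_hasFDerivAt (f := fun p : V × V => ip p p) q h1 hL, fun v => ?_⟩
  simp [hLv]; ring

/-- derivative of `rad f t (w t)` along a curve -/
lemma rad_curve {w : ℝ → V × V} {w' : V × V} {t : ℝ} (c : ℝ) (hw : HasDerivAt w w' t) :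
    HasDerivAt (fun s => rad f (c * s) (w s)) (rot (-(2 * (c * t) * deriv f (ip (w t) (w t))))
      ((-(2 * c * deriv f (ip (w t) (w t)) + 4 * (c * t) * deriv (deriv f) (ip (w t) (w t)) *
        ip (w t) w')) • JJ (w t) + w')) t := by
  have h1 : HasDerivAt (deriv f) (deriv (deriv f) (ip (w t) (w t))) (ip (w t) (w t)) :=
    ((df_smooth hf).differentiable (by simp) _).hasDerivAt
  have h2 := h1.comp t (ip_hasDerivAt hw hw)
  have h3 := (((hasDerivAt_id t).const_mul c).const_mul 2).fun_mul h2
  have h4 := rot_hasDerivAt h3.neg hw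
  refine HasDerivAt.congr_deriv (f' := _) h4 ?_
  simp only [id, Function.comp]
  congr 2
  rw [ip_comm w']
  congr 1
  ring

end gen

variable {n : ℕ}

lemma ball_compact (ρ : ℝ) : IsCompact {p : Phase n | ip p p ≤ ρ} := by
  have hc : Continuous (fun p : Phase n => ip p p) :=
    (ip_contDiff (k := 0) contDiff_id contDiff_id).continuous
  refine Metric.isCompact_of_isClosed_isBounded (isClosed_le hc continuous_const) ?_
  refine (Metric.isBounded_closedBall (x := (0 : Phase n)) (r := |ρ| + 1)).subset fun p hp => ?_
  rw [mem_closedBall_zero_iff]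
  have h1 := (ip_self_norm p).1
  have h2 : ip p p ≤ ρ := hp
  have := le_abs_self ρ
  have := abs_nonneg ρ
  nlinarith [norm_nonneg p]

lemma isHam_of_rho {K : ℝ → Phase n → ℝ} (hs : ContDiff ℝ (⊤ : ℕ∞) (fun q : ℝ × Phase n => K q.1 q.2))
    {ρ : ℝ} (hρ : ρ < 1 / Real.pi) (h0 : ∀ t p, ρ < ip p p → K t p = 0) : IsHamiltonian n K := by
  refine ⟨hs, _, ball_compact ρ, fun p hp => ?_, fun t p hp => h0 t p ?_⟩
  · have h2 : ip p p ≤ ρ := hp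
    have : quadNorm p < 1 / Real.pi := by rw [quadNorm_eq]; linarith
    exact this
  · exact not_le.mp hp

section comp
variable {f : ℝ → ℝ} (hf : ContDiff ℝ (⊤ : ℕ∞) f) {ρ : ℝ} (hρ : ρ < 1 / Real.pi)
  (h0 : ∀ r, ρ < r → f r = 0)
include hf hρ h0

lemma F_ham : IsHamiltonian n (fun _ p => f (ip p p)) := by
  refine isHam_of_rho ?_ hρ (fun t p hp => h0 _ hp)
  exact hf.comp (ip_contDiff contDiff_snd contDiff_snd)

lemma F_flow : IsHamFlow n (fun _ p => f (ip p p)) (rad f) := by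
  refine ⟨fun p => by simp [rad, rot_zero], fun p t => ?_, rad_smooth hf contDiff_fst contDiff_snd⟩
  have h1 := rad_curve hf 1 (hasDerivAt_const t p)
  simp only [one_mul] at h1
  refine HasDerivAt.congr_deriv (f' := _) h1 ?_
  symm
  obtain ⟨L, hL, hLv⟩ := f_hasFDerivAt hf (rad f t p)
  apply hamVF_unique hL.differentiableAt
  intro v
  rw [hL.fderiv, hLv, ip_rad]
  have e0 : ip p 0 = 0 := by simp [ip]
  rw [e0, rot_vadd, rot_smul, rot_JJ, Om_add_left, Om_smul_left, Om_JJ_left]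
  have e1 : rot (-(2 * t * deriv f (ip p p))) (0 : Phase n) = 0 := by simp [rot, JJ]
  rw [e1, Om_zero_left]
  change _ = -(2 * 1 * deriv f (ip p p) + _) * -ip (rad f t p) v + 0
  ring

variable {H : ℝ → Phase n → ℝ} {ψ : ℝ → Phase n → Phase n} (hH : IsHamiltonian n H)
  (hψ : IsHamFlow n H ψ)
include hH hψ

lemma K_ham : IsHamiltonian n (fun t p => H t (rad f t p) - f (ip p p)) := by
  obtain ⟨ρ', _, hρ', h0'⟩ := supp_rho hH
  refine isHam_of_rho ?_ (max_lt hρ hρ') (fun t p hp => ?_)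
  · have h1 := hH.smooth.comp
      ((contDiff_fst (𝕜 := ℝ)).prodMk (rad_smooth hf contDiff_fst contDiff_snd))
    have h2 := hf.comp (ip_contDiff (contDiff_snd (𝕜 := ℝ) (E := ℝ) (F := Phase n)) contDiff_snd)
    exact h1.sub h2
  · rw [h0 _ ((le_max_left _ _).trans_lt hp), h0' _ _ (by
      rw [ip_rad]; exact (le_max_right _ _).trans_lt hp), sub_zero]

lemma K_flow : IsHamFlow n (fun t p => H t (rad f t p) - f (ip p p))
    (fun t p => rad f (-t) (ψ t p)) := by
  refine ⟨fun p => by simp [rad, rot_zero, hψ.init], fun p t => ?_,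
    rad_smooth hf contDiff_fst.neg hψ.smooth⟩
  have h1 := rad_curve hf (-1) (hψ.deriv p t)
  simp only [neg_one_mul] at h1
  refine HasDerivAt.congr_deriv (f' := _) h1 ?_
  symm
  set w := ψ t p with hw
  set q := rad f (-t) w with hq
  have hqw : rad f t q = w := rad_inv f t w
  have hip : ip q q = ip w w := ip_rad f (-t) w
  obtain ⟨L, hL, hLv⟩ := f_hasFDerivAt hf q
  obtain ⟨L2, hL2, hL2v⟩ := rad_hasFDerivAt hf t q
  have hd := (diff_t hH t (rad f t q))
  have hK := (hd.hasFDerivAt.comp q hL2).sub hL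
  have hK' : HasFDerivAt (fun p => H t (rad f t p) - f (ip p p))
    ((fderiv ℝ (H t) (rad f t q)).comp L2 - L) q := hK
  apply hamVF_unique hK'.differentiableAt
  intro v
  rw [hK'.fderiv, sub_apply, ContinuousLinearMap.comp_apply, hamVF_spec hd, hLv, hL2v, hip, hqw]
  rw [rot_vadd, rot_smul, rot_JJ, Om_add_left, Om_smul_left]
  have e1 : rot (-(2 * -t * deriv f (ip w w))) w = q := rfl
  rw [e1, Om_JJ_left, sub_eq_add_neg (rot _ _), Om_add_right, ← neg_smul, Om_smul_right, Om_JJ_right]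
  have e2 : Om (rot (-(2 * -t * deriv f (ip w w))) (hamVF H t w)) v
      = Om (hamVF H t w) (rot (-(2 * t * deriv f (ip w w))) v) := by
    rw [← Om_rot (2 * t * deriv f (ip w w)) _ (rot _ v), rot_inj]
    congr 2; ring
  rw [e2, ip_comm w (hamVF H t w)]
  ring

lemma K_pres (h1 : ψ 1 '' L0 n = rad f 1 '' L0 n) (x) : (rad f (-1) (ψ 1 (x, 0))).2 = 0 := by
  by_cases hx : ((x, 0) : Phase n) ∈ BallB n
  · have h2 : ψ 1 (x, 0) ∈ rad f 1 '' L0 n := by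
      rw [← h1]; exact mem_image_of_mem _ ⟨hx, rfl⟩
    obtain ⟨q, hq, e⟩ := h2
    rw [← e, rad_inv']; exact hq.2
  · rw [flow_out hH hψ hx, flow_out (F_ham hf hρ h0) (F_flow hf hρ h0) hx]

end comp

lemma exists_profile (R : ℝ) (hR : 0 < R) : ∃ f : ℝ → ℝ, ContDiff ℝ (⊤ : ℕ∞) f ∧
    ∃ ρ, ρ < 1 / Real.pi ∧ (∀ r, ρ < r → f r = 0) ∧
      ∀ r, 0 ≤ r → f r ≤ 1 - R * (1 - Real.pi * r) := by
  have hpi := Real.pi_pos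
  set a : ℝ := 1 - 1 / R with ha
  set b : ℝ := 1 - 1 / (2 * R) with hb
  have hab : a < b := by
    have : 1 / (2 * R) < 1 / R := by
      apply one_div_lt_one_div_of_lt hR; linarith
    rw [ha, hb]; linarith
  refine ⟨fun r => R * (Real.smoothTransition ((Real.pi * r - a) / (b - a)) - 1), ?_, b / Real.pi, ?_, ?_, ?_⟩
  · have : ContDiff ℝ (⊤ : ℕ∞) (fun r : ℝ => (Real.pi * r - a) / (b - a)) := by fun_prop
    have h2 := (Real.smoothTransition.contDiff (n := (⊤ : ℕ∞))).comp this
    exact contDiff_const.mul (h2.sub contDiff_const)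
  · have : b < 1 := by rw [hb]; have : 0 < 1 / (2 * R) := by positivity
                       linarith
    gcongr
  · intro r hr
    rw [div_lt_iff₀ hpi] at hr
    have : 1 ≤ (Real.pi * r - a) / (b - a) := by
      rw [le_div_iff₀ (by linarith)]; linarith
    beta_reduce
    rw [Real.smoothTransition.one_of_one_le this]; ring
  · intro r hr
    beta_reduce
    rcases le_or_gt (Real.pi * r) a with h | h
    · rw [Real.smoothTransition.zero_of_nonpos]
      · have : 0 ≤ R * (Real.pi * r) := by positivity
        linarith
      · exact div_nonpos_of_nonpos_of_nonneg (by linarith) (by linarith)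
    · have h1 := Real.smoothTransition.le_one ((Real.pi * r - a) / (b - a))
      have h2 : R * (Real.smoothTransition ((Real.pi * r - a) / (b - a)) - 1) ≤ 0 :=
        mul_nonpos_of_nonneg_of_nonpos hR.le (by linarith)
      have h3 : R * (1 - Real.pi * r) ≤ R * (1 / R) := by
        apply mul_le_mul_of_nonneg_left _ hR.le
        linarith
      rw [mul_one_div_cancel hR.ne'] at h3
      linarith
end Rad
end PartM6

open Set
set_option linter.unusedSectionVars false
noncomputable section PartM7

namespace Rep
open Sy Fl Lf Rad

lemma exists_tau {u : ℝ → ℝ} (hu : ContDiff ℝ (⊤ : ℕ∞) u) {ε : ℝ} (hε : 0 < ε)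
    (hpos : ∀ t, ε ≤ u t) : ∃ τ : ℝ → ℝ, ContDiff ℝ (⊤ : ℕ∞) τ ∧ τ 0 = 0 ∧ τ 1 = 1 ∧
      StrictMono τ ∧ ∀ t, deriv τ t * u (τ t) = ∫ s in (0:ℝ)..1, u s := by
  set G : ℝ → ℝ := fun x => ∫ s in (0:ℝ)..x, u s with hG
  have hd : ∀ x, HasDerivAt G (u x) x := fun x =>
    (hu.continuous.integral_hasStrictDerivAt 0 x).hasDerivAt
  have hGs : ContDiff ℝ (⊤ : ℕ∞) G := by
    rw [contDiff_infty_iff_deriv]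
    refine ⟨fun x => (hd x).differentiableAt, ?_⟩
    rw [show deriv G = u from funext fun x => (hd x).deriv]; exact hu
  have hup : ∀ t, 0 < u t := fun t => hε.trans_le (hpos t)
  have hmono : StrictMono G := strictMono_of_hasDerivAt_pos hd hup
  have hG0 : G 0 = 0 := by simp [hG]
  have hm2 : Monotone (fun x => G x - ε * x) := by
    refine monotone_of_hasDerivAt_nonneg (f' := fun x => u x - ε * 1)
      (fun x => (hd x).fun_sub ((hasDerivAt_id x).const_mul ε)) (fun x => ?_)
    have := hpos x
    simp only [Pi.zero_apply]; linarith
  have hsurj : Function.Surjective G := by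
    refine Continuous.surjective hGs.continuous ?_ ?_
    · refine Filter.tendsto_atTop_mono' _ ?_ (Filter.tendsto_id.const_mul_atTop hε)
      filter_upwards [Filter.eventually_ge_atTop 0] with x hx
      have := hm2 hx
      simp only [hG0] at this
      simp only [id]; linarith
    · refine Filter.tendsto_atBot_mono' _ ?_ (Filter.tendsto_id.const_mul_atBot hε)
      filter_upwards [Filter.eventually_le_atBot 0] with x hx
      have := hm2 hx
      simp only [hG0] at this
      simp only [id]; linarith
  set e : ℝ ≃o ℝ := hmono.orderIsoOfSurjective G hsurj with he
  have heG : ∀ x, e.symm (G x) = x := fun x => e.symm_apply_apply x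
  have heG' : ∀ x, G (e.symm x) = x := fun x => e.apply_symm_apply x
  have hes : ContDiff ℝ (⊤ : ℕ∞) (e.symm : ℝ → ℝ) :=
    e.toHomeomorph.contDiff_symm_deriv (f' := u) (fun x => (hup x).ne') hd hGs
  have hG1 : 0 < G 1 := by rw [← hG0]; exact hmono one_pos
  have hτ : ContDiff ℝ (⊤ : ℕ∞) (fun t => e.symm (G 1 * t)) :=
    hes.comp (contDiff_const.mul contDiff_id)
  refine ⟨fun t => e.symm (G 1 * t), hτ, ?_, ?_, ?_, fun t => ?_⟩
  · simp only [mul_zero]; have := heG 0; rwa [hG0] at this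
  · simp only [mul_one]; exact heG 1
  · exact e.symm.strictMono.comp fun a b h => mul_lt_mul_of_pos_left h hG1
  · have h1 : HasDerivAt (fun t => e.symm (G 1 * t)) (deriv (fun t => e.symm (G 1 * t)) t) t :=
      (hτ.differentiable (by simp) t).hasDerivAt
    have h2 := (hd (e.symm (G 1 * t))).comp t h1
    have h3 : HasDerivAt (fun t => G 1 * t) (G 1 * 1) t := (hasDerivAt_id t).const_mul _
    have h4 : (G ∘ fun t => e.symm (G 1 * t)) = fun t => G 1 * t := funext fun t => heG' _
    rw [h4] at h2
    have := h2.unique h3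
    rw [mul_comm, this, mul_one]

lemma exists_u {o : ℝ → ℝ} (ho : Continuous o) (h0 : ∀ t, 0 ≤ o t) :
    ∃ u : ℝ → ℝ, ContDiff ℝ (⊤ : ℕ∞) u ∧ (∀ t, 1 / 4 ≤ u t) ∧ (∀ t ∈ Icc (0 : ℝ) 1, o t ≤ u t) ∧
      ∫ t in (0:ℝ)..1, u t ≤ (∫ t in (0:ℝ)..1, o t) + 1 := by
  have hsc : Continuous (fun t => Real.sqrt (o t)) := ho.sqrt
  obtain ⟨S, hS⟩ := (isCompact_Icc (a := (0:ℝ)) (b := 1)).bddAbove_image hsc.continuousOn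
  have hS' : ∀ t ∈ Icc (0:ℝ) 1, Real.sqrt (o t) ≤ S := fun t ht => hS (mem_image_of_mem _ ht)
  have hS0 : 0 ≤ S := (Real.sqrt_nonneg _).trans (hS' 0 (by simp))
  set η : ℝ := 1 / (8 * (S + 1)) with hη
  have hη0 : 0 < η := by positivity
  have hηS : η * (S + 1) = 1 / 8 := by rw [hη]; field_simp
  obtain ⟨P, hP⟩ := exists_polynomial_near_of_continuousOn 0 1 (fun t => Real.sqrt (o t) + η)
    (by fun_prop) η hη0
  have hPs : ContDiff ℝ (⊤ : ℕ∞) (fun t => P.eval t) := by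
    simpa using Polynomial.contDiff_aeval P (𝕜 := ℝ) (⊤ : ℕ∞)
  have hus : ContDiff ℝ (⊤ : ℕ∞) (fun t => P.eval t ^ 2 + 1 / 4) := (hPs.pow 2).add contDiff_const
  refine ⟨fun t => P.eval t ^ 2 + 1 / 4, hus, ?_, ?_, ?_⟩
  · intro t; nlinarith [sq_nonneg (P.eval t)]
  · intro t ht
    have h1 := abs_lt.mp (hP t ht)
    have h2 := Real.sq_sqrt (h0 t)
    have h3 := Real.sqrt_nonneg (o t)
    nlinarith
  · rw [show (∫ t in (0:ℝ)..1, o t) + 1 = ∫ t in (0:ℝ)..1, (o t + 1) by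
      rw [intervalIntegral.integral_add (ho.intervalIntegrable _ _) (by simp)]; simp]
    refine intervalIntegral.integral_mono_on (by norm_num) (hus.continuous.intervalIntegrable _ _)
      ((ho.add continuous_const).intervalIntegrable _ _) fun t ht => ?_
    have h1 := abs_lt.mp (hP t ht)
    have h2 := Real.sq_sqrt (h0 t)
    have h3 := Real.sqrt_nonneg (o t)
    have h4 := hS' t ht
    have h5 : P.eval t ≤ Real.sqrt (o t) + 2 * η := by linarith
    have h6 : 0 ≤ P.eval t := by linarith
    have h7 : P.eval t ^ 2 ≤ (Real.sqrt (o t) + 2 * η) ^ 2 := by gcongr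
    have h8 : η * Real.sqrt (o t) ≤ η * S := by gcongr
    have h9 : η ≤ 1 / 8 := by nlinarith
    have h10 : 0 ≤ η * S := by positivity
    nlinarith

variable {n : ℕ}

lemma exists_osc (hn : 1 ≤ n) {H : ℝ → Phase n → ℝ} (hH : IsHamiltonian n H) :
    ∃ o : ℝ → ℝ, Continuous o ∧ (∀ t, 0 ≤ o t) ∧ (∀ t p, |H t p| ≤ o t) ∧
      oscNorm n H = ∫ t in (0:ℝ)..1, o t := by
  obtain ⟨ρ, hρ0, hρ, h0⟩ := supp_rho hH
  have hpi : 1 / Real.pi < 1 := by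
    rw [div_lt_one Real.pi_pos]; linarith [Real.pi_gt_three]
  set p0 : Phase n := (EuclideanSpace.single ⟨0, hn⟩ 1, 0) with hp0
  have hip0 : ip p0 p0 = 1 := by simp [hp0, ip]
  have hr : ∀ t, range (H t) = H t '' {p | ip p p ≤ 1} := by
    intro t
    apply subset_antisymm
    · rintro _ ⟨p, rfl⟩
      by_cases hp : ip p p ≤ 1
      · exact mem_image_of_mem _ hp
      · refine ⟨p0, hip0.le, ?_⟩
        rw [h0 t p0 (by linarith), h0 t p (by linarith)]
    · exact image_subset_range _ _
  have hc : Continuous (Function.HasUncurry.uncurry H) := hH.smooth.continuous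
  have c1 := (ball_compact (n := n) 1).continuous_sSup hc
  have c2 := (ball_compact (n := n) 1).continuous_sInf hc
  have hb : ∀ t, BddAbove (range (H t)) ∧ BddBelow (range (H t)) := by
    intro t
    rw [hr]
    have := (ball_compact (n := n) 1).image (smooth_t hH t).continuous
    exact ⟨this.bddAbove, this.bddBelow⟩
  have hz : ∀ t, H t p0 = 0 := fun t => h0 t p0 (by linarith)
  have hs : ∀ t p, |H t p| ≤ (⨆ p, H t p) - ⨅ p, H t p := by
    intro t p
    have a1 := le_ciSup (hb t).1 p
    have a2 := ciInf_le (hb t).2 p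
    have a3 := le_ciSup (hb t).1 p0
    have a4 := ciInf_le (hb t).2 p0
    rw [hz] at a3 a4
    rw [abs_le]; constructor <;> linarith
  refine ⟨fun t => (⨆ p, H t p) - ⨅ p, H t p, ?_, fun t => ?_, hs, rfl⟩
  · have := c1.sub c2
    simp only [← hr] at this
    exact this
  · exact (abs_nonneg _).trans (hs t p0)

theorem reparam (hn : 1 ≤ n) {H : ℝ → Phase n → ℝ} {ψ : ℝ → Phase n → Phase n}
    (hH : IsHamiltonian n H) (hψ : IsHamFlow n H ψ) {M : ℝ} (hM : oscNorm n H ≤ M) :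
    ∃ H' ψ', IsHamiltonian n H' ∧ IsHamFlow n H' ψ' ∧ ψ' 1 = ψ 1 ∧
      ∀ t ∈ Icc (0 : ℝ) 1, ∀ p, |H' t p| ≤ M + 1 := by
  obtain ⟨o, ho, ho0, hoH, hosc⟩ := exists_osc hn hH
  obtain ⟨u, hu, hu4, huo, hui⟩ := exists_u ho ho0
  obtain ⟨τ, hτ, hτ0, hτ1, hτm, hτd⟩ := exists_tau hu (by norm_num) hu4
  have hdτ : ContDiff ℝ (⊤ : ℕ∞) (deriv τ) := (contDiff_infty_iff_deriv.mp hτ).2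
  refine ⟨fun t p => deriv τ t * H (τ t) p, fun t => ψ (τ t), ⟨?_, ?_⟩, ⟨?_, ?_, ?_⟩, ?_, ?_⟩
  · have h1 : ContDiff ℝ (⊤ : ℕ∞) (fun q : ℝ × Phase n => deriv τ q.1) := hdτ.comp contDiff_fst
    have h2 : ContDiff ℝ (⊤ : ℕ∞) (fun q : ℝ × Phase n => H (τ q.1) q.2) :=
      hH.smooth.comp ((hτ.comp contDiff_fst).prodMk contDiff_snd)
    exact h1.mul h2
  · obtain ⟨K, hK, hKB, h0⟩ := hH.support
    exact ⟨K, hK, hKB, fun t p hp => by rw [h0 _ _ hp, mul_zero]⟩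
  · intro p; rw [hτ0]; exact hψ.init p
  · intro p t
    have h1 : HasDerivAt τ (deriv τ t) t := (hτ.differentiable (by simp) t).hasDerivAt
    have h2 := (hψ.deriv p (τ t)).scomp t h1
    refine HasDerivAt.congr_deriv (f' := _) h2 ?_
    symm
    have hd := (diff_t hH (τ t) (ψ (τ t) p))
    have hd' : HasFDerivAt (fun p => deriv τ t * H (τ t) p)
      (deriv τ t • fderiv ℝ (H (τ t)) (ψ (τ t) p)) (ψ (τ t) p) := hd.hasFDerivAt.const_mul _
    apply hamVF_unique hd'.differentiableAt
    intro v
    rw [hd'.fderiv, smul_apply, hamVF_spec hd, Om_smul_left, smul_eq_mul]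
  · exact hψ.smooth.comp ((hτ.comp contDiff_fst).prodMk contDiff_snd)
  · beta_reduce; rw [hτ1]
  · intro t ht p
    have h1 : τ t ∈ Icc (0:ℝ) 1 := by
      constructor
      · rw [← hτ0]; exact hτm.monotone ht.1
      · rw [← hτ1]; exact hτm.monotone ht.2
    have hd0 : 0 ≤ deriv τ t := hτm.monotone.deriv_nonneg
    rw [abs_mul, abs_of_nonneg hd0]
    calc deriv τ t * |H (τ t) p| ≤ deriv τ t * u (τ t) := by
          gcongr; exact (hoH _ _).trans (huo _ h1)
      _ = _ := hτd t
      _ ≤ M + 1 := by linarith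
end Rep
end PartM7

open Set
set_option linter.unusedSectionVars false
noncomputable section PartM8

namespace Fin8
open Sy Fl Lf Rad Rep

lemma osc_nonneg {n : ℕ} (hn : 1 ≤ n) {H : ℝ → Phase n → ℝ} (hH : IsHamiltonian n H) :
    0 ≤ oscNorm n H := by
  obtain ⟨o, ho, ho0, -, e⟩ := exists_osc hn hH
  rw [e]
  exact intervalIntegral.integral_nonneg (by norm_num) fun t _ => ho0 t

theorem main (n : ℕ) (hn : 1 ≤ n) :
    ∀ R : ℝ, 0 < R → ∃ φ ∈ Ham n, R < lagd n (L0 n) (φ '' L0 n) := by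
  intro R hR
  have hpi := Real.pi_pos
  set M : ℝ := R + 3 with hM
  obtain ⟨J, hJ⟩ := exists_nat_gt (2 * Real.pi * M)
  set A : ℝ := 8 * ((Module.finrank ℝ (EuclideanSpace ℝ (Fin n)) * J + 1 : ℕ) : ℝ) with hA
  have hA0 : 0 ≤ A := by positivity
  set R' : ℝ := (A + 2 * Real.pi * M) / (2 * Real.pi) with hR'
  have hM0 : 0 < M := by linarith
  have hR'0 : 0 < R' := by positivity
  have hR'1 : 2 * Real.pi * R' = A + 2 * Real.pi * M := by rw [hR']; field_simp
  obtain ⟨f, hf, ρ, hρ, h0, hlow⟩ := exists_profile R' hR'0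
  have hmem : rad f 1 ∈ Ham n := ⟨_, _, F_ham hf hρ h0, F_flow hf hρ h0, rfl⟩
  refine ⟨rad f 1, hmem, ?_⟩
  by_contra hcon
  rw [not_lt] at hcon
  have hlt : lagd n (L0 n) (rad f 1 '' L0 n) < R + 1 := by linarith
  obtain ⟨c, ⟨g, hg, hgL, rfl⟩, hc⟩ := exists_lt_of_csInf_lt (s := {c | ∃ g ∈ Ham n,
    g '' L0 n = rad f 1 '' L0 n ∧ c = hoferNorm n g}) ⟨_, rad f 1, hmem, rfl, rfl⟩ hlt
  obtain ⟨H0, ψ0, hH0, hψ0, hg1⟩ := hg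
  obtain ⟨c, ⟨H, ψ, hH, hψ, hψ1, rfl⟩, hc⟩ := exists_lt_of_csInf_lt (s := {c | ∃ H φ,
    IsHamiltonian n H ∧ IsHamFlow n H φ ∧ φ 1 = g ∧ c = oscNorm n H})
    ⟨_, H0, ψ0, hH0, hψ0, hg1, rfl⟩ hc
  obtain ⟨H', ψ', hH', hψ', h1, hb⟩ := reparam hn hH hψ hc.le
  have hL : ψ' 1 '' L0 n = rad f 1 '' L0 n := by rw [h1, hψ1, hgL]
  have hgood := good_of_flow hn (K_ham hf hρ h0 hH' hψ') (K_flow hf hρ h0 hH' hψ')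
    (K_pres hf hρ h0 hH' hψ' hL)
  refine good_contra hgood (J := J) (M := M) (R := R') hM0.le (fun t ht p _ => ?_) hJ ?_
  · have a1 := (abs_le.mp (hb t ht (rad f t p))).1
    have a2 := hlow (ip p p) (ip_self_nonneg p)
    linarith
  · rw [hR'1, ← hA]; linarith
end Fin8
end PartM8

/-- the metric space (𝓛, d) is unbounded. -/
theorem lagrangian_hofer_distance_unbounded (n : ℕ) (hn : 1 ≤ n) :
    ∀ R : ℝ, 0 < R → ∃ φ ∈ Ham n, R < lagd n (L0 n) (φ '' L0 n) := by
  exact Fin8.main n hn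

end
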